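/- Let δ ∈ (0,1) and define h(n) = δ^{ω(n)}, where ω(n) denotes the number of distinct prime factors of n. Then h ∈ 𝓜; that is, h is multiplicative and satisfies all four conditions (i)–(iv) defining the class 𝓜. -/

import Mathlib

open Filter Finset MeasureTheory
open scoped Classical Pointwise

noncomputable section

/-- The set of primes in `[1, x]`. -/
def primesUpTo (x : ℝ) : Finset ℕ := (Finset.Icc 1 ⌊x⌋₊).filter Nat.Prime

/-- The mean value `S_h(x) = (1/x) ∑_{1 ≤ n ≤ x} h(n)`. -/
def Sm (h : ℕ → ℝ) (x : ℝ) : ℝ := (1 / x) * ∑ n ∈ Finset.Icc 1 ⌊x⌋₊, h n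

/-- The mean value `S_h(x; q, a) = (q/x) ∑_{1 ≤ n ≤ x, n ≡ a (q)} h(n)`. -/
def SmAP (h : ℕ → ℝ) (x : ℝ) (q : ℕ) (a : ℤ) : ℝ :=
  ((q : ℝ) / x) * ∑ n ∈ Finset.Icc 1 ⌊x⌋₊,
    if ((n : ℤ) : ZMod q) = (a : ZMod q) then h n else 0

/-- `∏_{p ≤ x, p ∤ q} (1 + |h(p)|/p)`. -/
def ppProd (h : ℕ → ℝ) (x : ℝ) (q : ℕ) : ℝ :=
  ∏ p ∈ (primesUpTo x).filter (fun p => ¬ p ∣ q), (1 + |h p| / p)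

/-- `h` is multiplicative. -/
def MultFn (h : ℕ → ℝ) : Prop :=
  h 1 = 1 ∧ ∀ m n : ℕ, Nat.Coprime m n → h (m * n) = h m * h n

/-- Condition (i) of the class `𝓜`, with explicit constant `H`. -/
def CondI (h : ℕ → ℝ) (H : ℝ) : Prop :=
  1 ≤ H ∧ ∀ p k : ℕ, p.Prime → 1 ≤ k → |h (p ^ k)| ≤ H ^ k

/-- Condition (ii) of the class `𝓜`: `|h(n)| ≪_ε n^ε`. -/
def CondII (h : ℕ → ℝ) : Prop :=
  ∀ ε : ℝ, 0 < ε → ∃ C : ℝ, 0 < C ∧ ∀ n : ℕ, 1 ≤ n → |h n| ≤ C * (n : ℝ) ^ ε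

/-- Condition (iii) of the class `𝓜`, with explicit constant `α`. -/
def CondIII (h : ℕ → ℝ) (α : ℝ) : Prop :=
  0 < α ∧ ∃ x₀ : ℝ, ∀ x ≥ x₀, α ≤ (1 / x) * ∑ p ∈ primesUpTo x, |h p| * Real.log p

/-- Condition (iv) of the class `𝓜`: stability of mean values in progressions. -/
def CondIV (h : ℕ → ℝ) : Prop :=
  ∀ C : ℝ, 0 < C → ∃ φ : ℝ → ℝ, Tendsto φ atTop (nhds 0) ∧
    ∃ K : ℝ, 0 < K ∧ ∃ x₀ : ℝ, ∀ x ≥ x₀, ∀ x' : ℝ, ∀ q : ℕ, ∀ A : ℤ,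
      x * (Real.log x) ^ (-C) < x' → x' < x →
      1 ≤ q → (q : ℝ) < (Real.log x) ^ C → Int.gcd (q : ℤ) A = 1 →
      |SmAP h x' q A - SmAP h x q A| ≤
        K * φ x * ((q : ℝ) / (Nat.totient q : ℝ)) * (1 / Real.log x) * ppProd h x q

/-- The class `𝓜` of multiplicative functions. -/
def MemM (h : ℕ → ℝ) : Prop :=
  MultFn h ∧ (∃ H, CondI h H) ∧ CondII h ∧ (∃ α, CondIII h α) ∧ CondIV h

/-- An admissible choice of the function `w`:
`log log x / log log log x < w(x) ≤ log log x` for all large `x`. -/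
def GoodW (w : ℝ → ℝ) : Prop :=
  ∃ x₀ : ℝ, ∀ x ≥ x₀,
    Real.log (Real.log x) / Real.log (Real.log (Real.log x)) < w x ∧
    w x ≤ Real.log (Real.log x)

/-- `W(x) = ∏_{p ≤ w(x)} p`. -/
def Wprod (w : ℝ → ℝ) (x : ℝ) : ℕ := ∏ p ∈ primesUpTo (w x), p

/-- The completely multiplicative function `n ↦ n ^ a`. -/
def natRpow (a : ℝ) : ℕ →* ℝ where
  toFun n := (n : ℝ) ^ a
  map_one' := by simp
  map_mul' m n := by
    simp only [Nat.cast_mul]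
    exact Real.mul_rpow (Nat.cast_nonneg _) (Nat.cast_nonneg _)

lemma natRpow_apply (a : ℝ) (n : ℕ) : natRpow a n = (n : ℝ) ^ a := rfl

/-- Finite Euler product. -/
def PP (a : ℝ) (N : ℕ) : ℝ := ∏ p ∈ N.primesBelow, (1 - (p : ℝ) ^ a)⁻¹

lemma rpow_prime_lt_one {a : ℝ} (ha : a < 0) {p : ℕ} (hp : p.Prime) : (p : ℝ) ^ a < 1 :=
  Real.rpow_lt_one_of_one_lt_of_neg (by exact_mod_cast hp.one_lt) ha

lemma zeta_sum_le (a : ℝ) (ha : 0 < a) (s : Finset ℕ) :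
    ∑ n ∈ s, (n : ℝ) ^ (-(1 + a)) ≤ 1 + 1 / a := by
  obtain ⟨N, hN⟩ := s.exists_nat_subset_range
  have h1 : ∑ n ∈ s, (n : ℝ) ^ (-(1 + a)) ≤ ∑ n ∈ range (N + 2), (n : ℝ) ^ (-(1 + a)) := by
    apply Finset.sum_le_sum_of_subset_of_nonneg
    · intro n hn
      have := hN hn
      simp at this ⊢; omega
    · intros; positivity
  refine h1.trans ?_
  rw [Finset.sum_range_succ', Finset.sum_range_succ']
  have h0 : ((0 : ℕ) : ℝ) ^ (-(1 + a)) = 0 := by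
    simp only [Nat.cast_zero]
    exact Real.zero_rpow (by linarith)
  have hanti : AntitoneOn (fun x : ℝ => x ^ (-(1 + a))) (Set.Icc 1 (1 + (N : ℕ))) := by
    intro x hx y hy hxy
    exact Real.rpow_le_rpow_of_nonpos (by linarith [hx.1]) hxy (by linarith)
  have h2 := hanti.sum_le_integral
  rw [integral_rpow (Or.inr ⟨by linarith, by
    rw [Set.uIcc_of_le (by linarith [Nat.cast_nonneg (α := ℝ) N])]
    intro h; linarith [h.1]⟩)] at h2
  have h3 : ((1 + (N : ℝ)) ^ (-(1 + a) + 1) - (1 : ℝ) ^ (-(1 + a) + 1)) / (-(1 + a) + 1) ≤ 1 / a := by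
    have e1 : -(1 + a) + 1 = -a := by ring
    rw [e1, Real.one_rpow, div_neg, ← neg_div]
    apply div_le_div_of_nonneg_right _ ha.le
    have : 0 ≤ (1 + (N : ℝ)) ^ (-a) := by positivity
    linarith
  rw [h0]
  have e2 : ∑ k ∈ range N, (((k + 1 + 1 : ℕ)) : ℝ) ^ (-(1 + a))
      = ∑ i ∈ range N, (1 + ((i + 1 : ℕ) : ℝ)) ^ (-(1 + a)) := by
    apply Finset.sum_congr rfl
    intro i _
    congr 1
    push_cast; ring
  rw [e2]
  have e3 : (((0 + 1 : ℕ)) : ℝ) ^ (-(1 + a)) = 1 := by simp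
  rw [e3]
  linarith

lemma smooth_hasSum {a : ℝ} (ha : a < 0) (N : ℕ) :
    HasSum (fun m : N.smoothNumbers => ((m : ℕ) : ℝ) ^ a) (PP a N) := by
  have := (EulerProduct.summable_and_hasSum_smoothNumbers_prod_primesBelow_geometric
    (f := natRpow a) (fun {p} hp => by
      rw [natRpow_apply, Real.norm_of_nonneg (by positivity)]
      exact rpow_prime_lt_one ha hp) N).2
  exact this

lemma smooth_sum_le {a : ℝ} (ha : a < 0) (N : ℕ) (s : Finset ℕ) (hs : ∀ n ∈ s, n ∈ N.smoothNumbers) :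
    ∑ n ∈ s, (n : ℝ) ^ a ≤ PP a N := by
  have h := smooth_hasSum ha N
  have := sum_le_hasSum (s.subtype (· ∈ N.smoothNumbers)) (fun i _ => by positivity) h
  refine le_trans (le_of_eq ?_) this
  rw [Finset.sum_subtype_of_mem (fun n : ℕ => (n : ℝ) ^ a) hs]

lemma PP_pos {a : ℝ} (ha : a < 0) (N : ℕ) : 0 < PP a N := by
  apply Finset.prod_pos
  intro p hp
  have := rpow_prime_lt_one ha (Nat.prime_of_mem_primesBelow hp)
  apply inv_pos.mpr; linarith

lemma PP_le_zeta (a : ℝ) (ha : 0 < a) (N : ℕ) : PP (-(1 + a)) N ≤ 1 + 1 / a := by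
  have h := smooth_hasSum (a := -(1 + a)) (by linarith) N
  rw [← h.tsum_eq]
  refine h.summable.tsum_le_of_sum_le fun s => ?_
  have := zeta_sum_le a ha (s.map ⟨Subtype.val, Subtype.val_injective⟩)
  rwa [Finset.sum_map] at this

lemma sum_inv_ge_log (N : ℕ) (hN : 1 ≤ N) : Real.log N ≤ ∑ n ∈ Icc 1 (N - 1), (n : ℝ)⁻¹ := by
  have h := log_add_one_le_harmonic (N - 1)
  rw [Nat.sub_add_cancel hN] at h
  rw [harmonic_eq_sum_Icc] at h
  push_cast at h
  exact h

lemma sum_inv_le_log (N : ℕ) : ∑ n ∈ Icc 1 N, (n : ℝ)⁻¹ ≤ 1 + Real.log N := by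
  have h := harmonic_le_one_add_log N
  rw [harmonic_eq_sum_Icc] at h
  push_cast at h
  exact h

lemma PP_ge (a : ℝ) (ha : 0 ≤ a) (N : ℕ) (hN : 1 ≤ N) :
    (N : ℝ) ^ (-a) * Real.log N ≤ PP (-(1 + a)) N := by
  have h := smooth_sum_le (a := -(1 + a)) (by linarith) N (Icc 1 (N - 1)) (fun n hn => by
    simp at hn
    exact Nat.mem_smoothNumbers_of_lt (by omega) (by omega))
  refine le_trans ?_ h
  calc (N : ℝ) ^ (-a) * Real.log N ≤ (N : ℝ) ^ (-a) * ∑ n ∈ Icc 1 (N - 1), (n : ℝ)⁻¹ := by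
        gcongr; exact sum_inv_ge_log N hN
    _ = ∑ n ∈ Icc 1 (N - 1), (N : ℝ) ^ (-a) * (n : ℝ)⁻¹ := Finset.mul_sum _ _ _
    _ ≤ _ := by
        apply Finset.sum_le_sum
        intro n hn
        simp at hn
        have hn0 : (0 : ℝ) < n := by exact_mod_cast hn.1
        rw [neg_add, Real.rpow_add hn0, Real.rpow_neg_one, mul_comm]
        gcongr (n : ℝ)⁻¹ * ?_
        apply Real.rpow_le_rpow_of_nonpos hn0 _ (by linarith)
        have : n ≤ N := by omega
        exact_mod_cast this

lemma log_le_PP (N : ℕ) (hN : 1 ≤ N) : Real.log N ≤ PP (-1) N := by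
  have := PP_ge 0 le_rfl N hN
  simpa using this

/-- `∏_{p ∣ q} (1 + 1/p) ≤ 1 + log q`. -/
lemma prod_primeFactors_le (q : ℕ) (hq : 1 ≤ q) :
    ∏ p ∈ q.primeFactors, (1 + (p : ℝ)⁻¹) ≤ 1 + Real.log q := by
  rw [Finset.prod_one_add]
  have : ∑ t ∈ q.primeFactors.powerset, ∏ i ∈ t, ((i : ℕ) : ℝ)⁻¹
      = ∑ n ∈ q.primeFactors.powerset.image (fun t => ∏ i ∈ t, i), (n : ℝ)⁻¹ := by
    rw [Finset.sum_image]
    · apply Finset.sum_congr rfl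
      intro t _
      push_cast
      rw [Finset.prod_inv_distrib]
    · intro s hs t ht hst
      simp at hs ht hst
      have := congrArg Nat.primeFactors hst
      rwa [Nat.primeFactors_prod (fun p hp => Nat.prime_of_mem_primeFactors (hs hp)),
        Nat.primeFactors_prod (fun p hp => Nat.prime_of_mem_primeFactors (ht hp))] at this
  rw [this]
  refine le_trans (Finset.sum_le_sum_of_subset_of_nonneg ?_ ?_) (sum_inv_le_log q)
  · intro n hn
    simp at hn
    obtain ⟨t, ht, rfl⟩ := hn
    have h1 : ∏ i ∈ t, i ∣ q :=
      (Finset.prod_dvd_prod_of_subset _ _ _ ht).trans (Nat.prod_primeFactors_dvd q)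
    have h2 := Nat.le_of_dvd hq h1
    have h3 := Nat.pos_of_dvd_of_pos h1 hq
    simp; omega
  · intros; positivity

lemma PP_rankin (N : ℕ) (a : ℝ) (ha : 0 < a) (ha' : a ≤ 1/4) (hN : (N : ℝ) ^ a ≤ Real.exp 1) :
    PP (-1 + a) N ≤ (1 + 1 / a) ^ 24 := by
  have h1 := PP_le_zeta a ha N
  have h0 := PP_pos (a := -(1+a)) (by linarith) N
  refine le_trans ?_ (pow_le_pow_left₀ h0.le h1 24)
  unfold PP
  rw [← Finset.prod_pow]
  apply Finset.prod_le_prod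
  · intro p hp
    have := rpow_prime_lt_one (a := -1 + a) (by linarith) (Nat.prime_of_mem_primesBelow hp)
    apply inv_nonneg.mpr; linarith
  intro p hp
  have hpp := Nat.prime_of_mem_primesBelow hp
  have hpN : p < N := Nat.lt_of_mem_primesBelow hp
  have hp0 : (0 : ℝ) < p := by exact_mod_cast hpp.pos
  have hp2 : (2 : ℝ) ≤ p := by exact_mod_cast hpp.two_le
  set w := (p : ℝ) ^ (-1 + a) with hw
  set v := (p : ℝ) ^ (-(1 + a)) with hv
  have hv0 : 0 < v := by positivity
  have hv1 : v < 1 := rpow_prime_lt_one (by linarith) hpp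
  have hw0 : 0 < w := by positivity
  have hwv : w ≤ 8 * v := by
    have : w = ((p : ℝ) ^ a * (p : ℝ) ^ a) * v := by
      rw [hw, hv, ← Real.rpow_add hp0, ← Real.rpow_add hp0]; congr 1; ring
    rw [this]
    have hpa : (p : ℝ) ^ a ≤ Real.exp 1 := by
      refine le_trans (Real.rpow_le_rpow hp0.le ?_ ha.le) hN
      exact_mod_cast hpN.le
    have he : Real.exp 1 < 2.7182818286 := Real.exp_one_lt_d9
    have hpa0 : 0 ≤ (p : ℝ) ^ a := by positivity
    have : (p : ℝ) ^ a * (p : ℝ) ^ a ≤ 8 := by nlinarith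
    nlinarith
  have hw23 : w ≤ 2 / 3 := by
    have h5 : w ≤ (2 : ℝ) ^ (-1 + a) := by
      apply Real.rpow_le_rpow_of_nonpos (by norm_num) hp2 (by linarith)
    have h6 : (2 : ℝ) ^ (-1 + a) ≤ (2 : ℝ) ^ (-(3/4 : ℝ)) := by
      apply Real.rpow_le_rpow_of_exponent_le (by norm_num) (by linarith)
    have h7 : (2 : ℝ) ^ (-(3/4 : ℝ)) ≤ 2 / 3 := by
      have h8 : ((2 : ℝ) ^ (-(3/4 : ℝ))) ^ 4 = 1 / 8 := by
        rw [← Real.rpow_natCast, ← Real.rpow_mul (by norm_num)]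
        norm_num
      by_contra hcon
      push Not at hcon
      have : (2/3 : ℝ) ^ 4 < ((2 : ℝ) ^ (-(3/4 : ℝ))) ^ 4 := pow_lt_pow_left₀ hcon (by norm_num) (by norm_num)
      rw [h8] at this
      norm_num at this
    linarith
  have h9 : (1 - w)⁻¹ ≤ 1 + 3 * w := by
    rw [inv_le_iff_one_le_mul₀ (by linarith)]
    nlinarith
  have h10 : 1 + v ≤ (1 - v)⁻¹ := by
    rw [le_inv_comm₀ (by linarith) (by linarith), inv_eq_one_div, le_div_iff₀ (by linarith)]
    nlinarith
  calc (1 - w)⁻¹ ≤ 1 + 24 * v := by linarith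
    _ = 1 + ((24 : ℕ) : ℝ) * v := by norm_num
    _ ≤ (1 + v) ^ 24 := one_add_mul_le_pow (by linarith) 24
    _ ≤ _ := pow_le_pow_left₀ (by linarith) h10 24

lemma prod_le_prod_sub {ι : Type*} {s t : Finset ι} {f : ι → ℝ} (h : s ⊆ t) (h1 : ∀ i ∈ t, 1 ≤ f i) :
    ∏ i ∈ s, f i ≤ ∏ i ∈ t, f i := by
  rw [← Finset.prod_sdiff h]
  have a : 1 ≤ ∏ i ∈ t \ s, f i := by
    have := Finset.prod_le_prod (s := t \ s) (f := fun _ => (1:ℝ)) (g := f) (fun _ _ => zero_le_one)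
      (fun i hi => h1 i (mem_sdiff.1 hi).1)
    simpa using this
  have b : 0 ≤ ∏ i ∈ s, f i := Finset.prod_nonneg (fun i hi => zero_le_one.trans (h1 i (h hi)))
  nlinarith

/-- counting in residue classes -/
lemma count_class (q : ℕ) (hq : 1 ≤ q) (b : ZMod q) (u : ℝ) (hu : 0 ≤ u) :
    |(((Icc 1 ⌊u⌋₊).filter (fun n : ℕ => (n : ZMod q) = b)).card : ℝ) - u / q| ≤ 1 := by
  have : NeZero q := ⟨by omega⟩
  set v := b.val with hv
  have hb : b = (v : ZMod q) := by simp [hv]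
  have hvq : v < q := ZMod.val_lt b
  have h1 : (Icc 1 ⌊u⌋₊).filter (fun n : ℕ => (n : ZMod q) = b)
      = (Ioc 0 ⌊u⌋₊).filter (fun n : ℕ => n ≡ v [MOD q]) := by
    ext n
    simp only [mem_filter, mem_Icc, mem_Ioc, hb, ZMod.natCast_eq_natCast_iff]
    constructor <;> rintro ⟨⟨h, h'⟩, h''⟩ <;> exact ⟨⟨by omega, h'⟩, h''⟩
  have hqr : (0:ℝ) < q := by exact_mod_cast hq
  have h2 := Nat.Ioc_filter_modEq_card 0 ⌊u⌋₊ (r := q) (by omega) v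
  rw [h1]
  have h3 : (((Ioc 0 ⌊u⌋₊).filter (fun n : ℕ => n ≡ v [MOD q])).card : ℤ) =
     ⌊((⌊u⌋₊:ℝ) - v) / q⌋ - ⌊((0:ℝ) - v) / q⌋ := by
    have e1 : ⌊((⌊u⌋₊:ℚ) - v) / q⌋ = ⌊((⌊u⌋₊:ℝ) - v) / q⌋ := by
      rw [← Rat.floor_cast (α := ℝ)]; push_cast; rfl
    have e2 : ⌊((0:ℚ) - v) / q⌋ = ⌊((0:ℝ) - v) / q⌋ := by
      rw [← Rat.floor_cast (α := ℝ)]; push_cast; rfl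
    rw [h2, ← e1, ← e2]
    push_cast
    apply max_eq_left
    rw [sub_nonneg]
    apply Int.floor_le_floor
    gcongr
    positivity
  have h4 : (((Ioc 0 ⌊u⌋₊).filter (fun n : ℕ => n ≡ v [MOD q])).card : ℝ) =
     ⌊((⌊u⌋₊:ℝ) - v) / q⌋ - ⌊((0:ℝ) - v) / q⌋ := by exact_mod_cast congrArg (Int.cast : ℤ → ℝ) h3
  -- replace ⌊u⌋ by u
  have h5 : ⌊((⌊u⌋₊:ℝ) - v) / q⌋ = ⌊(u - v) / q⌋ := by
    have a1 := Int.floor_div_natCast (u - v) q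
    have a2 := Int.floor_div_natCast ((⌊u⌋₊:ℝ) - v) q
    rw [a1, a2]
    congr 1
    have : (⌊u⌋₊ : ℝ) = ((⌊u⌋ : ℤ) : ℝ) := by
      rw [← natCast_floor_eq_intCast_floor hu]
    rw [this, Int.floor_sub_natCast, Int.floor_sub_natCast, Int.floor_intCast]
  rw [h4, h5]
  have b1 := Int.floor_le ((u - v) / (q:ℝ))
  have b2 := Int.lt_floor_add_one ((u - v) / (q:ℝ))
  have b3 := Int.floor_le (((0:ℝ) - v) / (q:ℝ))
  have b4 := Int.lt_floor_add_one (((0:ℝ) - v) / (q:ℝ))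
  have b5 : (u - v) / (q:ℝ) - ((0:ℝ) - v) / q = u / q := by field_simp; ring
  rw [abs_le]; constructor <;> linarith

/-- counting multiples of `d` in residue classes -/
lemma count_class_mul (q : ℕ) (hq : 1 ≤ q) (b : ZMod q) (t : ℝ) (ht : 0 ≤ t) (d : ℕ) (hd : 1 ≤ d)
    (hdq : d.Coprime q) (α : ℝ) (h0 : 0 ≤ α) (h1 : α ≤ 1) :
    |(((Icc 1 ⌊t⌋₊).filter (fun n : ℕ => (n : ZMod q) = b ∧ d ∣ n)).card : ℝ) - t / d / q|
      ≤ (t / d) ^ (1 - α) := by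
  have hd0 : (0:ℝ) < d := by exact_mod_cast hd
  obtain ⟨u, hu⟩ := (ZMod.isUnit_iff_coprime d q).2 hdq
  have key : ((Icc 1 ⌊t⌋₊).filter (fun n : ℕ => (n : ZMod q) = b ∧ d ∣ n)).card =
      ((Icc 1 ⌊t / d⌋₊).filter (fun n : ℕ => (n : ZMod q) = (↑u⁻¹ : ZMod q) * b)).card := by
    symm
    apply Finset.card_bij (fun k _ => d * k)
    · intro k hk
      simp only [mem_filter, mem_Icc] at hk ⊢
      refine ⟨⟨?_, ?_⟩, ?_, dvd_mul_right _ _⟩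
      · exact Nat.mul_pos hd hk.1.1
      · apply Nat.le_floor
        have := (Nat.le_floor_iff (by positivity)).1 hk.1.2
        push_cast
        rw [le_div_iff₀ hd0] at this; linarith
      · push_cast; rw [hk.2, ← hu]; simp
    · intro a _ b _ h
      exact Nat.eq_of_mul_eq_mul_left hd h
    · intro n hn
      simp only [mem_filter, mem_Icc] at hn
      obtain ⟨k, rfl⟩ := hn.2.2
      refine ⟨k, ?_, rfl⟩
      simp only [mem_filter, mem_Icc]
      refine ⟨⟨?_, ?_⟩, ?_⟩
      · rcases Nat.eq_zero_or_pos k with h | h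
        · subst h; simp at hn
        · exact h
      · apply Nat.le_floor
        have := (Nat.le_floor_iff ht).1 hn.1.2
        push_cast at this
        rw [le_div_iff₀ hd0]; linarith
      · rw [← hn.2.1]; push_cast; rw [← hu]; simp
  rw [key]
  by_cases hdt : (d:ℝ) ≤ t
  · refine (count_class q hq _ (t / d) (by positivity)).trans ?_
    apply Real.one_le_rpow _ (by linarith)
    rwa [one_le_div hd0]
  · push Not at hdt
    have hlt : t / d < 1 := by rwa [div_lt_one hd0]
    have : ⌊t / d⌋₊ = 0 := by rw [Nat.floor_eq_zero]; exact hlt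
    rw [this]
    simp only [show Icc 1 0 = (∅ : Finset ℕ) from rfl, filter_empty, card_empty]
    have hqr : (1:ℝ) ≤ q := by exact_mod_cast hq
    have h00 : 0 ≤ t / d := by positivity
    rw [Nat.cast_zero, zero_sub, abs_neg, abs_of_nonneg (by positivity)]
    calc t / d / q ≤ t / d := div_le_self h00 hqr
      _ = (t/d) ^ (1:ℝ) := (Real.rpow_one _).symm
      _ ≤ _ := by
        rcases h00.eq_or_lt with h | h
        · rw [← h, Real.zero_rpow one_ne_zero]; apply Real.rpow_nonneg; rfl
        · apply Real.rpow_le_rpow_of_exponent_ge h hlt.le; linarith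

/-- number of `Z`-rough integers up to `t` in a class -/
def roughCount (Z q : ℕ) (b : ZMod q) (t : ℝ) : ℝ :=
  (((Icc 1 ⌊t⌋₊).filter (fun n : ℕ => (n : ZMod q) = b ∧ ∀ p, p.Prime → p ∣ n → Z ≤ p)).card : ℝ)

lemma sieve (Z q : ℕ) (hZ : 2 ≤ Z) (hq : 1 ≤ q) (b : ZMod q) (t : ℝ) (ht : 0 ≤ t) (α : ℝ)
    (ha : 0 < α) (ha' : α ≤ 1/4) (hN : (Z : ℝ) ^ α ≤ Real.exp 1) :
    roughCount Z q b t ≤ t / q * (1 + Real.log q) ^ 2 / Real.log Z + t ^ (1 - α) * (1 + 1/α)^24 := by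
  set S := Z.primesBelow.filter (fun p => ¬ p ∣ q) with hS
  have hSp : ∀ p ∈ S, p.Prime := fun p hp => Nat.prime_of_mem_primesBelow (mem_filter.1 hp).1
  have hSq : ∀ p ∈ S, ¬ p ∣ q := fun p hp => (mem_filter.1 hp).2
  have hqr : (0:ℝ) < q := by exact_mod_cast hq
  -- step 1: upper bound by the inclusion-exclusion
  have s1 : roughCount Z q b t ≤ ∑ n ∈ (Icc 1 ⌊t⌋₊).filter (fun n : ℕ => (n : ZMod q) = b),
      ∏ p ∈ S, (1 + -(if p ∣ n then (1:ℝ) else 0)) := by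
    unfold roughCount
    rw [← filter_filter, Finset.card_filter]
    push_cast
    apply Finset.sum_le_sum
    intro n hn
    have hnn : 0 ≤ ∏ p ∈ S, (1 + -(if p ∣ n then (1:ℝ) else 0)) := by
      apply Finset.prod_nonneg; intro p _; split_ifs <;> norm_num
    split_ifs with h
    · apply le_of_eq; symm
      apply Finset.prod_eq_one
      intro p hp
      rw [if_neg]; norm_num
      intro hpn
      have := h p (hSp p hp) hpn
      have h2 := Nat.lt_of_mem_primesBelow (mem_filter.1 hp).1
      omega
    · exact hnn
  have s2 : ∑ n ∈ (Icc 1 ⌊t⌋₊).filter (fun n : ℕ => (n : ZMod q) = b),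
      ∏ p ∈ S, (1 + -(if p ∣ n then (1:ℝ) else 0)) =
      ∑ T ∈ S.powerset, (-1)^(T.card) *
        (((Icc 1 ⌊t⌋₊).filter (fun n : ℕ => (n : ZMod q) = b ∧ (∏ p ∈ T, p) ∣ n)).card : ℝ) := by
    simp_rw [Finset.prod_one_add]
    rw [Finset.sum_comm]
    apply Finset.sum_congr rfl
    intro T hT
    rw [mem_powerset] at hT
    rw [← filter_filter, Finset.card_filter]
    push_cast
    rw [Finset.mul_sum]
    apply Finset.sum_congr rfl
    intro n hn
    rw [Finset.prod_neg, Finset.prod_ite_zero]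
    congr 1
    have : (∀ i ∈ T, i ∣ n) ↔ (∏ p ∈ T, p) ∣ n := by
      constructor
      · intro h
        exact Finset.prod_primes_dvd n (fun p hp => (hSp p (hT hp)).prime) h
      · intro h i hi
        exact (Finset.dvd_prod_of_mem _ hi).trans h
    simp [this]
  have s3 : ∀ T ∈ S.powerset, (-1)^(T.card) *
        (((Icc 1 ⌊t⌋₊).filter (fun n : ℕ => (n : ZMod q) = b ∧ (∏ p ∈ T, p) ∣ n)).card : ℝ) ≤
        t / q * ∏ p ∈ T, (-(p:ℝ)⁻¹) + t^(1-α) * ∏ p ∈ T, (p:ℝ)^(-1+α) := by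
    intro T hT
    rw [mem_powerset] at hT
    have hd : 1 ≤ ∏ p ∈ T, p := Finset.prod_pos (fun p hp => (hSp p (hT hp)).pos)
    have hc : (∏ p ∈ T, p).Coprime q := by
      apply Nat.Coprime.prod_left
      intro p hp
      exact (Nat.Prime.coprime_iff_not_dvd (hSp p (hT hp))).2 (hSq p (hT hp))
    have := count_class_mul q hq b t ht _ hd hc α ha.le (by linarith)
    set N := (((Icc 1 ⌊t⌋₊).filter (fun n : ℕ => (n : ZMod q) = b ∧ (∏ p ∈ T, p) ∣ n)).card : ℝ)
    set D := ∏ p ∈ T, p with hD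
    have e1 : ∏ p ∈ T, (-(p:ℝ)⁻¹) = (-1)^T.card * (D:ℝ)⁻¹ := by
      rw [Finset.prod_neg, Finset.prod_inv_distrib, hD]; push_cast; rfl
    have e2 : t^(1-α) * ∏ p ∈ T, (p:ℝ)^(-1+α) = (t / D)^(1-α) := by
      rw [Real.finsetProd_rpow _ _ (fun i _ => Nat.cast_nonneg i), hD, Real.div_rpow ht (by positivity)]
      push_cast
      rw [show -1 + α = -(1-α) by ring, Real.rpow_neg (Finset.prod_nonneg (fun i _ => Nat.cast_nonneg i))]
      rfl
    rw [e1, e2]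
    have hD0 : (0:ℝ) < D := by exact_mod_cast hd
    have : (-1)^T.card * N - t / q * ((-1)^T.card * (D:ℝ)⁻¹) ≤ (t/D)^(1-α) := by
      calc _ = (-1)^T.card * (N - t / D / q) := by field_simp
        _ ≤ |(-1)^T.card * (N - t / D / q)| := le_abs_self _
        _ ≤ _ := by rw [abs_mul, abs_pow]; simpa using this
    linarith
  have s4 : roughCount Z q b t ≤ t / q * ∏ p ∈ S, (1 + -(p:ℝ)⁻¹) + t^(1-α) * ∏ p ∈ S, (1 + (p:ℝ)^(-1+α)) := by
    refine s1.trans (s2.le.trans ((Finset.sum_le_sum s3).trans ?_))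
    rw [Finset.sum_add_distrib, ← Finset.mul_sum, ← Finset.mul_sum, ← Finset.prod_one_add, ← Finset.prod_one_add]
  refine s4.trans ?_
  have hlogZ : 0 < Real.log Z := Real.log_pos (by exact_mod_cast hZ)
  apply add_le_add
  · rw [mul_div_assoc]
    apply mul_le_mul_of_nonneg_left _ (by positivity)
    rw [le_div_iff₀ hlogZ]
    -- ∏_S (1-1/p) = PP^{-1} * ∏_{p|q,p<Z}(1-1/p)^{-1}
    have hpp := log_le_PP Z (by omega)
    have hnn : 0 ≤ ∏ p ∈ S, (1 + -(p:ℝ)⁻¹) := by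
      apply Finset.prod_nonneg; intro p hp
      have : (p:ℝ)⁻¹ ≤ 1 := inv_le_one_of_one_le₀ (by exact_mod_cast (hSp p hp).one_lt.le)
      linarith
    refine (mul_le_mul_of_nonneg_left hpp hnn).trans ?_
    have f1 : PP (-1) Z = (∏ p ∈ S, (1 - (p:ℝ)^(-1:ℝ))⁻¹) *
        ∏ p ∈ Z.primesBelow.filter (fun p => ¬ ¬ p ∣ q), (1 - (p:ℝ)^(-1:ℝ))⁻¹ := by
      unfold PP
      rw [hS, Finset.prod_filter_mul_prod_filter_not]
    have f2 : (∏ p ∈ S, (1 + -(p:ℝ)⁻¹)) * (∏ p ∈ S, (1 - (p:ℝ)^(-1:ℝ))⁻¹) = 1 := by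
      rw [← Finset.prod_mul_distrib]
      apply Finset.prod_eq_one
      intro p hp
      have : (p:ℝ)⁻¹ < 1 := inv_lt_one_of_one_lt₀ (by exact_mod_cast (hSp p hp).one_lt)
      rw [Real.rpow_neg_one, ← sub_eq_add_neg]
      apply mul_inv_cancel₀; linarith
    rw [f1, ← mul_assoc, f2, one_mul]
    have f3 : ∏ p ∈ Z.primesBelow.filter (fun p => ¬ ¬ p ∣ q), (1 - (p:ℝ)^(-1:ℝ))⁻¹ ≤
        ∏ p ∈ q.primeFactors, ((1 + (p:ℝ)⁻¹)^2) := by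
      have g1 : ∀ p ∈ q.primeFactors, (1:ℝ) ≤ (1 + (p:ℝ)⁻¹)^2 := by
        intro p hp
        have : (0:ℝ) ≤ (p:ℝ)⁻¹ := by positivity
        nlinarith
      have g2 : Z.primesBelow.filter (fun p => ¬ ¬ p ∣ q) ⊆ q.primeFactors := by
        intro p hp
        simp only [mem_filter, not_not] at hp
        rw [Nat.mem_primeFactors]
        exact ⟨Nat.prime_of_mem_primesBelow hp.1, hp.2, by omega⟩
      refine le_trans ?_ (prod_le_prod_sub g2 g1)
      · apply Finset.prod_le_prod
        · intro p hp
          have hp := Nat.prime_of_mem_primesBelow (mem_filter.1 hp).1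
          have : (p:ℝ)^(-1:ℝ) < 1 := rpow_prime_lt_one (by norm_num) hp
          exact inv_nonneg.2 (by linarith)
        · intro p hp
          have hp := Nat.prime_of_mem_primesBelow (mem_filter.1 hp).1
          rw [Real.rpow_neg_one]
          have h2 : (2:ℝ) ≤ p := by exact_mod_cast hp.two_le
          have h3 : (p:ℝ)⁻¹ ≤ 1/2 := by rw [one_div]; exact inv_anti₀ (by norm_num) h2
          have h4 : (0:ℝ) < (p:ℝ)⁻¹ := by positivity
          rw [inv_le_iff_one_le_mul₀ (by linarith)]
          nlinarith [mul_nonneg h4.le (show (0:ℝ) ≤ 1/2 - (p:ℝ)⁻¹ by linarith), pow_pos h4 3, mul_nonneg (mul_nonneg h4.le h4.le) (show (0:ℝ) ≤ 1/2 - (p:ℝ)⁻¹ by linarith)]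
    refine f3.trans ?_
    rw [Finset.prod_pow]
    apply pow_le_pow_left₀ (Finset.prod_nonneg (fun p _ => by positivity))
    exact prod_primeFactors_le q hq
  · apply mul_le_mul_of_nonneg_left _ (by positivity)
    refine le_trans ?_ (PP_rankin Z α ha ha' hN)
    unfold PP
    have k1 : ∀ p ∈ Z.primesBelow, (1 + (p:ℝ)^(-1+α)) ≤ (1 - (p:ℝ)^(-1+α))⁻¹ ∧ 1 ≤ (1 + (p:ℝ)^(-1+α)) := by
      intro p hp
      have hp := Nat.prime_of_mem_primesBelow hp
      have h1 := rpow_prime_lt_one (a := -1 + α) (by linarith) hp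
      have h2 : 0 ≤ (p:ℝ)^(-1+α) := by positivity
      refine ⟨?_, by linarith⟩
      rw [← one_div, le_div_iff₀ (by linarith)]
      nlinarith
    refine (prod_le_prod_sub (filter_subset _ _) (fun p hp => (k1 p hp).2)).trans ?_
    apply Finset.prod_le_prod
    · intro p hp; linarith [(k1 p hp).2]
    · intro p hp; exact (k1 p hp).1

lemma mertens_aux (n : ℕ) (hn : 1 ≤ n) :
    ∑ p ∈ (Ioc 0 n).filter Nat.Prime, Real.log p / p ≤ Real.log n + Real.log 4 := by
  set P := (Ioc 0 n).filter Nat.Prime with hP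
  have hn0 : (0:ℝ) < n := by exact_mod_cast hn
  have h1 : ∑ p ∈ P, ((n / p : ℕ) : ℝ) * Real.log p ≤ n * Real.log n := by
    have e : ∀ p, ((n / p : ℕ) : ℝ) * Real.log p = ∑ m ∈ Ioc 0 n, if p ∣ m then Real.log p else 0 := by
      intro p
      rw [← Finset.sum_filter, Finset.sum_const, Nat.Ioc_filter_dvd_card_eq_div, nsmul_eq_mul]
    simp_rw [e]
    rw [Finset.sum_comm]
    calc ∑ m ∈ Ioc 0 n, ∑ p ∈ P, (if p ∣ m then Real.log p else 0) ≤ ∑ m ∈ Ioc 0 n, Real.log n := by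
          apply Finset.sum_le_sum
          intro m hm
          rw [mem_Ioc] at hm
          rw [← Finset.sum_filter]
          calc ∑ p ∈ P.filter (fun p => p ∣ m), Real.log p ≤ ∑ p ∈ m.primeFactors, Real.log p := by
                apply Finset.sum_le_sum_of_subset_of_nonneg
                · intro p hp
                  simp only [hP, mem_filter] at hp
                  exact Nat.mem_primeFactors.2 ⟨hp.1.2, hp.2, by omega⟩
                · intro p hp _
                  exact Real.log_natCast_nonneg p
            _ = Real.log (∏ p ∈ m.primeFactors, (p:ℝ)) := by
                rw [Real.log_prod]
                intro p hp
                exact_mod_cast (Nat.prime_of_mem_primeFactors hp).ne_zero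
            _ ≤ Real.log n := by
                apply Real.log_le_log
                · apply Finset.prod_pos
                  intro p hp
                  exact_mod_cast (Nat.prime_of_mem_primeFactors hp).pos
                · have := Nat.le_of_dvd hm.1 (Nat.prod_primeFactors_dvd m)
                  rw [← Nat.cast_prod]
                  exact Nat.cast_le.2 (this.trans hm.2)
      _ = n * Real.log n := by simp
  have h2 : ∑ p ∈ P, ((n:ℝ) / p - 1) * Real.log p ≤ n * Real.log n := by
    refine le_trans (Finset.sum_le_sum ?_) h1
    intro p hp
    apply mul_le_mul_of_nonneg_right _ (Real.log_natCast_nonneg p)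
    have := Nat.lt_floor_add_one ((n:ℝ) / p)
    rw [Nat.floor_div_natCast, Nat.floor_natCast] at this
    linarith
  have h3 : ∑ p ∈ P, Real.log p ≤ Real.log 4 * n := by
    have := Chebyshev.theta_le_log4_mul_x (x := (n:ℝ)) hn0.le
    rw [Chebyshev.theta, Nat.floor_natCast] at this
    exact this
  have h4 : ∑ p ∈ P, ((n:ℝ) / p - 1) * Real.log p = n * ∑ p ∈ P, Real.log p / p - ∑ p ∈ P, Real.log p := by
    rw [Finset.mul_sum, ← Finset.sum_sub_distrib]
    apply Finset.sum_congr rfl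
    intro p _
    ring
  rw [h4] at h2
  have h5 : n * ∑ p ∈ P, Real.log p / p ≤ n * (Real.log n + Real.log 4) := by linarith
  exact le_of_mul_le_mul_left h5 hn0

lemma mertens_upper (N : ℕ) (hN : 3 ≤ N) : PP (-1) N ≤ 2 * Real.exp 5 * Real.log N := by
  have hN0 : (0:ℝ) < N := by positivity
  have hlog : 1 ≤ Real.log N := by
    rw [Real.le_log_iff_exp_le hN0]
    have := Real.exp_one_lt_d9
    have h3 : (3:ℝ) ≤ N := by exact_mod_cast hN
    linarith
  set a := 1 / Real.log N with ha
  have ha0 : 0 < a := by positivity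
  have h1 := PP_le_zeta a ha0 N
  have h2 : PP (-1) N ≤ PP (-(1+a)) N * ∏ p ∈ N.primesBelow, Real.exp (2 * a * (Real.log p / p)) := by
    unfold PP
    rw [← Finset.prod_mul_distrib]
    apply Finset.prod_le_prod
    · intro p hp
      have := rpow_prime_lt_one (a := -1) (by norm_num) (Nat.prime_of_mem_primesBelow hp)
      exact inv_nonneg.2 (by linarith)
    intro p hp
    have hpp := Nat.prime_of_mem_primesBelow hp
    have hp0 : (0:ℝ) < p := by exact_mod_cast hpp.pos
    have hp2 : (2:ℝ) ≤ p := by exact_mod_cast hpp.two_le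
    set v := (p:ℝ)^(-(1+a))
    have hv1 : v < 1 := rpow_prime_lt_one (by linarith) hpp
    rw [Real.rpow_neg_one]
    set u := (p:ℝ)⁻¹ with hu
    have hu0 : 0 < u := by positivity
    have hu2 : u ≤ 1/2 := by rw [one_div]; exact inv_anti₀ (by norm_num) hp2
    have hv : v = u * Real.exp (-(a * Real.log p)) := by
      show (p:ℝ)^(-(1+a)) = _
      rw [neg_add, Real.rpow_add hp0, Real.rpow_neg_one, Real.rpow_def_of_pos hp0]
      congr 2; ring
    have h3 : u - v ≤ a * (Real.log p / p) := by
      have := Real.add_one_le_exp (-(a * Real.log p))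
      have e : a * (Real.log p / p) = u * (a * Real.log p) := by rw [hu]; ring
      rw [e, hv]; nlinarith
    have h4 := Real.add_one_le_exp (2 * a * (Real.log p / p))
    have h5 : 0 ≤ a * (Real.log p / p) := by
      have := Real.log_natCast_nonneg p
      positivity
    have h6 : (1 - v) ≤ (1 - u) * Real.exp (2 * a * (Real.log p / p)) := by
      have : (1-u) * (2 * a * (Real.log p / p) + 1) ≤ (1 - u) * Real.exp (2 * a * (Real.log p / p)) :=
        mul_le_mul_of_nonneg_left h4 (by linarith)
      nlinarith
    rw [inv_mul_eq_div, ← one_div, div_le_div_iff₀ (by linarith) (by linarith)]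
    linarith
  have h3 : ∏ p ∈ N.primesBelow, Real.exp (2 * a * (Real.log p / p)) ≤ Real.exp 5 := by
    rw [← Real.exp_sum, Real.exp_le_exp, ← Finset.mul_sum]
    have h4 : ∑ p ∈ N.primesBelow, Real.log p / p ≤ Real.log N + Real.log 4 := by
      refine le_trans ?_ (mertens_aux N (by omega))
      apply Finset.sum_le_sum_of_subset_of_nonneg
      · intro p hp
        have h1 := Nat.prime_of_mem_primesBelow hp
        have h2 := Nat.lt_of_mem_primesBelow hp
        simp only [mem_filter, mem_Ioc]
        exact ⟨⟨h1.pos, h2.le⟩, h1⟩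
      · intro p _ _
        have := Real.log_natCast_nonneg p
        positivity
    have h5 : Real.log 4 ≤ 3/2 := by
      have : (4:ℝ) = 2^2 := by norm_num
      rw [this, Real.log_pow]; have := Real.log_two_lt_d9; push_cast; linarith
    calc 2 * a * ∑ p ∈ N.primesBelow, Real.log p / p ≤ 2 * a * (Real.log N + 3/2 * Real.log N) := by
          apply mul_le_mul_of_nonneg_left _ (by positivity); linarith
      _ = 5 := by rw [ha]; field_simp; norm_num
  have h0 := PP_pos (a := -(1+a)) (by linarith) N
  calc PP (-1) N ≤ _ := h2
    _ ≤ (1 + 1/a) * Real.exp 5 := mul_le_mul h1 h3 (by positivity) (by positivity)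
    _ ≤ _ := by
      have : 1 / a = Real.log N := by rw [ha]; field_simp
      rw [this]; nlinarith [Real.exp_pos 5]

/-- Euler factor comparison -/
lemma euler_factor (δ : ℝ) (h0 : 0 < δ) (h1 : δ < 1) (z : ℂ) (hz : ‖z‖ ≤ 1/2) :
    ‖1 + δ * (z / (1 - z))‖ ≤ (‖1 - z‖⁻¹) ^ δ * Real.exp (14 * ‖z‖^2) := by
  set ρ := 1 - δ with hρ
  have hnz : 1/2 ≤ ‖1 - z‖ := by
    have := norm_sub_norm_le (1:ℂ) z
    rw [norm_one] at this; linarith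
  have hnz0 : 0 < ‖1-z‖ := by linarith
  have hz1 : 1 - z ≠ 0 := by rw [← norm_pos_iff]; exact hnz0
  have e1 : 1 + δ * (z / (1 - z)) = (1 - ρ * z) / (1 - z) := by
    rw [hρ]; push_cast; field_simp; ring
  rw [e1, norm_div, div_eq_mul_inv]
  have key : ‖1 - ρ * z‖ ≤ ‖1 - z‖ ^ ρ * Real.exp (14 * ‖z‖^2) := by
    set b := -2 * z.re + ‖z‖^2 with hb
    have hzz : ‖z‖^2 = z.re^2 + z.im^2 := by rw [Complex.sq_norm, Complex.normSq_apply]; ring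
    have hb1 : ‖1 - z‖^2 = 1 + b := by
      rw [Complex.sq_norm, Complex.normSq_apply, hb, hzz]; simp; ring
    have hb2 : ‖1 - ρ * z‖^2 ≤ 1 + ρ * b := by
      rw [Complex.sq_norm, Complex.normSq_apply, hb, hzz]; simp
      have : ρ^2 ≤ ρ := by nlinarith
      nlinarith [sq_nonneg z.re, sq_nonneg z.im]
    have hre : |z.re| ≤ ‖z‖ := Complex.abs_re_le_norm z
    have hre2 := abs_le.1 hre
    have hn := norm_nonneg z
    have hb3 : 1/4 ≤ 1 + b := by rw [← hb1]; nlinarith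
    have hb4 : b^2 ≤ 25/4 * ‖z‖^2 := by
      have : |b| ≤ 5/2 * ‖z‖ := by rw [abs_le, hb]; constructor <;> nlinarith
      have := pow_le_pow_left₀ (abs_nonneg b) this 2
      rw [sq_abs] at this; nlinarith
    have hlog : b - 4 * b^2 ≤ Real.log (1 + b) := by
      have := Real.one_sub_inv_le_log_of_pos (x := 1 + b) (by linarith)
      refine le_trans ?_ this
      rw [← sub_nonneg]
      have : 1 - (1+b)⁻¹ - (b - 4 * b^2) = b^2 * (4 * (1+b) - 1) / (1 + b) := by
        field_simp; ring
      rw [this]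
      apply div_nonneg _ (by linarith)
      nlinarith [sq_nonneg b]
    have h2 : ‖1 - ρ * z‖^2 ≤ (‖1 - z‖ ^ ρ * Real.exp (14 * ‖z‖^2))^2 := by
      rw [mul_pow, ← Real.exp_nat_mul, ← Real.rpow_natCast, ← Real.rpow_natCast (‖1-z‖^ρ), ← Real.rpow_mul hnz0.le, mul_comm ρ, Real.rpow_mul hnz0.le]
      rw [Real.rpow_natCast, Real.rpow_natCast, hb1, Real.rpow_def_of_pos (by linarith), ← Real.exp_add]
      refine hb2.trans ?_
      have := Real.add_one_le_exp (ρ * b)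
      refine (by linarith : 1 + ρ * b ≤ Real.exp (ρ * b)).trans ?_
      rw [Real.exp_le_exp]
      push_cast
      have hr0 : 0 ≤ ρ := by linarith
      have : ρ * (b - 4 * b^2) ≤ ρ * Real.log (1+b) := mul_le_mul_of_nonneg_left hlog hr0
      have h8 : ρ * b^2 ≤ b^2 := by nlinarith [sq_nonneg b]
      nlinarith
    exact le_of_sq_le_sq h2 (by positivity)
  calc ‖1 - ρ * z‖ * ‖1-z‖⁻¹ ≤ (‖1 - z‖ ^ ρ * Real.exp (14 * ‖z‖^2)) * ‖1-z‖⁻¹ :=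
        mul_le_mul_of_nonneg_right key (by positivity)
    _ = _ := by
      rw [Real.inv_rpow hnz0.le, hρ, Real.rpow_sub hnz0, Real.rpow_one]
      field_simp

lemma sum_inv_sq_le (s : Finset ℕ) : ∑ n ∈ s, ((n:ℝ)⁻¹)^2 ≤ 2 := by
  have := zeta_sum_le 1 one_pos s
  norm_num at this
  simpa [inv_pow] using this

/-- general multiplicative function from its values at prime powers -/
def MF (F : ℕ → ℕ → ℝ) : ArithmeticFunction ℝ :=
  ⟨fun n => if n = 0 then 0 else ∏ p ∈ n.primeFactors, F p (n.factorization p), by simp⟩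

lemma MF_apply (F : ℕ → ℕ → ℝ) {n : ℕ} (hn : n ≠ 0) :
    MF F n = ∏ p ∈ n.primeFactors, F p (n.factorization p) := by
  simp [MF, hn]

lemma MF_one (F : ℕ → ℕ → ℝ) : MF F 1 = 1 := by simp [MF_apply]

lemma MF_mult (F : ℕ → ℕ → ℝ) : (MF F).IsMultiplicative := by
  rw [ArithmeticFunction.IsMultiplicative.iff_ne_zero]
  refine ⟨MF_one F, ?_⟩
  intro m n hm hn hmn
  rw [MF_apply F (mul_ne_zero hm hn), MF_apply F hm, MF_apply F hn, hmn.primeFactors_mul,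
    Finset.prod_union hmn.disjoint_primeFactors]
  congr 1
  · apply Finset.prod_congr rfl
    intro p hp
    rw [Nat.factorization_mul hm hn]
    have : n.factorization p = 0 := by
      rw [← Finsupp.notMem_support_iff, Nat.support_factorization]
      exact Finset.disjoint_left.1 hmn.disjoint_primeFactors hp
    simp [this]
  · apply Finset.prod_congr rfl
    intro p hp
    rw [Nat.factorization_mul hm hn]
    have : m.factorization p = 0 := by
      rw [← Finsupp.notMem_support_iff, Nat.support_factorization]
      exact Finset.disjoint_right.1 hmn.disjoint_primeFactors hp
    simp [this]

lemma MF_pow (F : ℕ → ℕ → ℝ) {p : ℕ} (hp : p.Prime) {k : ℕ} (hk : k ≠ 0) : MF F (p ^ k) = F p k := by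
  rw [MF_apply F (pow_ne_zero _ hp.ne_zero), Nat.primeFactors_prime_pow hk hp]
  simp [hp.factorization]

lemma MF_pow' (F : ℕ → ℕ → ℝ) {p : ℕ} (hp : p.Prime) (k : ℕ) : MF F (p ^ k) = if k = 0 then 1 else F p k := by
  split_ifs with h
  · simp [h, MF_one]
  · exact MF_pow F hp h

lemma MF_conv (F G H : ℕ → ℕ → ℝ)
    (h : ∀ p k, p.Prime → k ≠ 0 → ∑ i ∈ range (k+1), (if i = 0 then 1 else F p i) *
      (if k - i = 0 then 1 else G p (k - i)) = H p k) : MF F * MF G = MF H := by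
  rw [ArithmeticFunction.IsMultiplicative.eq_iff_eq_on_prime_powers _ ((MF_mult F).mul (MF_mult G)) _ (MF_mult H)]
  intro p k hp
  by_cases hk : k = 0
  · subst hk
    simp [MF_one]
  rw [MF_pow H hp hk, ArithmeticFunction.mul_apply, Nat.sum_divisorsAntidiagonal (fun a b => MF F a * MF G b),
    Nat.sum_divisors_prime_pow hp, ← h p k hp hk]
  apply Finset.sum_congr rfl
  intro i hi
  rw [mem_range] at hi
  rw [MF_pow' F hp, Nat.pow_div (by omega) hp.pos, MF_pow' G hp]

lemma MF_conv_disj (F G : ℕ → ℕ → ℝ) (h : ∀ p, (∀ k, F p k = 0) ∨ (∀ k, G p k = 0)) :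
    MF F * MF G = MF (fun p k => F p k + G p k) := by
  apply MF_conv
  intro p k hp hk
  rcases h p with h | h
  · rw [Finset.sum_eq_single 0]
    · simp [hk, h]
    · intro i _ hi; simp [hi, h]
    · simp
  · rw [Finset.sum_eq_single k]
    · simp [hk, h]
    · intro i hi hi'
      have : k - i ≠ 0 := by rw [mem_range] at hi; omega
      simp [this, h]
    · simp

lemma MF_nonneg {F : ℕ → ℕ → ℝ} (h : ∀ p k, 0 ≤ F p k) (n : ℕ) : 0 ≤ MF F n := by
  by_cases hn : n = 0
  · simp [hn]
  · rw [MF_apply F hn]; exact Finset.prod_nonneg (fun p _ => h _ _)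

lemma MF_mono {F G : ℕ → ℕ → ℝ} (h : ∀ p k, 0 ≤ F p k) (h1 : ∀ p k, F p k ≤ G p k) (n : ℕ) : MF F n ≤ MF G n := by
  by_cases hn : n = 0
  · simp [hn]
  · rw [MF_apply F hn, MF_apply G hn]
    exact Finset.prod_le_prod (fun p _ => h _ _) (fun p _ => h1 _ _)

lemma MF_le_one {F : ℕ → ℕ → ℝ} (h : ∀ p k, 0 ≤ F p k) (h1 : ∀ p k, F p k ≤ 1) (n : ℕ) : MF F n ≤ 1 := by
  by_cases hn : n = 0
  · simp [hn]
  · rw [MF_apply F hn]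
    exact Finset.prod_le_one (fun p _ => h _ _) (fun p _ => h1 _ _)

lemma MF_eq_zero {F : ℕ → ℕ → ℝ} {n p : ℕ} (hp : p.Prime) (hpn : p ∣ n) (h : ∀ k, F p k = 0) : MF F n = 0 := by
  by_cases hn : n = 0
  · simp [hn]
  · rw [MF_apply F hn]
    exact Finset.prod_eq_zero (Nat.mem_primeFactors.2 ⟨hp, hpn, hn⟩) (h _)

lemma MF_const (δ : ℝ) {n : ℕ} (hn : n ≠ 0) : MF (fun _ _ => δ) n = δ ^ n.primeFactors.card := by
  rw [MF_apply _ hn]; simp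

/-- `h` restricted to primes `< Y` -/
def Flo (Y : ℕ) (a : ℝ) : ℕ → ℕ → ℝ := fun p _ => if p < Y then a else 0
/-- constant on primes `≥ Y` -/
def Fhi (Y : ℕ) (a : ℝ) : ℕ → ℕ → ℝ := fun p _ => if p < Y then 0 else a
def Gfun (Y : ℕ) (c : ℝ) : ℕ → ℕ → ℝ := fun p k => if p < Y then 0 else c * (1 - c)^(k-1)
def Fmix (Y : ℕ) (a b : ℝ) : ℕ → ℕ → ℝ := fun p _ => if p < Y then a else b

lemma conv_eg (Y : ℕ) (c : ℝ) : MF (Fhi Y c) * MF (Gfun Y c) = MF (Fhi Y (2*c)) := by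
  apply MF_conv
  intro p k hp hk
  unfold Fhi Gfun
  by_cases h : p < Y
  · simp only [h, if_true]
    apply Finset.sum_eq_zero
    intro i hi
    rw [mem_range] at hi
    by_cases h0 : i = 0
    · simp [h0, hk]
    · simp [h0]
  · simp only [h, if_false]
    obtain ⟨m, rfl⟩ : ∃ m, k = m + 1 := ⟨k-1, by omega⟩
    rw [Finset.sum_range_succ, Finset.sum_range_succ']
    simp only [Nat.sub_self, if_true, mul_one, Nat.sub_zero, one_mul]
    have e : ∀ i ∈ range m, (if i + 1 = 0 then (1:ℝ) else c) * (if m + 1 - (i+1) = 0 then 1 else c * (1-c)^(m+1-(i+1)-1))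
        = c * (c * (1-c)^(m-1-i)) := by
      intro i hi
      rw [mem_range] at hi
      rw [if_neg (by omega), if_neg (by omega)]
      congr 3; omega
    rw [Finset.sum_congr rfl e, ← Finset.mul_sum, ← Finset.mul_sum, Finset.sum_range_reflect (fun j => (1-c)^j) m]
    have := mul_neg_geom_sum (1-c) m
    simp only [sub_sub_cancel] at this
    rw [this]
    simp
    ring

lemma conv_fmix (Y : ℕ) (a b : ℝ) : MF (Flo Y a) * MF (Fhi Y b) = MF (Fmix Y a b) := by
  rw [MF_conv_disj]
  · congr 1; ext p k; unfold Flo Fhi Fmix; split_ifs <;> simp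
  · intro p; by_cases h : p < Y
    · right; simp [Fhi, h]
    · left; simp [Flo, h]

/-- truncation: `1 < n ≤ X` -/
def trunc (a : ArithmeticFunction ℝ) (X : ℕ) : ArithmeticFunction ℝ :=
  ⟨fun n => if 1 < n ∧ n ≤ X then a n else 0, by simp⟩

lemma trunc_apply (a : ArithmeticFunction ℝ) (X n : ℕ) :
  trunc a X n = if 1 < n ∧ n ≤ X then a n else 0 := rfl

/-- The main decomposition. -/
lemma decomp (δ : ℝ) (h0 : 0 < δ) (h1 : δ < 1) (Y X n : ℕ) (hn : n ≠ 0) (hnX : n ≤ X) :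
    0 ≤ δ ^ n.primeFactors.card - (MF (Flo Y δ) * trunc (MF (Fhi Y (δ/2))) X * trunc (MF (Gfun Y (δ/2))) X) n ∧
    δ ^ n.primeFactors.card - (MF (Flo Y δ) * trunc (MF (Fhi Y (δ/2))) X * trunc (MF (Gfun Y (δ/2))) X) n ≤ 2 * MF (Fmix Y δ (δ/2)) n := by
  set c := δ / 2 with hc
  set S := MF (Flo Y δ) with hS
  set E := MF (Fhi Y c) with hE
  set G := MF (Gfun Y c) with hG
  have hSn : ∀ n, 0 ≤ S n := MF_nonneg (by intro p k; unfold Flo; split_ifs <;> linarith)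
  have hEn : ∀ n, 0 ≤ E n := MF_nonneg (by intro p k; unfold Fhi; split_ifs <;> linarith)
  have hGn : ∀ n, 0 ≤ G n := MF_nonneg (by
    intro p k; unfold Gfun; split_ifs
    · rfl
    · exact mul_nonneg (by linarith) (pow_nonneg (by linarith) _))
  have hGE : ∀ n, G n ≤ E n := MF_mono (by
    intro p k; unfold Gfun; split_ifs
    · rfl
    · exact mul_nonneg (by linarith) (pow_nonneg (by linarith) _)) (by
    intro p k; unfold Gfun Fhi; split_ifs
    · rfl
    · have : (1-c)^(k-1) ≤ 1 := pow_le_one₀ (by linarith) (by linarith)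
      nlinarith)
  have hh : δ ^ n.primeFactors.card = (S * (E * G)) n := by
    rw [hE, hG, conv_eg, hS, conv_fmix, ← MF_const δ hn]
    congr 2
    ext p k; unfold Fmix; split_ifs
    · rfl
    · rw [hc]; ring
  rw [hh, mul_assoc]
  have e : (S * (E * G)) n - (S * (trunc E X * trunc G X)) n =
     ∑ x ∈ n.divisorsAntidiagonal, S x.1 * ((E * G) x.2 - (trunc E X * trunc G X) x.2) := by
    rw [ArithmeticFunction.mul_apply, ArithmeticFunction.mul_apply, ← Finset.sum_sub_distrib]
    apply Finset.sum_congr rfl; intro x _; ring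
  have key : ∀ x ∈ n.divisorsAntidiagonal, 0 ≤ ((E * G) x.2 - (trunc E X * trunc G X) x.2) ∧
      ((E * G) x.2 - (trunc E X * trunc G X) x.2) ≤ 2 * E x.2 := by
    intro x hx
    set r := x.2
    have hr0 : r ≠ 0 := by
      intro h; have := (Nat.mem_divisorsAntidiagonal.1 hx).1; rw [show x.2 = 0 from h] at this; simp at this; omega
    have hrn : r ≤ X := by
      have := (Nat.mem_divisorsAntidiagonal.1 hx).1
      exact (Nat.le_of_dvd (by omega) ⟨x.1, by rw [mul_comm]; exact this.symm⟩).trans hnX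
    have e2 : (E * G) r - (trunc E X * trunc G X) r =
        ∑ y ∈ r.divisorsAntidiagonal, (E y.1 * G y.2 - trunc E X y.1 * trunc G X y.2) := by
      rw [ArithmeticFunction.mul_apply, ArithmeticFunction.mul_apply, ← Finset.sum_sub_distrib]
    rw [e2]
    have t1 : ∀ (a : ArithmeticFunction ℝ), (∀ n, 0 ≤ a n) → ∀ m, 0 ≤ trunc a X m ∧ trunc a X m ≤ a m := by
      intro a ha m
      rw [trunc_apply]; split_ifs
      · exact ⟨ha m, le_rfl⟩
      · exact ⟨le_rfl, ha m⟩
    constructor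
    · apply Finset.sum_nonneg
      intro y _
      have := mul_le_mul (t1 E hEn y.1).2 (t1 G hGn y.2).2 (t1 G hGn y.2).1 (hEn y.1)
      linarith
    · have : ∀ y ∈ r.divisorsAntidiagonal, (E y.1 * G y.2 - trunc E X y.1 * trunc G X y.2) ≤
          (if y = (1, r) then E r else 0) + (if y = (r, 1) then E r else 0) := by
        intro y hy
        have hy1 := (Nat.mem_divisorsAntidiagonal.1 hy).1
        have hy2 : y.1 ≠ 0 := by intro h; rw [h] at hy1; simp at hy1; omega
        have hy3 : y.2 ≠ 0 := by intro h; rw [h] at hy1; simp at hy1; omega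
        have hl1 : y.1 ≤ r := by rw [← hy1]; exact Nat.le_mul_of_pos_right _ (by omega)
        have hl2 : y.2 ≤ r := by rw [← hy1]; exact Nat.le_mul_of_pos_left _ (by omega)
        have n1 : 0 ≤ (if y = (1, r) then E r else 0) := by split_ifs; exact hEn r; rfl
        have n2 : 0 ≤ (if y = (r, 1) then E r else 0) := by split_ifs; exact hEn r; rfl
        by_cases c1 : y.1 = 1
        · have : y = (1, r) := by ext; exact c1; simpa [c1] using hy1
          rw [if_pos this]
          have : E y.1 * G y.2 ≤ E r := by
            rw [this]; simp only; rw [hE, MF_one, one_mul]; exact hGE r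
          have := (t1 E hEn y.1).1
          have := (t1 G hGn y.2).1
          have : 0 ≤ trunc E X y.1 * trunc G X y.2 := by positivity
          linarith
        · by_cases c2 : y.2 = 1
          · have : y = (r, 1) := by ext; simpa [c2] using hy1; exact c2
            rw [if_pos this]
            have : E y.1 * G y.2 ≤ E r := by
              rw [this]; simp only; rw [hG, MF_one, mul_one]
            have := (t1 E hEn y.1).1
            have := (t1 G hGn y.2).1
            have : 0 ≤ trunc E X y.1 * trunc G X y.2 := by positivity
            linarith
          · rw [trunc_apply, trunc_apply, if_pos ⟨by omega, by omega⟩, if_pos ⟨by omega, by omega⟩]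
            linarith
      refine (Finset.sum_le_sum this).trans ?_
      rw [Finset.sum_add_distrib, Finset.sum_ite_eq', Finset.sum_ite_eq']
      have := hEn r
      split_ifs <;> linarith
  rw [e]
  constructor
  · apply Finset.sum_nonneg; intro x hx
    exact mul_nonneg (hSn _) (key x hx).1
  · rw [← conv_fmix, ArithmeticFunction.mul_apply, Finset.mul_sum]
    apply Finset.sum_le_sum
    intro x hx
    have := mul_le_mul_of_nonneg_left (key x hx).2 (hSn x.1)
    linarith

/-- Euler product over smooth numbers -/
lemma euler_smooth (w : ℕ → ℝ) (ψ : ℕ → ℂ) (h1 : ψ 1 = 1) (hm : ∀ m n, ψ (m * n) = ψ m * ψ n)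
    (hp : ∀ p, p.Prime → ‖ψ p‖ < 1) (N : ℕ) :
    Summable (fun m : N.smoothNumbers => ‖((MF (fun p _ => w p) m : ℝ) : ℂ) * ψ m‖) ∧
    HasSum (fun m : N.smoothNumbers => ((MF (fun p _ => w p) m : ℝ) : ℂ) * ψ m)
      (∏ p ∈ N.primesBelow, (1 + w p * (ψ p / (1 - ψ p)))) := by
  have hpow : ∀ p n, ψ (p ^ n) = ψ p ^ n := by
    intro p n; induction n with
    | zero => simp [h1]
    | succ n ih => rw [pow_succ, hm, ih, pow_succ]
  set f : ℕ → ℂ := fun m => ((MF (fun p _ => w p) m : ℝ) : ℂ) * ψ m with hf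
  have hval : ∀ p, p.Prime → ∀ n, f (p ^ (n+1)) = w p * (ψ p * ψ p ^ n) := by
    intro p hpp n
    simp only [hf]
    rw [MF_pow _ hpp (by omega), hpow, pow_succ']
  have hsum : ∀ p, p.Prime → HasSum (fun n => f (p ^ (n+1))) (w p * (ψ p / (1 - ψ p))) := by
    intro p hpp
    simp_rw [hval p hpp]
    have := hasSum_geometric_of_norm_lt_one (hp p hpp)
    have := (this.mul_left (ψ p)).mul_left (w p : ℂ)
    rwa [← div_eq_mul_inv] at this
  have hs : ∀ {p : ℕ}, p.Prime → Summable (fun n => ‖f (p ^ n)‖) := by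
    intro p hpp
    rw [← summable_nat_add_iff 1]
    simp_rw [hval p hpp, norm_mul, norm_pow]
    exact ((summable_geometric_of_lt_one (norm_nonneg _) (hp p hpp)).mul_left _).mul_left _
  have main := EulerProduct.summable_and_hasSum_smoothNumbers_prod_primesBelow_tsum (f := f)
    (by simp [hf, MF_one, h1]) (by
      intro m n hmn
      simp only [hf]
      rw [(MF_mult _).map_mul_of_coprime hmn, hm]; push_cast; ring) hs N
  refine ⟨main.1, ?_⟩
  have e : ∏ p ∈ N.primesBelow, (1 + w p * (ψ p / (1 - ψ p))) = ∏ p ∈ N.primesBelow, ∑' n : ℕ, f (p ^ n) := by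
    apply Finset.prod_congr rfl
    intro p hpp
    have hpp := Nat.prime_of_mem_primesBelow hpp
    have h3 := hsum p hpp
    rw [hasSum_nat_add_iff (f := fun n => f (p ^ n)) 1] at h3
    rw [h3.tsum_eq]
    simp [hf, MF_one, h1, add_comm]
  rw [e]; exact main.2

/-- Sum of `f(m)/m` over smooth numbers. -/
lemma smooth_f_sum (δ : ℝ) (h0 : 0 < δ) (h1 : δ < 1) (Y Z : ℕ) (hYZ : Y ≤ Z) (s : Finset ℕ)
    (hs : ∀ n ∈ s, n ∈ Z.smoothNumbers) :
    ∑ m ∈ s, MF (Fmix Y δ (δ/2)) m * (m:ℝ)⁻¹ ≤ Real.exp 28 * (PP (-1) Z ^ (δ/2) * PP (-1) Y ^ (δ/2)) := by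
  set w : ℕ → ℝ := fun p => if p < Y then δ else δ/2 with hw
  set ψ : ℕ → ℂ := fun n => ((n:ℝ)⁻¹ : ℝ) with hψ
  have hF : Fmix Y δ (δ/2) = fun p _ => w p := by ext p k; rfl
  have hw0 : ∀ p, 0 < w p := by intro p; simp only [hw]; split_ifs <;> linarith
  have hw1 : ∀ p, w p < 1 := by intro p; simp only [hw]; split_ifs <;> linarith
  have hψn : ∀ n, ‖ψ n‖ = (n:ℝ)⁻¹ := by
    intro n; simp only [hψ]; rw [Complex.norm_real, Real.norm_of_nonneg (by positivity)]
  obtain ⟨e1, e2⟩ := euler_smooth w ψ (by simp [hψ]) (by intro m n; simp only [hψ]; push_cast; rw [mul_inv])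
    (by
      intro p hp
      rw [hψn]
      exact inv_lt_one_of_one_lt₀ (by exact_mod_cast hp.one_lt)) Z
  have hnn : ∀ m, 0 ≤ MF (Fmix Y δ (δ/2)) m * (m:ℝ)⁻¹ := by
    intro m
    apply mul_nonneg _ (by positivity)
    rw [hF]; exact MF_nonneg (fun p _ => (hw0 p).le) m
  have e3 : HasSum (fun m : Z.smoothNumbers => MF (Fmix Y δ (δ/2)) m * ((m:ℕ):ℝ)⁻¹)
      ‖∏ p ∈ Z.primesBelow, (1 + w p * (ψ p / (1 - ψ p)))‖ := by
    have : (fun m : Z.smoothNumbers => ((MF (fun p _ => w p) m : ℝ) : ℂ) * ψ m) =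
       fun m : Z.smoothNumbers => ((MF (Fmix Y δ (δ/2)) m * ((m:ℕ):ℝ)⁻¹ : ℝ) : ℂ) := by
      ext m; rw [hF]; simp [hψ]
    rw [this] at e2
    have h2 := Complex.reCLM.hasSum e2
    simp only [Complex.reCLM_apply, Complex.ofReal_re] at h2
    have h3 : 0 ≤ (∏ p ∈ Z.primesBelow, (1 + w p * (ψ p / (1 - ψ p)))).re := by
      refine HasSum.nonneg (g := fun m : Z.smoothNumbers => MF (Fmix Y δ (δ/2)) m * ((m:ℕ):ℝ)⁻¹) (fun m => hnn m) h2
    have h4 : ((∏ p ∈ Z.primesBelow, (1 + w p * (ψ p / (1 - ψ p)))).re : ℂ) = ∏ p ∈ Z.primesBelow, (1 + w p * (ψ p / (1 - ψ p))) := by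
      have := (Complex.hasSum_ofReal.2 h2)
      exact this.unique e2
    rw [← h4, Complex.norm_real, Real.norm_of_nonneg h3]
    exact h2
  have e4 : ∑ m ∈ s, MF (Fmix Y δ (δ/2)) m * (m:ℝ)⁻¹ ≤ ‖∏ p ∈ Z.primesBelow, (1 + w p * (ψ p / (1 - ψ p)))‖ := by
    have := e3.summable.sum_le_tsum (s.attach.map ⟨fun n => (⟨n.1, hs n.1 n.2⟩ : Z.smoothNumbers), by
      intro a b h; ext; simpa using h⟩) (fun i _ => hnn i)
    rw [e3.tsum_eq] at this
    refine le_trans (le_of_eq ?_) this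
    rw [Finset.sum_map, ← Finset.sum_attach]
    rfl
  refine e4.trans ?_
  rw [norm_prod]
  have e5 : ∀ p ∈ Z.primesBelow, ‖1 + w p * (ψ p / (1 - ψ p))‖ ≤
      ((1 - (p:ℝ)^(-1:ℝ))⁻¹)^(δ/2) * (if p < Y then ((1 - (p:ℝ)^(-1:ℝ))⁻¹)^(δ/2) else 1) * Real.exp (14 * ((p:ℝ)⁻¹)^2) := by
    intro p hp
    have hpp := Nat.prime_of_mem_primesBelow hp
    have hp2 : (2:ℝ) ≤ p := by exact_mod_cast hpp.two_le
    have hu2 : (p:ℝ)⁻¹ ≤ 1/2 := by rw [one_div]; exact inv_anti₀ (by norm_num) hp2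
    have := euler_factor (w p) (hw0 p) (hw1 p) (ψ p) (by rw [hψn]; exact hu2)
    refine this.trans ?_
    rw [hψn]
    apply mul_le_mul_of_nonneg_right _ (by positivity)
    have h3 : ‖1 - ψ p‖ = 1 - (p:ℝ)^(-1:ℝ) := by
      rw [Real.rpow_neg_one]
      have : 1 - ψ p = ((1 - (p:ℝ)⁻¹ : ℝ) : ℂ) := by simp [hψ]
      rw [this, Complex.norm_real, Real.norm_of_nonneg (by linarith)]
    rw [h3]
    have h4 : 0 < (1 - (p:ℝ)^(-1:ℝ))⁻¹ := by
      rw [Real.rpow_neg_one]; apply inv_pos.2; linarith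
    simp only [hw]
    split_ifs
    · rw [← Real.rpow_add h4]; apply le_of_eq; congr 1; ring
    · rw [mul_one]
  refine (Finset.prod_le_prod (fun _ _ => norm_nonneg _) e5).trans ?_
  rw [Finset.prod_mul_distrib, Finset.prod_mul_distrib, ← Real.exp_sum, ← Finset.mul_sum, mul_comm (Real.exp 28)]
  have k0 : ∀ p : ℕ, p.Prime → 0 ≤ (1 - (p:ℝ)^(-1:ℝ))⁻¹ := by
    intro p hp
    have := rpow_prime_lt_one (a := -1) (by norm_num) hp
    apply inv_nonneg.2; linarith
  have k1 : ∏ p ∈ Z.primesBelow, ((1 - (p:ℝ)^(-1:ℝ))⁻¹)^(δ/2) = PP (-1) Z ^ (δ/2) := by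
    unfold PP
    rw [Real.finsetProd_rpow]
    intro p hp; exact k0 p (Nat.prime_of_mem_primesBelow hp)
  have k2 : ∏ p ∈ Z.primesBelow, (if p < Y then ((1 - (p:ℝ)^(-1:ℝ))⁻¹)^(δ/2) else 1) = PP (-1) Y ^ (δ/2) := by
    unfold PP
    rw [← Real.finsetProd_rpow, ← Finset.prod_filter]
    · apply Finset.prod_congr _ (fun _ _ => rfl)
      ext p
      simp only [mem_filter, Nat.mem_primesBelow]
      constructor
      · rintro ⟨⟨_, h⟩, h'⟩; exact ⟨h', h⟩
      · rintro ⟨h', h⟩; exact ⟨⟨by omega, h⟩, h'⟩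
    · intro p hp; exact k0 p (Nat.prime_of_mem_primesBelow hp)
  rw [k1, k2]
  apply mul_le_mul_of_nonneg_left
  · rw [Real.exp_le_exp]; have := sum_inv_sq_le Z.primesBelow; linarith
  · have := PP_pos (a := -1) (by norm_num) Z
    have := PP_pos (a := -1) (by norm_num) Y
    positivity

lemma shiu (δ : ℝ) (h0 : 0 < δ) (h1 : δ < 1) (Y Z q : ℕ) (hYZ : Y ≤ Z) (hZ : 2 ≤ Z) (hq : 1 ≤ q)
    (b : ZMod q) (hb : IsUnit b) (t : ℝ) (ht : 1 ≤ t) (α : ℝ)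
    (ha : 0 < α) (ha' : α ≤ 1/4) (hN : (Z : ℝ) ^ α ≤ Real.exp 1) :
    ∑ n ∈ (Icc 1 ⌊t⌋₊).filter (fun n : ℕ => (n : ZMod q) = b), MF (Fmix Y δ (δ/2)) n ≤
      t * (((1 + Real.log q)^2 / Real.log Z / q + t^(-(α/2)) * (1 + 1/α)^24) *
        (Real.exp 28 * (PP (-1) Z ^ (δ/2) * PP (-1) Y ^ (δ/2))) + t^(-(α/2)) * (1 + 1/α)^24) := by
  set N := ⌊t⌋₊ with hNdef
  set f := Fmix Y δ (δ/2) with hf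
  have hf0 : ∀ p k, 0 ≤ f p k := by intro p k; simp only [hf, Fmix]; split_ifs <;> linarith
  have hf1 : ∀ p k, f p k ≤ 1 := by intro p k; simp only [hf, Fmix]; split_ifs <;> linarith
  set fL : ℕ → ℕ → ℝ := fun p k => if p < Z then f p k else 0 with hfL
  set fH : ℕ → ℕ → ℝ := fun p k => if p < Z then 0 else f p k with hfH
  have hconv : MF f = MF fL * MF fH := by
    rw [MF_conv_disj]
    · congr 1; ext p k; simp only [hfL, hfH]; split_ifs <;> simp
    · intro p; by_cases h : p < Z
      · right; simp [hfH, h]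
      · left; simp [hfL, h]
  have hL0 : ∀ n, 0 ≤ MF fL n := MF_nonneg (by intro p k; simp only [hfL]; split_ifs; exact hf0 p k; rfl)
  have hH0 : ∀ n, 0 ≤ MF fH n := MF_nonneg (by intro p k; simp only [hfH]; split_ifs; rfl; exact hf0 p k)
  have hH1 : ∀ n, MF fH n ≤ 1 := MF_le_one (by intro p k; simp only [hfH]; split_ifs; rfl; exact hf0 p k)
    (by intro p k; simp only [hfH]; split_ifs; norm_num; exact hf1 p k)
  have hLle : ∀ n, MF fL n ≤ MF f n := MF_mono (by intro p k; simp only [hfL]; split_ifs; exact hf0 p k; rfl)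
    (by intro p k; simp only [hfL]; split_ifs; rfl; exact hf0 p k)
  have hf1' : ∀ n, MF f n ≤ 1 := MF_le_one hf0 hf1
  -- rewrite
  have s1 : ∑ n ∈ (Icc 1 N).filter (fun n : ℕ => (n : ZMod q) = b), MF f n ≤
      ∑ m ∈ Ioc 0 N, ∑ r ∈ Ioc 0 N, if (((m * r : ℕ) : ZMod q) = b ∧ m * r ≤ N) then MF fL m * MF fH r else 0 := by
    have : ∀ n ∈ (Icc 1 N).filter (fun n : ℕ => (n : ZMod q) = b), MF f n =
        ∑ x ∈ Ioc 0 N ×ˢ Ioc 0 N, if x.1 * x.2 = n then MF fL x.1 * MF fH x.2 else 0 := by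
      intro n hn
      simp only [mem_filter, mem_Icc] at hn
      rw [hconv, ArithmeticFunction.mul_apply, Nat.divisorsAntidiagonal_eq_prod_filter_of_le (by omega) hn.1.2,
        Finset.sum_filter]
    rw [Finset.sum_congr rfl this, Finset.sum_comm, ← Finset.sum_product' (s := Ioc 0 N) (t := Ioc 0 N) (f := fun m r => if (((m * r : ℕ) : ZMod q) = b ∧ m * r ≤ N) then MF fL m * MF fH r else 0)]
    apply Finset.sum_le_sum
    intro x hx
    rw [Finset.sum_ite_eq]
    have hnn := mul_nonneg (hL0 x.1) (hH0 x.2)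
    simp only [mem_filter, mem_Icc]
    split_ifs with c1 c2 c2
    · rfl
    · exact absurd ⟨c1.2, c1.1.2⟩ c2
    · exact hnn
    · rfl
  have hbound : ∀ m ∈ Ioc 0 N, (∑ r ∈ Ioc 0 N, if (((m * r : ℕ) : ZMod q) = b ∧ m * r ≤ N) then MF fL m * MF fH r else 0)
      ≤ if m ∈ Z.smoothNumbers ∧ m.Coprime q then MF fL m * roughCount Z q (b * (m : ZMod q)⁻¹) (t / m) else 0 := by
    intro m hm
    rw [mem_Ioc] at hm
    have hm0 : (0:ℝ) < m := by exact_mod_cast hm.1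
    by_cases c : m ∈ Z.smoothNumbers ∧ m.Coprime q
    · rw [if_pos c]
      unfold roughCount
      rw [Finset.card_filter, Nat.cast_sum, Finset.mul_sum]
      simp only [Nat.cast_ite, Nat.cast_one, Nat.cast_zero]
      have : ∀ r ∈ Ioc 0 N, (if (((m * r : ℕ) : ZMod q) = b ∧ m * r ≤ N) then MF fL m * MF fH r else 0) ≤
          if r ∈ Icc 1 ⌊t / m⌋₊ then (MF fL m * if ((r:ZMod q) = b * (m:ZMod q)⁻¹ ∧ ∀ p, p.Prime → p ∣ r → Z ≤ p) then (1:ℝ) else 0) else 0 := by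
        intro r hr
        rw [mem_Ioc] at hr
        by_cases c1 : (((m * r : ℕ) : ZMod q) = b ∧ m * r ≤ N)
        · rw [if_pos c1, if_pos]
          · by_cases c2 : ∀ p, p.Prime → p ∣ r → Z ≤ p
            · rw [if_pos]
              · exact mul_le_mul_of_nonneg_left (hH1 r) (hL0 m)
              · refine ⟨?_, c2⟩
                rw [← c1.1]; push_cast
                rw [mul_comm, ← mul_assoc, ZMod.inv_mul_of_unit _ ((ZMod.isUnit_iff_coprime m q).2 c.2), one_mul]
            · push Not at c2
              obtain ⟨p, hp, hpr, hpZ⟩ := c2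
              rw [MF_eq_zero hp hpr (by intro k; simp [hfH, hpZ]), mul_zero]
              apply mul_nonneg (hL0 m); split_ifs <;> norm_num
          · rw [mem_Icc]
            refine ⟨hr.1, Nat.le_floor ?_⟩
            rw [le_div_iff₀ hm0]
            have := (Nat.le_floor_iff (by linarith)).1 c1.2
            push_cast at this; linarith
        · rw [if_neg c1]
          split_ifs
          · simpa using hL0 m
          · simp
          · rfl
      refine (Finset.sum_le_sum this).trans ?_
      rw [← Finset.sum_filter]
      apply Finset.sum_le_sum_of_subset_of_nonneg
      · intro r hr; exact (mem_filter.1 hr).2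
      · intro r _ _; apply mul_nonneg (hL0 m); split_ifs <;> norm_num
    · rw [if_neg c]
      apply le_of_eq
      apply Finset.sum_eq_zero
      intro r hr
      rw [mem_Ioc] at hr
      rw [not_and_or] at c
      rcases c with c | c
      · have : MF fL m = 0 := by
          rw [Nat.mem_smoothNumbers'] at c
          push Not at c
          obtain ⟨p, hp, hpm, hpZ⟩ := c
          exact MF_eq_zero hp hpm (by intro k; simp [hfL, not_lt.2 hpZ])
        rw [this]; simp
      · rw [if_neg]
        rintro ⟨h, _⟩
        apply c
        rw [← ZMod.isUnit_iff_coprime]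
        rw [← h] at hb; push_cast at hb
        exact isUnit_of_mul_isUnit_left hb
  have hlogZ : 0 < Real.log Z := Real.log_pos (by exact_mod_cast hZ)
  have hqr : (0:ℝ) < q := by exact_mod_cast hq
  set B1 := (1 + Real.log q)^2 / Real.log Z / q + t^(-(α/2)) * (1 + 1/α)^24 with hB1
  have ht0 : 0 < t := by linarith
  have hB0 : 0 ≤ B1 := by positivity
  have hterm : ∀ m ∈ Ioc 0 N, (if m ∈ Z.smoothNumbers ∧ m.Coprime q then MF fL m * roughCount Z q (b * (m : ZMod q)⁻¹) (t / m) else 0)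
      ≤ if m ∈ Z.smoothNumbers then t * B1 * (MF f m * (m:ℝ)⁻¹) + t * t^(-(α/2)) * (m:ℝ)^(-1+α) else 0 := by
    intro m hm
    rw [mem_Ioc] at hm
    have hm0 : (0:ℝ) < m := by exact_mod_cast hm.1
    by_cases cs : m ∈ Z.smoothNumbers
    swap
    · rw [if_neg (by tauto), if_neg cs]
    rw [if_pos cs]
    have n1 : 0 ≤ t * B1 * (MF f m * (m:ℝ)⁻¹) := by have := MF_nonneg hf0 m; positivity
    have n2 : 0 ≤ t * t^(-(α/2)) * (m:ℝ)^(-1+α) := by positivity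
    split_ifs with cc
    swap
    · positivity
    have htm : 0 ≤ t / m := by positivity
    by_cases cm : (m:ℝ) ≤ t^(1/2:ℝ)
    · have hs := sieve Z q hZ hq (b * (m : ZMod q)⁻¹) (t/m) htm α ha ha' hN
      have h2 : (t/m)^(1-α) ≤ (t / m) * t^(-(α/2)) := by
        have hpos : 0 < t / m := by positivity
        rw [sub_eq_add_neg, Real.rpow_add hpos, Real.rpow_one]
        apply mul_le_mul_of_nonneg_left _ hpos.le
        have : t^(1/2:ℝ) ≤ t / m := by
          rw [le_div_iff₀ hm0]
          calc t^(1/2:ℝ) * m ≤ t^(1/2:ℝ) * t^(1/2:ℝ) := by gcongr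
            _ = t := by rw [← Real.rpow_add ht0]; norm_num
        calc (t/m)^(-α) ≤ (t^(1/2:ℝ))^(-α) :=
              Real.rpow_le_rpow_of_nonpos (by positivity) this (by linarith)
          _ = t^(-(α/2)) := by rw [← Real.rpow_mul ht0.le]; congr 1; ring
      have h3 : roughCount Z q (b * (m : ZMod q)⁻¹) (t / m) ≤ (t/m) * B1 := by
        refine hs.trans ?_
        have : (t/m)^(1-α) * (1 + 1/α)^24 ≤ (t / m) * t^(-(α/2)) * (1+1/α)^24 :=
          mul_le_mul_of_nonneg_right h2 (by positivity)
        have e : t / m / q * (1 + Real.log q)^2 / Real.log Z = (t/m) * ((1 + Real.log q)^2 / Real.log Z / q) := by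
          field_simp
        rw [e, hB1, mul_add]; linarith
      have h4 : MF fL m * roughCount Z q (b * (m : ZMod q)⁻¹) (t / m) ≤ MF f m * ((t/m) * B1) := by
        apply mul_le_mul (hLle m) h3 _ (MF_nonneg hf0 m)
        unfold roughCount; positivity
      have e : MF f m * ((t/m) * B1) = t * B1 * (MF f m * (m:ℝ)⁻¹) := by field_simp
      linarith
    · push Not at cm
      have h3 : roughCount Z q (b * (m : ZMod q)⁻¹) (t / m) ≤ t / m := by
        unfold roughCount
        calc _ ≤ ((Icc 1 ⌊t/m⌋₊).card : ℝ) := by exact_mod_cast Finset.card_filter_le _ _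
          _ = (⌊t/m⌋₊ : ℝ) := by simp
          _ ≤ _ := Nat.floor_le htm
      have h4 : MF fL m * roughCount Z q (b * (m : ZMod q)⁻¹) (t / m) ≤ 1 * (t / m) := by
        apply mul_le_mul ((hLle m).trans (hf1' m)) h3 _ zero_le_one
        unfold roughCount; positivity
      have h5 : t / m ≤ t * t^(-(α/2)) * (m:ℝ)^(-1+α) := by
        rw [div_eq_mul_inv, mul_assoc]
        apply mul_le_mul_of_nonneg_left _ ht0.le
        rw [Real.rpow_add hm0, Real.rpow_neg_one, mul_comm ((m:ℝ)⁻¹), ← mul_assoc]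
        apply le_mul_of_one_le_left (by positivity)
        calc (1:ℝ) = t^(-(α/2)) * (t^(1/2:ℝ))^α := by
              rw [← Real.rpow_mul ht0.le, ← Real.rpow_add ht0]; ring_nf; simp
          _ ≤ _ := by gcongr
      linarith
  refine s1.trans ((Finset.sum_le_sum hbound).trans ((Finset.sum_le_sum hterm).trans ?_))
  rw [← Finset.sum_filter, Finset.sum_add_distrib, ← Finset.mul_sum, ← Finset.mul_sum]
  have hmem : ∀ n ∈ (Ioc 0 N).filter (fun m => m ∈ Z.smoothNumbers), n ∈ Z.smoothNumbers := fun n hn => (mem_filter.1 hn).2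
  have f1 := smooth_f_sum δ h0 h1 Y Z hYZ _ hmem
  have f2 := (smooth_sum_le (a := -1 + α) (by linarith) Z _ hmem).trans (PP_rankin Z α ha ha' hN)
  have g1 := mul_le_mul_of_nonneg_left f1 (show 0 ≤ t * B1 by positivity)
  have g2 := mul_le_mul_of_nonneg_left f2 (show 0 ≤ t * t^(-(α/2)) by positivity)
  refine (add_le_add g1 g2).trans (le_of_eq ?_)
  ring

lemma norm_cpow_neg_le {s : ℂ} (hs : 1 < s.re) {u v : ℝ} (hv : 1 ≤ v) (huv : v ≤ u) :
    ‖(u:ℂ) ^ (-s)‖ ≤ v⁻¹ := by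
  rw [Complex.norm_cpow_eq_rpow_re_of_pos (by linarith), Complex.neg_re, ← Real.rpow_neg_one]
  calc u ^ (-s.re) ≤ v ^ (-s.re) := Real.rpow_le_rpow_of_nonpos (by linarith) huv (by linarith)
    _ ≤ v ^ (-1:ℝ) := Real.rpow_le_rpow_of_exponent_le hv (by linarith)

lemma cpow_diff {s : ℂ} (hs : 1 < s.re) {u v w b : ℝ} (hv : 1 ≤ v) (hu : u ∈ Set.Icc v (v+b))
    (hw : w ∈ Set.Icc v (v+b)) :
    ‖(u:ℂ) ^ (-s) - (w:ℂ) ^ (-s)‖ ≤ ‖s‖ * v⁻¹ ^ 2 * b := by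
  have hs0 : s ≠ 0 := by rintro rfl; simp at hs; linarith
  have key : ∀ u w : ℝ, v ≤ w → w ≤ u → u ≤ v + b → ‖(u:ℂ) ^ (-s) - (w:ℂ) ^ (-s)‖ ≤ ‖s‖ * v⁻¹ ^ 2 * b := by
    intro u w h1 h2 h3
    have := norm_image_sub_le_of_norm_deriv_le_segment' (a := w) (b := u)
      (f := fun y : ℝ => (y:ℂ)^(-s)) (f' := fun y : ℝ => -s * (y:ℂ)^(-s-1)) (C := ‖s‖ * v⁻¹^2)
      (fun y hy => (hasDerivAt_ofReal_cpow_const (by linarith [hy.1]) (neg_ne_zero.2 hs0)).hasDerivWithinAt) ?_ u ⟨h2, le_rfl⟩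
    · refine this.trans ?_
      gcongr; linarith
    · intro y hy
      have hy0 : 0 < y := by linarith [hy.1]
      rw [norm_mul, norm_neg]
      gcongr
      rw [Complex.norm_cpow_eq_rpow_re_of_pos hy0]
      simp only [Complex.sub_re, Complex.neg_re, Complex.one_re]
      calc y ^ (-s.re - 1) ≤ v ^ (-s.re-1) := Real.rpow_le_rpow_of_nonpos (by linarith) (by linarith [hy.1]) (by linarith)
        _ ≤ v ^ (-2:ℝ) := Real.rpow_le_rpow_of_exponent_le hv (by linarith)
        _ = v⁻¹^2 := by
          rw [Real.rpow_neg (by linarith), inv_pow]; norm_num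
  rcases le_total w u with h | h
  · exact key u w hw.1 h hu.2
  · rw [norm_sub_rev]; exact key w u hu.1 h hw.2

/-- Antiderivative used in the comparison. -/
def FF (s : ℂ) (q : ℕ) (m : ℕ) : ℂ := ((q * m : ℝ) : ℂ) ^ (1 - s) / ((s - 1) * q)

lemma FF_norm {s : ℂ} (hs : 1 < s.re) {q m : ℕ} (hq : 1 ≤ q) (hm : 1 ≤ m) :
    ‖FF s q m‖ ≤ 1 / (‖s-1‖ * q) := by
  have hs1 : 0 < ‖s - 1‖ := norm_pos_iff.2 (by intro h; have := congrArg Complex.re h; simp at this; linarith)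
  have hq' : (1:ℝ) ≤ q := by exact_mod_cast hq
  have hm' : (1:ℝ) ≤ m := by exact_mod_cast hm
  have : (1:ℝ) ≤ q * m := by nlinarith
  unfold FF
  rw [norm_div, norm_mul, Complex.norm_natCast]
  gcongr
  rw [Complex.norm_cpow_eq_rpow_re_of_pos (by linarith)]
  apply Real.rpow_le_one_of_one_le_of_nonpos this
  simp; linarith

lemma block_err {s : ℂ} (hs : 1 < s.re) {q m j : ℕ} (hm : 1 ≤ m) (hj : j < q) {κ : ℝ} (hκ : 0 < κ) (hκ1 : κ ≤ 1) :
    ‖((q * m + j : ℕ) : ℂ) ^ (-s) - (FF s q m - FF s q (m+1))‖ ≤ 2 / q * ‖s‖ ^ κ * (m:ℝ)^(-(1+κ)) := by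
  have hq : 1 ≤ q := by omega
  have hq' : (1:ℝ) ≤ q := by exact_mod_cast hq
  have hm' : (1:ℝ) ≤ m := by exact_mod_cast hm
  have hj' : (j:ℝ) ≤ q := by exact_mod_cast hj.le
  have hv : (1:ℝ) ≤ q * m := by nlinarith
  have hs1 : s - 1 ≠ 0 := by intro h; have := congrArg Complex.re h; simp at this; linarith
  have hs1' : 1 - s ≠ 0 := by intro h; apply hs1; linear_combination -h
  have hsn : 0 < ‖s‖ := norm_pos_iff.2 (by rintro rfl; simp at hs; linarith)
  set v : ℝ := q * m with hvdef
  set n : ℝ := v + j with hn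
  have hnc : ((q * m + j : ℕ) : ℂ) = (n : ℂ) := by simp [hn, hvdef]
  set M : ℝ := 2 / (v) * (‖s‖/m)^κ with hM
  have hbound : ∀ u ∈ Set.Icc v (v+q), ‖(u:ℂ)^(-s) - (n:ℂ)^(-s)‖ ≤ M := by
    intro u hu
    have hnm : n ∈ Set.Icc v (v+q) := ⟨by simp [hn], by simp [hn]; exact hj.le⟩
    have b1 := cpow_diff hs hv hu hnm
    have b2 : ‖(u:ℂ)^(-s) - (n:ℂ)^(-s)‖ ≤ 2 / v := by
      have := norm_sub_le ((u:ℂ)^(-s)) ((n:ℂ)^(-s))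
      have h1 := norm_cpow_neg_le hs hv hu.1
      have h2 := norm_cpow_neg_le hs hv hnm.1
      rw [div_eq_mul_inv]; linarith
    have b1' : ‖s‖ * v⁻¹ ^ 2 * q = 1 / v * (‖s‖/m) := by
      rw [hvdef]; field_simp
    rw [b1'] at b1
    rcases le_or_gt 1 (‖s‖/m) with h | h
    · refine b2.trans ?_
      have := Real.one_le_rpow h hκ.le
      rw [hM]; exact le_mul_of_one_le_right (by positivity) this
    · refine b1.trans ?_
      have : (‖s‖/m) ≤ (‖s‖/m)^κ := by
        conv_lhs => rw [← Real.rpow_one (‖s‖/m)]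
        exact Real.rpow_le_rpow_of_exponent_ge (by positivity) h.le hκ1
      rw [hM]; gcongr; norm_num
  have hr : -s ≠ -1 := by intro h; apply hs1; linear_combination -h
  have mv := norm_image_sub_le_of_norm_deriv_le_segment' (a := v) (b := v+q)
      (f := fun y : ℝ => (y:ℂ)^(-s+1)/(-s+1) - (n:ℂ)^(-s) * y) (f' := fun y : ℝ => (y:ℂ)^(-s) - (n:ℂ)^(-s)) (C := M)
      (fun y hy => by
        have h1 := hasDerivAt_ofReal_cpow_const' (x := y) (by linarith [hy.1]) hr
        have h2 : HasDerivAt (fun y : ℝ => (n:ℂ)^(-s) * (y:ℂ)) ((n:ℂ)^(-s) * 1) y :=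
          (Complex.ofRealCLM.hasDerivAt (x := y)).const_mul _
        rw [mul_one] at h2
        exact (h1.sub h2).hasDerivWithinAt) (fun u hu => hbound u ⟨hu.1, hu.2.le⟩) (v+q) ⟨by linarith, le_rfl⟩
  have e : ((n : ℂ) ^ (-s) - (FF s q m - FF s q (m+1))) * q =
     - ((((v+q : ℝ):ℂ)^(-s+1)/(-s+1) - (n:ℂ)^(-s) * (v+q:ℝ)) - ((v:ℂ)^(-s+1)/(-s+1) - (n:ℂ)^(-s) * v)) := by
    unfold FF
    have e1 : ((q:ℝ) * ((m+1:ℕ):ℝ)) = v + q := by rw [hvdef]; push_cast; ring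
    rw [e1, ← hvdef]
    have hq0 : (q:ℂ) ≠ 0 := by exact_mod_cast (by omega : q ≠ 0)
    have : -s + 1 ≠ 0 := by rwa [neg_add_eq_sub]
    rw [show 1 - s = -s+1 by ring]
    field_simp
    push_cast
    rw [show s - 1 = -(-s+1) by ring]
    field_simp
    ring
  rw [hnc]
  have e2 := congrArg norm e
  rw [norm_mul, norm_neg, Complex.norm_natCast] at e2
  have e3 : M = 2 / q * ‖s‖ ^ κ * (m:ℝ)^(-(1+κ)) := by
    rw [hM, Real.div_rpow (by positivity) (by positivity), Real.rpow_neg (by positivity), Real.rpow_add (by positivity), Real.rpow_one, hvdef]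
    field_simp
  rw [← e3]
  have hqpos : (0:ℝ) < q := by linarith
  refine le_of_mul_le_mul_right ?_ hqpos
  rw [e2]
  refine mv.trans (le_of_eq ?_)
  ring

lemma L_bound {q : ℕ} (hq : 1 ≤ q) (χ : DirichletCharacter ℂ q) {s : ℂ} (hs : 1 < s.re) {κ : ℝ} (hκ : 0 < κ) (hκ1 : κ ≤ 1)
    (R : ℝ) (hR0 : 0 ≤ R) (hR : χ = 1 → 2 / ‖s-1‖ ≤ R) :
    ‖LSeries (fun n => χ (n : ZMod q)) s‖ ≤ 1 + Real.log q + R + 2 * (1+1/κ) * ‖s‖^κ := by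
  have : NeZero q := ⟨by omega⟩
  have hs0 := Complex.ne_zero_of_one_lt_re hs
  set f : ℕ → ℂ := fun n => χ n * (n:ℂ)^(-s) with hf
  have hsum : HasSum f (LSeries (fun n => χ (n : ZMod q)) s) := by
    have := (summable_dirichletSummand χ hs).of_norm.hasSum
    rwa [tsum_dirichletSummand χ hs] at this
  have ht := hsum.tendsto_sum_nat
  have ht2 : Tendsto (fun M : ℕ => ∑ i ∈ range (q * (M+1)), f i) atTop (nhds (LSeries (fun n => χ (n : ZMod q)) s)) := by
    refine ht.comp ?_
    apply tendsto_atTop_mono (f := fun M : ℕ => M) _ tendsto_id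
    intro M; nlinarith
  set X0 : ℂ := ∑ j ∈ range q, χ (j : ZMod q) with hX0
  have hind : ∀ M : ℕ, ‖∑ i ∈ range (q * (M+1)), f i - ∑ i ∈ range q, f i - X0 * (FF s q 1 - FF s q (M+1))‖
      ≤ ∑ m ∈ range (M+1), 2 * ‖s‖^κ * (m:ℝ)^(-(1+κ)) := by
    intro M
    induction M with
    | zero => simp; positivity
    | succ M ih =>
      rw [show q * (M+1+1) = q * (M+1) + q by ring, Finset.sum_range_add, Finset.sum_range_succ (n := M+1)]
      have hb : ‖∑ x ∈ range q, f (q*(M+1)+x) - X0 * (FF s q (M+1) - FF s q (M+1+1))‖ ≤ 2 * ‖s‖^κ * ((M+1:ℕ):ℝ)^(-(1+κ)) := by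
        rw [hX0, Finset.sum_mul, ← Finset.sum_sub_distrib]
        refine (norm_sum_le_of_le _ (n := fun _ => 2 / q * ‖s‖ ^ κ * ((M+1:ℕ):ℝ)^(-(1+κ))) ?_).trans ?_
        · intro j hj
          have := block_err hs (q := q) (m := M+1) (j := j) (by omega) (Finset.mem_range.1 hj) hκ hκ1
          have hc : χ ((q*(M+1)+j : ℕ) : ZMod q) = χ (j : ZMod q) := by
            congr 1; push_cast; simp
          simp only [hf]
          rw [hc, ← mul_sub, norm_mul]
          refine (mul_le_of_le_one_left (norm_nonneg _) (χ.norm_le_one _)).trans this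
        · rw [Finset.sum_const, Finset.card_range, nsmul_eq_mul]
          have : (q:ℝ) ≠ 0 := by exact_mod_cast (by omega : q ≠ 0)
          apply le_of_eq; field_simp
      refine le_trans (le_of_eq ?_) ((norm_add_le _ _).trans (add_le_add ih hb))
      congr 1; ring
  have h0 : ‖∑ i ∈ range q, f i‖ ≤ 1 + Real.log q := by
    refine le_trans ?_ (sum_inv_le_log q)
    refine (norm_sum_le _ _).trans ?_
    calc ∑ i ∈ range q, ‖f i‖ ≤ ∑ i ∈ range q, (i:ℝ)⁻¹ := by
          apply Finset.sum_le_sum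
          intro i hi
          simp only [hf]
          rcases Nat.eq_zero_or_pos i with rfl | h
          · simp [hs0]
          · rw [norm_mul]
            refine (mul_le_of_le_one_left (norm_nonneg _) (χ.norm_le_one _)).trans ?_
            have := norm_cpow_neg_le hs (u := i) (v := i) (by exact_mod_cast h) le_rfl
            simpa using this
      _ ≤ ∑ i ∈ range (q+1), (i:ℝ)⁻¹ := by
          apply Finset.sum_le_sum_of_subset_of_nonneg
          · intro i; simp; omega
          · intros; positivity
      _ = ∑ n ∈ Icc 1 q, (n:ℝ)⁻¹ := by
          rw [Finset.sum_range_succ', Finset.range_eq_Ico, Finset.sum_Ico_add' (fun i : ℕ => ((i:ℕ):ℝ)⁻¹) 0 q 1]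
          simp
          rfl
  have hX : ∀ M, ‖X0 * (FF s q 1 - FF s q (M+1))‖ ≤ R := by
    intro M
    have hX0z : X0 = ∑ a : ZMod q, χ a := by
      rw [hX0]
      rw [← Fin.sum_univ_eq_sum_range (fun j => χ (j : ZMod q)) q]
      refine Fintype.sum_bijective (fun i : Fin q => ((i:ℕ) : ZMod q)) ?_ _ _ (fun _ => rfl)
      rw [Fintype.bijective_iff_injective_and_card]
      constructor
      · intro a b hab
        have := (ZMod.natCast_eq_natCast_iff' _ _ _).1 hab
        rw [Nat.mod_eq_of_lt a.2, Nat.mod_eq_of_lt b.2] at this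
        exact Fin.ext this
      · simp [ZMod.card]
    by_cases h : χ = 1
    · rw [norm_mul]
      have hX0n : ‖X0‖ ≤ q := by
        refine (norm_sum_le_of_le _ (fun j _ => χ.norm_le_one _)).trans ?_
        simp
      have h1 := FF_norm hs hq (m := 1) le_rfl
      have h2 := FF_norm hs hq (m := M+1) (by omega)
      have h3 := norm_sub_le (FF s q 1) (FF s q (M+1))
      have hs1 : 0 < ‖s - 1‖ := norm_pos_iff.2 (by intro h; have := congrArg Complex.re h; simp at this; linarith)
      have hqpos : (0:ℝ) < q := by exact_mod_cast hq
      calc ‖X0‖ * ‖FF s q 1 - FF s q (M+1)‖ ≤ q * (1 / (‖s-1‖ * q) + 1 / (‖s-1‖ * q)) := by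
            gcongr; linarith
        _ = 2 / ‖s-1‖ := by field_simp; norm_num
        _ ≤ R := hR h
    · rw [hX0z, MulChar.sum_eq_zero_of_ne_one h]; simpa using hR0
  have hall : ∀ M : ℕ, ‖∑ i ∈ range (q * (M+1)), f i‖ ≤ 1 + Real.log q + R + 2 * (1+1/κ) * ‖s‖^κ := by
    intro M
    have h1 := hind M
    have h2 := hX M
    have h3 : ∑ m ∈ range (M+1), 2 * ‖s‖^κ * (m:ℝ)^(-(1+κ)) ≤ 2 * (1+1/κ) * ‖s‖^κ := by
      rw [← Finset.mul_sum]
      have := zeta_sum_le κ hκ (range (M+1))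
      calc _ ≤ 2 * ‖s‖^κ * (1+1/κ) := by gcongr
        _ = _ := by ring
    have h4 : ∑ i ∈ range (q * (M+1)), f i = (∑ i ∈ range (q * (M+1)), f i - ∑ i ∈ range q, f i - X0 * (FF s q 1 - FF s q (M+1))) + ∑ i ∈ range q, f i + X0 * (FF s q 1 - FF s q (M+1)) := by ring
    rw [h4]
    refine (norm_add₃_le).trans ?_
    linarith
  exact le_of_tendsto' ht2.norm hall

lemma z_norm {q : ℕ} (χ : DirichletCharacter ℂ q) {s : ℂ} {p : ℕ} (hp : p.Prime) :
    ‖χ p * (p:ℂ)^(-s)‖ ≤ (p:ℝ)^(-s.re) := by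
  rw [norm_mul]
  have : ‖(p:ℂ)^(-s)‖ = (p:ℝ)^(-s.re) := by
    have := Complex.norm_cpow_eq_rpow_re_of_pos (x := (p:ℝ)) (by exact_mod_cast hp.pos) (-s)
    simpa using this
  rw [← this]
  exact mul_le_of_le_one_left (norm_nonneg _) (χ.norm_le_one _)

lemma prod_Y_bound {q : ℕ} (χ : DirichletCharacter ℂ q) {s : ℂ} {σ : ℝ} (hσ : 0 < σ) (hs : s.re = 1 + σ) (Y : ℕ) :
    ∏ p ∈ Y.primesBelow, ‖1 - χ p * (p:ℂ)^(-s)‖⁻¹ ≤ ‖LSeries (fun n => χ (n : ZMod q)) s‖ * (1+1/σ) / PP (-(1+σ)) Y := by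
  have hs1 : 1 < s.re := by linarith
  have ht := (DirichletCharacter.LSeries_eulerProduct χ hs1).norm
  have ht2 := (ht.mul_const (1+1/σ)).div_const (PP (-(1+σ)) Y)
  refine ge_of_tendsto ht2 ?_
  filter_upwards [eventually_ge_atTop Y] with N hN
  have hPY : 0 < PP (-(1+σ)) Y := PP_pos (by linarith) Y
  have hPN := PP_le_zeta σ hσ N
  rw [le_div_iff₀ hPY]
  have hsub : Y.primesBelow ⊆ N.primesBelow := by
    intro p hp
    rw [Nat.mem_primesBelow] at *
    exact ⟨by omega, hp.2⟩
  have hz : ∀ p : ℕ, p.Prime → ‖χ p * (p:ℂ)^(-s)‖ < 1 ∧ ‖1 - χ p * (p:ℂ)^(-s)‖ ≤ (1 - (p:ℝ)^(-(1+σ)))⁻¹ ∧ 0 < ‖1 - χ p * (p:ℂ)^(-s)‖ := by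
    intro p hp
    have h1 := z_norm χ (s := s) hp
    have h2 := rpow_prime_lt_one (a := -(1+σ)) (by linarith) hp
    rw [hs] at h1
    have h3 := norm_sub_le (1:ℂ) (χ p * (p:ℂ)^(-s))
    have h4 := norm_sub_norm_le (1:ℂ) (χ p * (p:ℂ)^(-s))
    rw [norm_one] at h3 h4
    have hpos : (0:ℝ) ≤ (p:ℝ)^(-(1+σ)) := by positivity
    refine ⟨by linarith, ?_, by linarith⟩
    rw [le_inv_comm₀ (by linarith) (by linarith)]
    refine le_trans ?_ (inv_anti₀ (by linarith) (h3.trans (by linarith : _ ≤ 1 + (p:ℝ)^(-(1+σ)))))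
    rw [le_inv_comm₀ (by linarith) (by linarith), ← one_div, le_div_iff₀ (by linarith)]
    nlinarith
  rw [norm_prod, ← Finset.prod_sdiff hsub]
  have hPP : PP (-(1+σ)) N = (∏ p ∈ N.primesBelow \ Y.primesBelow, (1 - (p : ℝ) ^ (-(1+σ)))⁻¹) * PP (-(1+σ)) Y := by
    unfold PP; rw [Finset.prod_sdiff hsub]
  set a := ∏ p ∈ Y.primesBelow, ‖1 - χ p * (p:ℂ)^(-s)‖⁻¹ with ha
  have ha' : ∏ p ∈ Y.primesBelow, ‖(1 - χ p * (p:ℂ)^(-s))⁻¹‖ = a := by simp [ha]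
  rw [ha']
  have hapos : 0 ≤ a := Finset.prod_nonneg (fun _ _ => by positivity)
  set b := ∏ p ∈ N.primesBelow \ Y.primesBelow, (1 - (p : ℝ) ^ (-(1+σ)))⁻¹ with hb
  set d := ∏ p ∈ N.primesBelow \ Y.primesBelow, ‖(1 - χ p * (p:ℂ)^(-s))⁻¹‖ with hd
  have hdn : 0 ≤ d := Finset.prod_nonneg (fun _ _ => by positivity)
  have hbd : 1 ≤ d * b := by
    rw [hd, hb, ← Finset.prod_mul_distrib]
    refine le_trans (le_of_eq (Finset.prod_const_one (s := N.primesBelow \ Y.primesBelow)).symm) ?_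
    apply Finset.prod_le_prod
    · intros; norm_num
    · intro p hp
      obtain ⟨h1, h2, h3⟩ := hz p (Nat.prime_of_mem_primesBelow (Finset.mem_sdiff.1 hp).1)
      rw [norm_inv, ← div_eq_inv_mul, le_div_iff₀ h3, one_mul]
      exact h2
  calc a * PP (-(1+σ)) Y = 1 * (a * PP (-(1+σ)) Y) := by ring
    _ ≤ d * b * (a * PP (-(1+σ)) Y) := by gcongr
    _ = d * a * PP (-(1+σ)) N := by rw [hPP]; ring
    _ ≤ d * a * (1+1/σ) := by gcongr

/-- Bound for the Dirichlet series over smooth numbers. -/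
lemma D_bound {q : ℕ} (χ : DirichletCharacter ℂ q) {s : ℂ} {σ : ℝ} (hσ : 0 < σ) (hs : s.re = 1 + σ) (Y : ℕ)
    (δ : ℝ) (h0 : 0 < δ) (h1 : δ < 1) :
    ‖∏ p ∈ Y.primesBelow, (1 + δ * ((χ p * (p:ℂ)^(-s)) / (1 - χ p * (p:ℂ)^(-s))))‖ ≤
     Real.exp 28 * (1 + ‖LSeries (fun n => χ (n : ZMod q)) s‖ * (1+1/σ) / PP (-(1+σ)) Y) := by
  have hz : ∀ p : ℕ, p.Prime → ‖χ p * (p:ℂ)^(-s)‖ ≤ (p:ℝ)⁻¹ := by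
    intro p hp
    refine (z_norm χ hp).trans ?_
    rw [← Real.rpow_neg_one]
    exact Real.rpow_le_rpow_of_exponent_le (by exact_mod_cast hp.one_le) (by linarith)
  rw [norm_prod]
  have h2 : ∏ p ∈ Y.primesBelow, ‖1 + δ * ((χ p * (p:ℂ)^(-s)) / (1 - χ p * (p:ℂ)^(-s)))‖ ≤
      ∏ p ∈ Y.primesBelow, ((‖1 - χ p * (p:ℂ)^(-s)‖⁻¹)^δ * Real.exp (14 * ((p:ℝ)⁻¹)^2)) := by
    apply Finset.prod_le_prod
    · intros; positivity
    · intro p hp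
      have hpp := Nat.prime_of_mem_primesBelow hp
      have hb := hz p hpp
      have h2p : (p:ℝ)⁻¹ ≤ 1/2 := by
        rw [one_div]; exact inv_anti₀ (by norm_num) (by exact_mod_cast hpp.two_le)
      refine (euler_factor δ h0 h1 _ (hb.trans h2p)).trans ?_
      gcongr
  refine h2.trans ?_
  rw [Finset.prod_mul_distrib, ← Real.exp_sum, ← Finset.mul_sum, Real.finsetProd_rpow _ _ (fun _ _ => by positivity)]
  have h3 : Real.exp (14 * ∑ p ∈ Y.primesBelow, ((p:ℝ)⁻¹)^2) ≤ Real.exp 28 := by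
    apply Real.exp_le_exp.2
    have := sum_inv_sq_le Y.primesBelow
    linarith
  have h4 := prod_Y_bound χ hσ hs Y
  set a := ∏ p ∈ Y.primesBelow, ‖1 - χ p * (p:ℂ)^(-s)‖⁻¹
  have ha : 0 ≤ a := Finset.prod_nonneg (fun _ _ => by positivity)
  have h5 : a ^ δ ≤ 1 + a := by
    rcases le_total a 1 with h | h
    · have := Real.rpow_le_one ha h h0.le; linarith
    · have := Real.rpow_le_rpow_of_exponent_le h h1.le
      rw [Real.rpow_one] at this; linarith
  rw [mul_comm]
  gcongr
  linarith

lemma ramp_integrableOn {r : ℂ} (hr : 0 < r.re) :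
    IntegrableOn (fun y : ℝ => (y:ℂ) * Complex.exp (-(r * y))) (Set.Ioi 0) := by
  have h1 := integrableOn_rpow_mul_exp_neg_mul_rpow (s := 1) (p := 1) (b := r.re) (by norm_num) (by norm_num) hr
  refine Integrable.mono' h1 ?_ ?_
  · exact (Continuous.aestronglyMeasurable (by fun_prop)).restrict
  · filter_upwards [ae_restrict_mem measurableSet_Ioi] with y hy
    have hy0 : 0 < y := hy
    rw [norm_mul, Complex.norm_exp, Complex.norm_real, Real.norm_of_nonneg hy0.le, Real.rpow_one]
    simp

lemma ramp_integral {r : ℂ} (hr : 0 < r.re) :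
    ∫ y in Set.Ioi (0:ℝ), (y:ℂ) * Complex.exp (-(r * y)) = 1 / r ^ 2 := by
  have hr0 : r ≠ 0 := by rintro rfl; simp at hr
  have h := integral_Ioi_of_hasDerivAt_of_tendsto' (a := (0:ℝ)) (m := (0:ℂ))
    (f := fun y : ℝ => -(((y:ℂ)/r + 1/r^2) * Complex.exp (-(r * y))))
    (f' := fun y : ℝ => (y:ℂ) * Complex.exp (-(r * y))) ?_ (ramp_integrableOn hr) ?_
  · rw [h]; simp
  · intro y _
    have ho : HasDerivAt (fun y : ℝ => (y:ℂ)) 1 y := Complex.ofRealCLM.hasDerivAt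
    have h1 : HasDerivAt (fun y : ℝ => Complex.exp (-(r * y))) (Complex.exp (-(r*y)) * (-(r*1))) y :=
      ((ho.const_mul r).neg).cexp
    have h2 : HasDerivAt (fun y : ℝ => (y:ℂ)/r + 1/r^2) (1/r) y := (ho.div_const r).add_const _
    have h3 := (h2.mul h1).neg
    refine h3.congr_deriv ?_
    field_simp
    ring
  · rw [tendsto_zero_iff_norm_tendsto_zero]
    have e : ∀ᶠ y : ℝ in atTop, ‖-(((y:ℂ)/r + 1/r^2) * Complex.exp (-(r * y)))‖ ≤
        y^(1:ℝ) * Real.exp (-r.re * y) * ‖1/r‖ + y^(0:ℝ) * Real.exp (-r.re * y) * ‖1/r^2‖ := by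
      filter_upwards [eventually_gt_atTop 0] with y hy
      rw [norm_neg, norm_mul, Complex.norm_exp]
      have : ‖(y:ℂ)/r + 1/r^2‖ ≤ y * ‖1/r‖ + ‖1/r^2‖ := by
        refine (norm_add_le _ _).trans ?_
        rw [div_eq_mul_one_div, norm_mul, Complex.norm_real, Real.norm_of_nonneg hy.le]
      rw [Real.rpow_one, Real.rpow_zero]
      have e2 : (-(r * (y:ℂ))).re = -r.re * y := by simp
      rw [e2]
      calc _ ≤ (y * ‖1/r‖ + ‖1/r^2‖) * Real.exp (-r.re * y) := by gcongr
        _ = _ := by ring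
    refine squeeze_zero' (Eventually.of_forall fun _ => norm_nonneg _) e ?_
    have t1 := tendsto_rpow_mul_exp_neg_mul_atTop_nhds_zero 1 r.re hr
    have t0 := tendsto_rpow_mul_exp_neg_mul_atTop_nhds_zero 0 r.re hr
    have := (t1.mul_const ‖1/r‖).add (t0.mul_const ‖1/r^2‖)
    rwa [zero_mul, zero_mul, add_zero] at this

lemma inv_sq_integrable {c : ℝ} (hc : 0 < c) :
    Integrable (fun t : ℝ => 1 / ((c:ℂ) + t * Complex.I)^2) := by
  have h1 : Integrable (fun t : ℝ => (1 + (c⁻¹ * t)^2)⁻¹ * (c⁻¹)^2) :=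
    ((integrable_inv_one_add_sq).comp_mul_left' (by positivity : c⁻¹ ≠ 0)).mul_const _
  refine h1.mono' ?_ ?_
  · apply Continuous.aestronglyMeasurable
    apply Continuous.div continuous_const (by fun_prop)
    intro t h
    have := pow_eq_zero_iff (two_ne_zero) |>.1 h
    have := congrArg Complex.re this
    simp at this; linarith
  · refine Eventually.of_forall fun t => ?_
    rw [norm_div, norm_one, norm_pow, ← Complex.normSq_eq_norm_sq]
    have : Complex.normSq ((c:ℂ) + t * Complex.I) = c^2 + t^2 := by
      rw [Complex.normSq_add_mul_I]
    rw [this]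
    apply le_of_eq
    field_simp

open FourierTransform in
lemma perron_fourier {c : ℝ} (hc : 0 < c) (y : ℝ) :
    ∫ t : ℝ, Complex.exp (((c:ℂ) + t * Complex.I) * y) * (1 / ((c:ℂ) + t * Complex.I)^2) = 2 * (Real.pi:ℂ) * ((max y 0 : ℝ):ℂ) := by
  set f : ℝ → ℂ := fun y => ((max y 0 : ℝ) : ℂ) * Complex.exp (-((c:ℂ) * y)) with hf
  have hfc : Continuous f := by rw [hf]; fun_prop
  have hind : ∀ (w : ℝ), (fun v : ℝ => Complex.exp (↑(-2 * Real.pi * v * w) * Complex.I) • f v) =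
      Set.indicator (Set.Ioi 0) (fun v : ℝ => (v:ℂ) * Complex.exp (-(((c:ℂ) + (2*Real.pi*w : ℝ) * Complex.I) * v))) := by
    intro w; ext v
    by_cases hv : 0 < v
    · rw [Set.indicator_of_mem (show v ∈ Set.Ioi 0 from hv), hf]
      simp only [max_eq_left hv.le, smul_eq_mul]
      rw [mul_left_comm, ← Complex.exp_add]
      congr 2; push_cast; ring
    · rw [Set.indicator_of_notMem (show v ∉ Set.Ioi 0 from hv), hf]
      simp [max_eq_right (not_lt.1 hv)]
  have hfi : Integrable f := by
    have h0 := hind 0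
    have : f = Set.indicator (Set.Ioi 0) (fun v : ℝ => (v:ℂ) * Complex.exp (-(((c:ℂ) + (2*Real.pi*0 : ℝ) * Complex.I) * v))) := by
      rw [← h0]; ext v; simp
    rw [this, integrable_indicator_iff measurableSet_Ioi]
    exact ramp_integrableOn (by simpa using hc)
  have hF : 𝓕 f = fun w : ℝ => 1 / ((c:ℂ) + (2*Real.pi*w : ℝ) * Complex.I)^2 := by
    ext w
    rw [Real.fourier_real_eq_integral_exp_smul, hind w, integral_indicator measurableSet_Ioi]
    exact ramp_integral (by simpa using hc)
  have hFi : Integrable (𝓕 f) := by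
    rw [hF]
    exact (inv_sq_integrable hc).comp_mul_left' (by positivity : (2*Real.pi) ≠ 0)
  have inv := congrFun (hfc.fourierInv_fourier_eq hfi hFi) y
  rw [Real.fourierInv_eq', hF] at inv
  have e1 : (fun v : ℝ => Complex.exp (↑(2 * Real.pi * inner ℝ v y) * Complex.I) • (1 / ((c:ℂ) + (2*Real.pi*v : ℝ) * Complex.I)^2)) =
     fun v => (fun t : ℝ => Complex.exp ((t:ℂ) * y * Complex.I) * (1 / ((c:ℂ) + t * Complex.I)^2)) (2*Real.pi * v) := by
    ext v
    simp only [smul_eq_mul, RCLike.inner_apply, conj_trivial]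
    congr 2
    push_cast; ring
  have e1' := Measure.integral_comp_mul_left (fun t : ℝ => Complex.exp ((t:ℂ) * y * Complex.I) * (1 / ((c:ℂ) + t * Complex.I)^2)) (2*Real.pi)
  rw [e1, e1'] at inv
  have e2 : ∀ t : ℝ, Complex.exp (((c:ℂ) + t * Complex.I) * y) * (1 / ((c:ℂ) + t * Complex.I)^2) =
     Complex.exp (c*y) * (Complex.exp ((t:ℂ) * y * Complex.I) * (1 / ((c:ℂ) + t * Complex.I)^2)) := by
    intro t; rw [← mul_assoc, ← Complex.exp_add]; congr 2; ring
  simp_rw [e2]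
  rw [integral_const_mul]
  rw [abs_of_pos (by positivity)] at inv
  have hpi : (0:ℝ) < 2 * Real.pi := by positivity
  set I0 := ∫ t : ℝ, Complex.exp ((t:ℂ) * y * Complex.I) * (1 / ((c:ℂ) + t * Complex.I)^2)
  have e3 : I0 = (2*Real.pi : ℝ) * f y := by
    rw [← inv, Complex.real_smul]
    push_cast
    have : (Real.pi : ℂ) ≠ 0 := by exact_mod_cast Real.pi_ne_zero
    field_simp
  rw [e3, hf]
  simp only
  have : Complex.exp (c*y) * Complex.exp (-(c*y)) = 1 := by rw [← Complex.exp_add]; simp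
  push_cast
  linear_combination (2 * (Real.pi:ℂ) * ((max y 0 : ℝ):ℂ)) * this

/-- smoothed cutoff kernel in logarithmic coordinates -/
def kk (η y : ℝ) : ℝ := (max (y + η) 0 - max y 0) / η

lemma kk_nonneg {η : ℝ} (h : 0 < η) (y : ℝ) : 0 ≤ kk η y :=
  div_nonneg (sub_nonneg.2 (max_le_max (by linarith) le_rfl)) h.le

lemma kk_le_one {η : ℝ} (h : 0 < η) (y : ℝ) : kk η y ≤ 1 := by
  unfold kk
  rw [div_le_one h]
  have : max (y+η) 0 ≤ max y 0 + η := max_le (by linarith [le_max_left y 0]) (by linarith [le_max_right y 0])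
  linarith

lemma kk_one {η : ℝ} (h : 0 < η) {y : ℝ} (hy : 0 ≤ y) : kk η y = 1 := by
  unfold kk; rw [max_eq_left hy, max_eq_left (by linarith)]; field_simp; ring

lemma kk_zero {η y : ℝ} (h : 0 < η) (hy : y ≤ -η) : kk η y = 0 := by
  unfold kk; rw [max_eq_right (by linarith), max_eq_right (by linarith)]; simp

/-- Transform of `kk`. -/
def JJ (η : ℝ) (s : ℂ) : ℂ := (Complex.exp (η * s) - 1) / (η * s^2)

lemma exp_inv_sq_integrable {c : ℝ} (hc : 0 < c) (y : ℝ) :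
    Integrable (fun t : ℝ => Complex.exp (((c:ℂ) + t * Complex.I) * y) * (1 / ((c:ℂ) + t * Complex.I)^2)) := by
  refine Integrable.bdd_mul (c := Real.exp (c*y)) (inv_sq_integrable hc) (Continuous.aestronglyMeasurable (by fun_prop)) ?_
  refine Eventually.of_forall fun t => ?_
  rw [Complex.norm_exp]
  simp

lemma JJ_expand {η : ℝ} (hη : 0 < η) {c : ℝ} (hc : 0 < c) (y t : ℝ) :
    JJ η ((c:ℂ) + t * Complex.I) * Complex.exp (((c:ℂ) + t * Complex.I) * y) =
    (1/η : ℂ) * (Complex.exp (((c:ℂ) + t * Complex.I) * ((y + η : ℝ):ℂ)) * (1 / ((c:ℂ) + t * Complex.I)^2)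
      - Complex.exp (((c:ℂ) + t * Complex.I) * y) * (1 / ((c:ℂ) + t * Complex.I)^2)) := by
  have hs : (c:ℂ) + t * Complex.I ≠ 0 := by
    intro h; have := congrArg Complex.re h; simp at this; linarith
  unfold JJ
  set s := (c:ℂ) + t * Complex.I
  have : Complex.exp (s * ((y + η : ℝ):ℂ)) = Complex.exp (η * s) * Complex.exp (s * y) := by
    rw [← Complex.exp_add]; congr 1; push_cast; ring
  rw [this]
  have : (η:ℂ) ≠ 0 := by exact_mod_cast hη.ne'
  field_simp

lemma JJ_integrable {η : ℝ} (hη : 0 < η) {c : ℝ} (hc : 0 < c) (y : ℝ) :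
    Integrable (fun t : ℝ => JJ η ((c:ℂ) + t * Complex.I) * Complex.exp (((c:ℂ) + t * Complex.I) * y)) := by
  simp_rw [JJ_expand hη hc]
  exact ((exp_inv_sq_integrable hc (y+η)).sub (exp_inv_sq_integrable hc y)).const_mul _

lemma JJ_integral {η : ℝ} (hη : 0 < η) {c : ℝ} (hc : 0 < c) (y : ℝ) :
    ∫ t : ℝ, JJ η ((c:ℂ) + t * Complex.I) * Complex.exp (((c:ℂ) + t * Complex.I) * y) = 2 * (Real.pi:ℂ) * ((kk η y : ℝ):ℂ) := by
  simp_rw [JJ_expand hη hc]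
  rw [integral_const_mul, integral_sub (exp_inv_sq_integrable hc (y+η)) (exp_inv_sq_integrable hc y), perron_fourier hc, perron_fourier hc]
  unfold kk
  push_cast
  ring

lemma norm_exp_sub_exp_le (w : ℂ) {a b : ℝ} (hab : a ≤ b) {E : ℝ} (hE : ∀ u ∈ Set.Icc a b, Real.exp (w.re * u) ≤ E) :
    ‖Complex.exp (w * b) - Complex.exp (w * a)‖ ≤ ‖w‖ * E * (b - a) := by
  refine norm_image_sub_le_of_norm_deriv_le_segment' (a := a) (b := b)
      (f := fun y : ℝ => Complex.exp (w * y)) (f' := fun y : ℝ => Complex.exp (w * y) * (w * 1)) (C := ‖w‖ * E)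
      (fun y hy => ?_) (fun u hu => ?_) b ⟨hab, le_rfl⟩
  · exact (((Complex.ofRealCLM.hasDerivAt (x := y)).const_mul w).cexp).hasDerivWithinAt
  · rw [mul_one, norm_mul, Complex.norm_exp, mul_comm]
    gcongr
    have := hE u ⟨hu.1, hu.2.le⟩
    simpa using this

lemma JJ_bound {η : ℝ} (hη : 0 < η) (hη1 : η ≤ 1) {s : ℂ} (hs : 1 ≤ s.re) (hs2 : s.re ≤ 2) {κ : ℝ} (hκ : 0 < κ) (hκ1 : κ ≤ 1) :
    ‖JJ η s‖ ≤ 9 * η^(-κ) * ‖s‖^(-(1+κ)) := by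
  have hsn : 1 ≤ ‖s‖ := hs.trans ((le_abs_self _).trans (Complex.abs_re_le_norm s))
  have he2 : Real.exp 2 ≤ 8 := by
    have h := Real.exp_one_lt_d9
    have : Real.exp 2 = Real.exp 1 ^ 2 := by rw [← Real.exp_nat_mul]; norm_num
    rw [this]; nlinarith [Real.exp_pos 1]
  have hexp : ∀ u ∈ Set.Icc 0 η, Real.exp (s.re * u) ≤ 8 := by
    intro u hu
    refine le_trans (Real.exp_le_exp.2 ?_) he2
    nlinarith [hu.1, hu.2]
  have h1 : ‖Complex.exp (η * s) - 1‖ ≤ 9 * (η * ‖s‖) := by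
    have := norm_exp_sub_exp_le s hη.le hexp
    simp only [Complex.ofReal_zero, mul_zero, Complex.exp_zero, sub_zero] at this
    rw [mul_comm (η:ℂ)]
    nlinarith
  have h2 : ‖Complex.exp (η * s) - 1‖ ≤ 9 := by
    refine (norm_sub_le _ _).trans ?_
    rw [norm_one, Complex.norm_exp]
    have := hexp η ⟨hη.le, le_rfl⟩
    have e : ((η:ℂ) * s).re = s.re * η := by simp [mul_comm]
    rw [e]; linarith
  have hu : 0 < η * ‖s‖ := by positivity
  have h3 : ‖Complex.exp (η * s) - 1‖ ≤ 9 * (η * ‖s‖)^(1-κ) := by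
    rcases le_total 1 (η * ‖s‖) with h | h
    · have := Real.one_le_rpow h (by linarith : 0 ≤ 1 - κ)
      linarith
    · have : η * ‖s‖ ≤ (η * ‖s‖)^(1-κ) := by
        conv_lhs => rw [← Real.rpow_one (η * ‖s‖)]
        exact Real.rpow_le_rpow_of_exponent_ge hu h (by linarith)
      linarith
  unfold JJ
  rw [norm_div, norm_mul, norm_pow, Complex.norm_real, Real.norm_of_nonneg hη.le, div_le_iff₀ (by positivity)]
  refine h3.trans (le_of_eq ?_)
  have hs0 : 0 < ‖s‖ := by linarith
  rw [Real.mul_rpow hη.le hs0.le, Real.rpow_sub hη, Real.rpow_sub hs0, Real.rpow_neg hη.le, Real.rpow_neg hs0.le, Real.rpow_add hs0, Real.rpow_one, Real.rpow_one]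
  field_simp

lemma gauss_ft (k y : ℝ) :
    ‖∫ t : ℝ, Complex.exp (-((t:ℂ)-k)^2) * Complex.exp (Complex.I * t * y)‖ = Real.sqrt Real.pi * Real.exp (-(y^2/4)) := by
  have e1 : (fun t : ℝ => Complex.exp (-((t:ℂ)-k)^2) * Complex.exp (Complex.I * t * y)) =
      fun t => (fun t : ℝ => Complex.exp (Complex.I * k * y) * (Complex.exp (Complex.I * y * t) * Complex.exp (-1 * (t:ℂ)^2))) (t - k) := by
    ext t
    simp only [← Complex.exp_add]
    congr 1; push_cast; ring
  rw [e1, integral_sub_right_eq_self (fun t : ℝ => Complex.exp (Complex.I * k * y) * (Complex.exp (Complex.I * y * t) * Complex.exp (-1 * (t:ℂ)^2))) k,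
    integral_const_mul, norm_mul, fourierIntegral_gaussian (by norm_num : 0 < (1:ℂ).re), norm_mul]
  have h1 : ‖Complex.exp (Complex.I * k * y)‖ = 1 := by
    rw [Complex.norm_exp]; simp
  have h2 : ‖Complex.exp (-(y:ℂ)^2 / (4*1))‖ = Real.exp (-(y^2/4)) := by
    rw [Complex.norm_exp]
    congr 1
    have : (-(y:ℂ)^2 / (4*1)) = ((-(y^2/4) : ℝ) : ℂ) := by push_cast; ring
    rw [this, Complex.ofReal_re]
  have h3 : ‖((Real.pi:ℂ) / 1) ^ (1/2 : ℂ)‖ = Real.sqrt Real.pi := by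
    rw [div_one, Complex.norm_cpow_eq_rpow_re_of_pos Real.pi_pos, Real.sqrt_eq_rpow]
    congr 1; norm_num
  rw [h1, h2, h3, one_mul]

lemma gauss_int (k y : ℝ) :
    Integrable (fun t : ℝ => Complex.exp (-((t:ℂ)-k)^2) * Complex.exp (Complex.I * t * y)) := by
  have h0 : Integrable (fun t : ℝ => Real.exp (-1 * (t - k)^2)) := (integrable_exp_neg_mul_sq one_pos).comp_sub_right k
  refine h0.mono' (Continuous.aestronglyMeasurable (by fun_prop)) (Eventually.of_forall fun t => ?_)
  rw [norm_mul, Complex.norm_exp, Complex.norm_exp]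
  have e1 : (-((t:ℂ)-k)^2) = ((-(t-k)^2 : ℝ):ℂ) := by push_cast; ring
  rw [e1, Complex.ofReal_re]
  simp

lemma char_orth {q : ℕ} (hq : 1 ≤ q) (a b : ZMod q) :
    ‖∑ χ : DirichletCharacter ℂ q, χ a * star (χ b)‖ ≤ if a = b then (q.totient : ℝ) else 0 := by
  have : NeZero q := ⟨by omega⟩
  by_cases hb : IsUnit b
  · have hc : ∀ χ : DirichletCharacter ℂ q, χ a * star (χ b) = χ b⁻¹ * χ a := by
      intro χ
      have h1 : ‖χ b‖ = 1 := by
        obtain ⟨u, rfl⟩ := hb; exact DirichletCharacter.unit_norm_eq_one χ u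
      have h2 : χ b * χ b⁻¹ = 1 := by rw [← map_mul, ZMod.mul_inv_of_unit _ hb, map_one]
      have h3 : star (χ b) = (χ b)⁻¹ := (Complex.inv_eq_conj h1).symm
      rw [h3, mul_comm, eq_inv_of_mul_eq_one_right h2]
    simp_rw [hc]
    rw [DirichletCharacter.sum_char_inv_mul_char_eq ℂ hb]
    by_cases hab : b = a
    · simp [hab]
    · rw [if_neg hab, if_neg (Ne.symm hab)]; simp
  · have : ∀ χ : DirichletCharacter ℂ q, χ a * star (χ b) = 0 := by
      intro χ; rw [MulChar.map_nonunit χ hb]; simp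
    simp_rw [this]
    simp
    split_ifs <;> positivity

lemma kernel_sum {q : ℕ} (R : Finset ℕ) (hR : ∀ r ∈ R, 1 ≤ r) {β : ℝ}
    (b : ZMod q) (hN : ∀ t : ℝ, 1 ≤ t → ((R.filter (fun r : ℕ => (r : ZMod q) = b ∧ (r:ℝ) ≤ t)).card : ℝ) ≤ β * t / q)
    (r : ℕ) (hr : 1 ≤ r) :
    ∑ r' ∈ R.filter (fun r' : ℕ => (r' : ZMod q) = b), (r':ℝ)⁻¹ * Real.exp (-|Real.log r' - Real.log r|) ≤ 8 * β / q := by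
  obtain ⟨X, hX⟩ := R.exists_nat_subset_range
  have hr0 : (1:ℝ) ≤ r := by exact_mod_cast hr
  have pt : ∀ r' ∈ R.filter (fun r' : ℕ => (r' : ZMod q) = b), (r':ℝ)⁻¹ * Real.exp (-|Real.log r' - Real.log r|) ≤
      ∑ j ∈ range (X+1), (if (r':ℝ) ≤ 2^j * r then 4 * (1/4:ℝ)^j / r else 0) := by
    intro r' hr'
    have hr'R := (Finset.mem_filter.1 hr').1
    have hr'1 : (1:ℝ) ≤ r' := by exact_mod_cast hR r' hr'R
    have hr'X : r' < X := Finset.mem_range.1 (hX hr'R)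
    have hex : ∃ j, (r':ℝ) ≤ 2^j * r := ⟨r', by
      have : (r':ℝ) ≤ 2^r' := by exact_mod_cast (Nat.lt_two_pow_self).le
      nlinarith⟩
    set j := Nat.find hex with hj
    have hj1 : (r':ℝ) ≤ 2^j * r := Nat.find_spec hex
    have hjle : j ≤ X := by
      refine (Nat.find_min' hex (m := r') ?_).trans hr'X.le
      have : (r':ℝ) ≤ 2^r' := by exact_mod_cast (Nat.lt_two_pow_self).le
      nlinarith
    have hterm : (r':ℝ)⁻¹ * Real.exp (-|Real.log r' - Real.log r|) ≤ 4 * (1/4:ℝ)^j / r := by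
      rcases Nat.eq_zero_or_pos j with h0 | h0
      · have : (r':ℝ)⁻¹ * Real.exp (-|Real.log r' - Real.log r|) ≤ (r:ℝ)⁻¹ := by
          have : Real.exp (-|Real.log r' - Real.log r|) ≤ r' / r := by
            rw [← Real.exp_log (by positivity : (0:ℝ) < r'/r), Real.log_div (by positivity) (by positivity)]
            apply Real.exp_le_exp.2
            have := neg_abs_le (Real.log r' - Real.log r); linarith
          calc _ ≤ (r':ℝ)⁻¹ * (r'/r) := by gcongr
            _ = (r:ℝ)⁻¹ := by field_simp
        rw [h0, pow_zero, mul_one]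
        refine this.trans ?_
        rw [inv_eq_one_div]; gcongr; norm_num
      · have hlow := Nat.find_min hex (m := j-1) (by omega)
        push Not at hlow
        have e : (2:ℝ)^j = 2 * 2^(j-1) := by rw [← pow_succ']; congr 1; omega
        have hexp : Real.exp (-|Real.log r' - Real.log r|) ≤ r / r' := by
            rw [← Real.exp_log (by positivity : (0:ℝ) < r/r'), Real.log_div (by positivity) (by positivity)]
            apply Real.exp_le_exp.2
            have := neg_le_abs (Real.log r' - Real.log r)
            have := le_abs_self (Real.log r' - Real.log r); linarith
        have h2 : 2^j * (r:ℝ) ≤ 2 * r' := by rw [e]; nlinarith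
        have h4 : (1/4:ℝ)^j = 1 / ((2:ℝ)^j)^2 := by
          rw [one_div_pow, ← pow_mul, mul_comm, pow_mul]; norm_num
        calc _ ≤ (r':ℝ)⁻¹ * (r/r') := by gcongr
          _ = r / r'^2 := by field_simp
          _ ≤ r / ((2^j * r)/2)^2 := by gcongr; linarith
          _ = 4 * (1/4:ℝ)^j / r := by rw [h4]; field_simp; norm_num
    refine hterm.trans ?_
    have := Finset.single_le_sum (f := fun j : ℕ => if (r':ℝ) ≤ 2^j * r then 4 * (1/4:ℝ)^j / r else 0)
      (s := range (X+1)) (fun i _ => by split_ifs <;> positivity) (Finset.mem_range.2 (by omega : j < X+1))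
    simp only [if_pos hj1] at this
    exact this
  refine (Finset.sum_le_sum pt).trans ?_
  rw [Finset.sum_comm]
  have hβ : 0 ≤ β / q := by
    have := (Nat.cast_nonneg _).trans (hN 1 le_rfl)
    rwa [mul_one] at this
  have inner : ∀ j ∈ range (X+1), ∑ r' ∈ R.filter (fun r' : ℕ => (r' : ZMod q) = b), (if (r':ℝ) ≤ 2^j * r then 4 * (1/4:ℝ)^j / r else 0)
      ≤ 4 * (β / q) * (1/2)^j := by
    intro j _
    rw [← Finset.sum_filter, Finset.filter_filter, Finset.sum_const, nsmul_eq_mul]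
    have h2j : (1:ℝ) ≤ 2^j := one_le_pow₀ (by norm_num)
    have := hN (2^j * r) (by nlinarith)
    calc _ ≤ β * (2^j * r) / q * (4 * (1/4:ℝ)^j / r) := by gcongr
      _ = 4 * (β / q) * (2^j * (1/4:ℝ)^j) := by field_simp
      _ = 4 * (β / q) * (1/2)^j := by rw [← mul_pow]; norm_num
  refine (Finset.sum_le_sum inner).trans ?_
  rw [← Finset.mul_sum]
  have : ∑ j ∈ range (X+1), (1/2:ℝ)^j ≤ 2 := sum_geometric_two_le _
  calc _ ≤ 4 * (β/q) * 2 := by gcongr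
    _ = 8 * β / q := by ring

/-- Dirichlet polynomial -/
def DPoly {q : ℕ} (R : Finset ℕ) (a : ℕ → ℝ) (χ : DirichletCharacter ℂ q) (s : ℂ) : ℂ :=
  ∑ r ∈ R, (a r : ℂ) * (χ r * (r:ℂ)^(-s))

lemma npow_exp {r : ℕ} (hr : 1 ≤ r) (s : ℂ) : (r:ℂ)^(-s) = Complex.exp (-(s * Real.log r)) := by
  rw [Complex.cpow_def_of_ne_zero (by exact_mod_cast (by omega : r ≠ 0)), ← Complex.natCast_log]
  congr 1; ring

lemma meansq_gauss {q : ℕ} (hq : 1 ≤ q) (R : Finset ℕ) (hR : ∀ r ∈ R, 1 ≤ r) (a : ℕ → ℝ) (ha : ∀ r ∈ R, |a r| ≤ 1)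
    {c : ℝ} (hc : 1 ≤ c) (k : ℝ) {β : ℝ}
    (hN : ∀ b : ZMod q, ∀ t : ℝ, 1 ≤ t → ((R.filter (fun r : ℕ => (r : ZMod q) = b ∧ (r:ℝ) ≤ t)).card : ℝ) ≤ β * t / q) :
    Integrable (fun t : ℝ => Real.exp (-(t-k)^2) * ∑ χ : DirichletCharacter ℂ q, ‖DPoly R a χ ((c:ℂ) + t * Complex.I)‖^2) ∧
    ∫ t : ℝ, Real.exp (-(t-k)^2) * ∑ χ : DirichletCharacter ℂ q, ‖DPoly R a χ ((c:ℂ) + t * Complex.I)‖^2 ≤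
      q.totient * (Real.sqrt Real.pi * Real.exp 1 * (8 * β / q)) * ∑ r ∈ R, (r:ℝ)^(-c) := by
  have : NeZero q := ⟨by omega⟩
  set w : ℕ → ℝ := fun r => a r * (r:ℝ)^(-c) with hw
  set S : ℕ → ℕ → ℂ := fun r r' => ∑ χ : DirichletCharacter ℂ q, χ r * star (χ r') with hS
  set g : ℝ → ℝ → ℂ := fun y t => Complex.exp (-((t:ℂ)-k)^2) * Complex.exp (Complex.I * t * y) with hg
  have expand : ∀ t : ℝ, ((Real.exp (-(t-k)^2) * ∑ χ : DirichletCharacter ℂ q, ‖DPoly R a χ ((c:ℂ) + t * Complex.I)‖^2 : ℝ) : ℂ)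
      = ∑ r ∈ R, ∑ r' ∈ R, ((w r * w r' : ℝ):ℂ) * S r r' * g (Real.log r' - Real.log r) t := by
    intro t
    have hD : ∀ χ : DirichletCharacter ℂ q, DPoly R a χ ((c:ℂ) + t * Complex.I) = ∑ r ∈ R, (w r : ℂ) * χ r * Complex.exp (-(Complex.I * t * Real.log r)) := by
      intro χ
      apply Finset.sum_congr rfl
      intro r hr
      have hr1 : (0:ℝ) < r := by exact_mod_cast hR r hr
      rw [npow_exp (hR r hr), hw]
      have : ((r:ℝ)^(-c) : ℝ) = Real.exp (-(c * Real.log r)) := by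
        rw [Real.rpow_def_of_pos hr1]; congr 1; ring
      simp only [this]
      push_cast
      rw [show -(((c:ℂ) + t * Complex.I) * Complex.log r) = -(c * Complex.log r) + -(Complex.I * t * Complex.log r) by ring, Complex.exp_add]
      ring
    have hsq : ∀ χ : DirichletCharacter ℂ q, ((‖DPoly R a χ ((c:ℂ) + t * Complex.I)‖^2 : ℝ):ℂ) =
        ∑ r ∈ R, ∑ r' ∈ R, ((w r * w r' : ℝ):ℂ) * (χ r * star (χ r')) * Complex.exp (Complex.I * t * ((Real.log r' - Real.log r : ℝ):ℂ)) := by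
      intro χ
      push_cast
      rw [← Complex.mul_conj', hD χ, map_sum, Finset.sum_mul_sum]
      refine Finset.sum_congr rfl fun r _ => Finset.sum_congr rfl fun r' _ => ?_
      simp only [map_mul, Complex.conj_ofReal, ← Complex.exp_conj, map_neg, Complex.conj_I, ← Complex.natCast_log, Complex.star_def]
      have : Complex.exp (Complex.I * t * ((Real.log r':ℂ) - (Real.log r:ℂ))) = Complex.exp (-(Complex.I * t * Real.log r)) * Complex.exp (-(-Complex.I * t * Real.log r')) := by
        rw [← Complex.exp_add]; congr 1; ring
      rw [this]; ring
    push_cast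
    have hsq' := hsq
    push_cast at hsq'
    simp_rw [hsq']
    rw [Finset.sum_comm, Finset.mul_sum]
    refine Finset.sum_congr rfl fun r _ => ?_
    rw [Finset.sum_comm, Finset.mul_sum]
    refine Finset.sum_congr rfl fun r' _ => ?_
    simp only [hS, hg]
    rw [Finset.mul_sum, Finset.mul_sum, Finset.sum_mul]
    refine Finset.sum_congr rfl fun χ _ => ?_
    push_cast
    ring
  have hIntg : ∀ r r' : ℕ, Integrable (fun t => ((w r * w r' : ℝ):ℂ) * S r r' * g (Real.log r' - Real.log r) t) := by
    intro r r'
    exact (gauss_int k _).const_mul _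
  have hIntg2 : Integrable (fun t : ℝ => ∑ r ∈ R, ∑ r' ∈ R, ((w r * w r' : ℝ):ℂ) * S r r' * g (Real.log r' - Real.log r) t) :=
    integrable_finsetSum _ fun r _ => integrable_finsetSum _ fun r' _ => hIntg r r'
  have hre : Integrable (fun t : ℝ => Real.exp (-(t-k)^2) * ∑ χ : DirichletCharacter ℂ q, ‖DPoly R a χ ((c:ℂ) + t * Complex.I)‖^2) := by
    have := hIntg2.re
    refine this.congr (Eventually.of_forall fun t => ?_)
    simp only [← expand t]
    exact Complex.ofReal_re _
  refine ⟨hre, ?_⟩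
  have hval : ((∫ t : ℝ, Real.exp (-(t-k)^2) * ∑ χ : DirichletCharacter ℂ q, ‖DPoly R a χ ((c:ℂ) + t * Complex.I)‖^2 : ℝ):ℂ) =
     ∑ r ∈ R, ∑ r' ∈ R, ((w r * w r' : ℝ):ℂ) * S r r' * ∫ t, g (Real.log r' - Real.log r) t := by
    rw [← integral_complex_ofReal]
    simp_rw [expand]
    rw [integral_finsetSum _ fun r _ => integrable_finsetSum _ fun r' _ => hIntg r r']
    refine Finset.sum_congr rfl fun r _ => ?_
    rw [integral_finsetSum _ fun r' _ => hIntg r r']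
    refine Finset.sum_congr rfl fun r' _ => ?_
    rw [integral_const_mul]
  have hle : ∫ t : ℝ, Real.exp (-(t-k)^2) * ∑ χ : DirichletCharacter ℂ q, ‖DPoly R a χ ((c:ℂ) + t * Complex.I)‖^2 ≤
     ∑ r ∈ R, ∑ r' ∈ R, ‖((w r * w r' : ℝ):ℂ) * S r r' * ∫ t, g (Real.log r' - Real.log r) t‖ := by
    refine (le_abs_self _).trans ?_
    rw [← Real.norm_eq_abs, ← Complex.norm_real, hval]
    exact (norm_sum_le _ _).trans (Finset.sum_le_sum fun r _ => norm_sum_le _ _)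
  refine hle.trans ?_
  rw [Finset.mul_sum]
  apply Finset.sum_le_sum
  intro r hr
  have hr1 : (1:ℝ) ≤ r := by exact_mod_cast hR r hr
  have hwb : ∀ r ∈ R, |w r| ≤ (r:ℝ)^(-c) := by
    intro r hr
    rw [hw]; simp only
    rw [abs_mul, abs_of_nonneg (by positivity : (0:ℝ) ≤ (r:ℝ)^(-c))]
    exact mul_le_of_le_one_left (by positivity) (ha r hr)
  have term : ∀ r' ∈ R, ‖((w r * w r' : ℝ):ℂ) * S r r' * ∫ t, g (Real.log r' - Real.log r) t‖ ≤
      if (r' : ZMod q) = r then (r:ℝ)^(-c) * q.totient * (Real.sqrt Real.pi * Real.exp 1) * ((r':ℝ)⁻¹ * Real.exp (-|Real.log r' - Real.log r|)) else 0 := by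
    intro r' hr'
    have hr'1 : (1:ℝ) ≤ r' := by exact_mod_cast hR r' hr'
    have hSb := char_orth hq (r : ZMod q) (r' : ZMod q)
    rw [norm_mul, norm_mul]
    by_cases hrr : (r' : ZMod q) = r
    · rw [if_pos hrr]
      rw [if_pos hrr.symm] at hSb
      have hgb : ‖∫ t, g (Real.log r' - Real.log r) t‖ ≤ Real.sqrt Real.pi * Real.exp 1 * Real.exp (-|Real.log r' - Real.log r|) := by
        simp only [hg]
        rw [gauss_ft, mul_assoc, ← Real.exp_add]
        gcongr
        rw [← sq_abs]
        nlinarith [sq_nonneg (|Real.log r' - Real.log r| - 2)]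
      have hww : ‖((w r * w r' : ℝ):ℂ)‖ ≤ (r:ℝ)^(-c) * (r':ℝ)⁻¹ := by
        rw [Complex.norm_real, Real.norm_eq_abs, abs_mul]
        have h1 := hwb r hr
        have h2 := hwb r' hr'
        have h3 : (r':ℝ)^(-c) ≤ (r':ℝ)⁻¹ := by
          rw [← Real.rpow_neg_one]
          exact Real.rpow_le_rpow_of_exponent_le hr'1 (by linarith)
        gcongr; exact h2.trans h3
      calc _ ≤ (r:ℝ)^(-c) * (r':ℝ)⁻¹ * q.totient * (Real.sqrt Real.pi * Real.exp 1 * Real.exp (-|Real.log r' - Real.log r|)) := by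
            gcongr
        _ = _ := by ring
    · rw [if_neg hrr]
      rw [if_neg (Ne.symm hrr)] at hSb
      have : ‖S r r'‖ = 0 := le_antisymm hSb (norm_nonneg _)
      rw [this]; simp
  refine (Finset.sum_le_sum term).trans ?_
  rw [← Finset.sum_filter, ← Finset.mul_sum]
  have := kernel_sum R hR (r : ZMod q) (hN r) r (hR r hr)
  calc _ ≤ (r:ℝ)^(-c) * q.totient * (Real.sqrt Real.pi * Real.exp 1) * (8 * β / q) := by gcongr
    _ = _ := by ring

def uk (κ : ℝ) (k : ℤ) : ℝ := ((1 + |(k:ℝ)|)/3)^(-(1+κ))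
def cK (κ : ℝ) : ℝ := ∑' k : ℤ, uk κ k

lemma uk_nonneg (κ : ℝ) (k : ℤ) : 0 ≤ uk κ k := by unfold uk; positivity

lemma uk_summable {κ : ℝ} (hκ : 0 < κ) : Summable (uk κ) := by
  have h : Summable (fun n : ℕ => ((1 + (n:ℝ))/3)^(-(1+κ))) := by
    have h1 : Summable (fun n : ℕ => ((n:ℝ))^(-(1+κ))) := Real.summable_nat_rpow.2 (by linarith)
    have h2 := (summable_nat_add_iff 1).2 h1
    have h3 := h2.mul_right ((3:ℝ)^(-(1+κ)))⁻¹
    refine h3.congr fun n => ?_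
    rw [Real.div_rpow (by positivity) (by norm_num), div_eq_mul_inv]
    push_cast; rw [add_comm]
  refine Summable.of_nat_of_neg ?_ ?_
  · refine h.congr fun n => ?_
    unfold uk; simp
  · refine h.congr fun n => ?_
    unfold uk; simp

lemma cK_nonneg (κ : ℝ) : 0 ≤ cK κ := tsum_nonneg (uk_nonneg κ)

lemma norm_s_ge {c : ℝ} (hc : 1 ≤ c) (t : ℝ) : 1 ≤ ‖(c:ℂ) + t * Complex.I‖ ∧ |t| ≤ ‖(c:ℂ) + t * Complex.I‖ := by
  constructor
  · have := Complex.abs_re_le_norm ((c:ℂ) + t * Complex.I)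
    simp at this
    exact hc.trans ((le_abs_self c).trans this)
  · have := Complex.abs_im_le_norm ((c:ℂ) + t * Complex.I)
    simpa using this

lemma DPoly_cont {q : ℕ} (R : Finset ℕ) (hR : ∀ r ∈ R, 1 ≤ r) (a : ℕ → ℝ) (χ : DirichletCharacter ℂ q) (c : ℝ) :
    Continuous (fun t : ℝ => DPoly R a χ ((c:ℂ) + t * Complex.I)) := by
  unfold DPoly
  refine continuous_finset_sum _ fun r hr => ?_
  refine continuous_const.mul (continuous_const.mul ?_)
  refine Continuous.const_cpow (by fun_prop) (Or.inl ?_)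
  have := hR r hr
  exact_mod_cast (by omega : r ≠ 0)

lemma DPoly_bdd {q : ℕ} (R : Finset ℕ) (hR : ∀ r ∈ R, 1 ≤ r) (a : ℕ → ℝ) (ha : ∀ r ∈ R, |a r| ≤ 1) (χ : DirichletCharacter ℂ q)
    {s : ℂ} (hs : 0 ≤ s.re) : ‖DPoly R a χ s‖ ≤ R.card := by
  unfold DPoly
  refine (norm_sum_le_of_le _ (n := fun _ => (1:ℝ)) fun r hr => ?_).trans (by simp)
  rw [norm_mul, norm_mul, Complex.norm_real, Real.norm_eq_abs]
  have h1 := ha r hr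
  have h2 := χ.norm_le_one r
  have h3 : ‖(r:ℂ)^(-s)‖ ≤ 1 := by
    have hr1 := hR r hr
    have := Complex.norm_natCast_cpow_of_pos (by omega : 0 < r) (-s)
    rw [this]
    exact Real.rpow_le_one_of_one_le_of_nonpos (by exact_mod_cast hr1) (by simpa using hs)
  have h4 : ‖χ r‖ * ‖(r:ℂ)^(-s)‖ ≤ 1 := mul_le_one₀ h2 (norm_nonneg _) h3
  exact mul_le_one₀ h1 (by positivity) h4

lemma wt_integrable {c : ℝ} (hc : 1 ≤ c) {κ : ℝ} (hκ : 0 < κ) :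
    Integrable (fun t : ℝ => ‖(c:ℂ) + t * Complex.I‖^(-(1+κ))) := by
  have h1 : Integrable (fun t : ℝ => (1 + ‖t‖)^(-(1+κ))) := integrable_one_add_norm (by simp; linarith)
  have h2 := h1.const_mul ((1/2:ℝ)^(-(1+κ)))
  refine h2.mono' ?_ (Eventually.of_forall fun t => ?_)
  · apply Continuous.aestronglyMeasurable
    apply Continuous.rpow_const (by fun_prop)
    intro t; left; have := (norm_s_ge hc t).1; linarith
  · obtain ⟨ha, hb⟩ := norm_s_ge hc t
    rw [Real.norm_of_nonneg (by positivity), ← Real.mul_rpow (by positivity) (by positivity)]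
    apply Real.rpow_le_rpow_of_nonpos (by positivity) _ (by linarith)
    rw [Real.norm_eq_abs]; linarith

lemma meansq {q : ℕ} (hq : 1 ≤ q) (R : Finset ℕ) (hR : ∀ r ∈ R, 1 ≤ r) (a : ℕ → ℝ) (ha : ∀ r ∈ R, |a r| ≤ 1)
    {c : ℝ} (hc : 1 ≤ c) {β : ℝ}
    (hN : ∀ b : ZMod q, ∀ t : ℝ, 1 ≤ t → ((R.filter (fun r : ℕ => (r : ZMod q) = b ∧ (r:ℝ) ≤ t)).card : ℝ) ≤ β * t / q)
    {κ : ℝ} (hκ : 0 < κ) :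
    Integrable (fun t : ℝ => ‖(c:ℂ) + t * Complex.I‖^(-(1+κ)) * ∑ χ : DirichletCharacter ℂ q, ‖DPoly R a χ ((c:ℂ) + t * Complex.I)‖^2) ∧
    ∫ t : ℝ, ‖(c:ℂ) + t * Complex.I‖^(-(1+κ)) * ∑ χ : DirichletCharacter ℂ q, ‖DPoly R a χ ((c:ℂ) + t * Complex.I)‖^2 ≤
      cK κ * (Real.exp 1 * (q.totient * (Real.sqrt Real.pi * Real.exp 1 * (8 * β / q)) * ∑ r ∈ R, (r:ℝ)^(-c))) := by
  set Q : ℝ → ℝ := fun t => ∑ χ : DirichletCharacter ℂ q, ‖DPoly R a χ ((c:ℂ) + t * Complex.I)‖^2 with hQ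
  have hQ0 : ∀ t, 0 ≤ Q t := fun t => Finset.sum_nonneg fun _ _ => by positivity
  have hQc : Continuous Q := by
    refine continuous_finset_sum _ fun χ _ => ?_
    exact ((DPoly_cont R hR a χ c).norm).pow 2
  have hIntg : Integrable (fun t : ℝ => ‖(c:ℂ) + t * Complex.I‖^(-(1+κ)) * Q t) := by
    refine Integrable.mul_bdd (c := ∑ χ : DirichletCharacter ℂ q, (R.card:ℝ)^2) (wt_integrable hc hκ) hQc.aestronglyMeasurable (Eventually.of_forall fun t => ?_)
    rw [Real.norm_of_nonneg (hQ0 t)]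
    refine Finset.sum_le_sum fun χ _ => ?_
    gcongr
    exact DPoly_bdd R hR a ha χ (by simp; linarith)
  refine ⟨hIntg, ?_⟩
  set V := q.totient * (Real.sqrt Real.pi * Real.exp 1 * (8 * β / q)) * ∑ r ∈ R, (r:ℝ)^(-c) with hV
  have hsum := hasSum_integral_iUnion (μ := volume) (s := fun k : ℤ => Set.Ico (k:ℝ) (k+1)) (fun _ => measurableSet_Ico)
    (Set.pairwise_disjoint_Ico_intCast ℝ) (f := fun t : ℝ => ‖(c:ℂ) + t * Complex.I‖^(-(1+κ)) * Q t) hIntg.integrableOn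
  rw [iUnion_Ico_intCast, setIntegral_univ] at hsum
  have hu := (uk_summable hκ).hasSum.mul_right (Real.exp 1 * V)
  refine hasSum_le (fun k => ?_) hsum hu
  obtain ⟨gi, gb⟩ := meansq_gauss hq R hR a ha hc k hN
  rw [← hV] at gb
  have hpt : ∀ t ∈ Set.Ico (k:ℝ) (k+1), ‖(c:ℂ) + t * Complex.I‖^(-(1+κ)) * Q t ≤ uk κ k * (Real.exp 1 * (Real.exp (-(t-k)^2) * Q t)) := by
    intro t ht
    obtain ⟨h1, h2⟩ := norm_s_ge hc t
    have h3 : |(k:ℝ)| ≤ |t| + 1 := by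
      have : |(k:ℝ) - t| ≤ 1 := abs_le.2 ⟨by linarith [ht.2], by linarith [ht.1]⟩
      have := abs_sub_abs_le_abs_sub (k:ℝ) t
      linarith
    have h4 : ‖(c:ℂ) + t * Complex.I‖^(-(1+κ)) ≤ uk κ k := by
      unfold uk
      exact Real.rpow_le_rpow_of_nonpos (by positivity) (by linarith) (by linarith)
    have h5 : 1 ≤ Real.exp 1 * Real.exp (-(t-k)^2) := by
      rw [← Real.exp_add]
      apply Real.one_le_exp
      nlinarith [ht.1, ht.2]
    have := hQ0 t
    calc _ ≤ uk κ k * (1 * Q t) := by rw [one_mul]; gcongr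
      _ ≤ uk κ k * ((Real.exp 1 * Real.exp (-(t-k)^2)) * Q t) := by
        have := uk_nonneg κ k
        gcongr
      _ = _ := by ring
  calc ∫ t in Set.Ico (k:ℝ) (k+1), ‖(c:ℂ) + t * Complex.I‖^(-(1+κ)) * Q t
      ≤ ∫ t in Set.Ico (k:ℝ) (k+1), uk κ k * (Real.exp 1 * (Real.exp (-(t-k)^2) * Q t)) :=
        setIntegral_mono_on hIntg.integrableOn ((gi.const_mul _).const_mul _).integrableOn measurableSet_Ico hpt
    _ ≤ ∫ t, uk κ k * (Real.exp 1 * (Real.exp (-(t-k)^2) * Q t)) := by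
        refine setIntegral_le_integral ((gi.const_mul _).const_mul _) (Eventually.of_forall fun t => ?_)
        have := uk_nonneg κ k
        have := hQ0 t
        simp only [Pi.zero_apply]
        positivity
    _ = uk κ k * (Real.exp 1 * ∫ t, (Real.exp (-(t-k)^2) * Q t)) := by rw [integral_const_mul, integral_const_mul]
    _ ≤ uk κ k * (Real.exp 1 * V) := by
        have := uk_nonneg κ k
        gcongr

/-- rough numbers in `(1,X]` -/
def Rset (Y X : ℕ) : Finset ℕ := (Icc 2 X).filter (fun r => ∀ p : ℕ, p.Prime → p ∣ r → Y ≤ p)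

def Hf (δ : ℝ) (Y X : ℕ) : ArithmeticFunction ℝ :=
  MF (Flo Y δ) * trunc (MF (Fhi Y (δ/2))) X * trunc (MF (Gfun Y (δ/2))) X

lemma lseries_fin (Y X : ℕ) (F : ℕ → ℕ → ℝ) (hF : ∀ p < Y, ∀ k, F p k = 0) {q : ℕ} (χ : DirichletCharacter ℂ q)
    (s : ℂ) : LSeriesHasSum (((χ ·) : ℕ → ℂ) * fun n => ((trunc (MF F) X n : ℝ) : ℂ)) s
      (DPoly (Rset Y X) (MF F) χ s) := by
  unfold LSeriesHasSum DPoly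
  have h := hasSum_sum_of_ne_finset_zero (L := SummationFilter.unconditional ℕ) (s := Rset Y X) (f := LSeries.term (((χ ·) : ℕ → ℂ) * fun n => ((trunc (MF F) X n : ℝ) : ℂ)) s) ?_
  · convert h using 1
    apply Finset.sum_congr rfl
    intro r hr
    simp only [Rset, mem_filter, mem_Icc] at hr
    rw [LSeries.term_of_ne_zero (by omega)]
    simp only [Pi.mul_apply, trunc_apply]
    rw [if_pos (by omega), Complex.cpow_neg]
    ring
  · intro r hr
    by_cases h0 : r = 0
    · simp [h0]
    rw [LSeries.term_of_ne_zero h0]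
    have : trunc (MF F) X r = 0 := by
      rw [trunc_apply]
      split_ifs with h1
      · simp only [Rset, mem_filter, mem_Icc, not_and, not_forall] at hr
        obtain ⟨p, hp, hpr, hY⟩ := hr (by omega)
        exact MF_eq_zero hp hpr (hF p (by omega))
      · rfl
    simp [this]

def Dχ (δ : ℝ) (Y : ℕ) {q : ℕ} (χ : DirichletCharacter ℂ q) (s : ℂ) : ℂ :=
  ∏ p ∈ Y.primesBelow, (1+(δ:ℂ)*((χ p*(p:ℂ)^(-s))/(1-χ p*(p:ℂ)^(-s))))

lemma lseries_D (δ : ℝ) (Y : ℕ) {q : ℕ} (χ : DirichletCharacter ℂ q)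
    (s : ℂ) (hs : 1 < s.re) : LSeriesHasSum (((χ ·) : ℕ → ℂ) * fun n => ((MF (Flo Y δ) n : ℝ) : ℂ)) s
      (Dχ δ Y χ s) := by
  have h := (euler_smooth (fun p => if p < Y then δ else 0) (fun n => χ n * (n:ℂ)^(-s)) (by simp)
    (by intro m n
        simp only [Nat.cast_mul, map_mul]
        rw [Complex.natCast_mul_natCast_cpow]; ring)
    (by intro p hp
        refine (z_norm χ hp).trans_lt ?_
        exact Real.rpow_lt_one_of_one_lt_of_neg (by exact_mod_cast hp.one_lt) (by linarith)) Y).2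
  unfold LSeriesHasSum
  have e : Dχ δ Y χ s = ∏ p ∈ Y.primesBelow, (1 + ((if p < Y then δ else 0 : ℝ):ℂ) * (χ p * (p:ℂ)^(-s) / (1 - χ p * (p:ℂ)^(-s)))) := by
    unfold Dχ
    apply Finset.prod_congr rfl
    intro p hp
    rw [if_pos (Nat.mem_primesBelow.1 hp).1]
  rw [e, ← hasSum_subtype_iff_of_support_subset (s := (Y.smoothNumbers : Set ℕ))]
  · convert h using 1
    ext ⟨m, hm⟩
    have h0 : m ≠ 0 := Nat.ne_zero_of_mem_smoothNumbers hm
    simp only [Function.comp]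
    rw [LSeries.term_of_ne_zero h0, Complex.cpow_neg]
    simp only [Pi.mul_apply]
    unfold Flo
    ring
  · intro m hm
    rw [Function.mem_support] at hm
    by_contra hc
    apply hm
    by_cases h0 : m = 0
    · simp [h0]
    rw [LSeries.term_of_ne_zero h0]
    rw [Nat.mem_smoothNumbers'] at hc
    push Not at hc
    obtain ⟨p, hp, hpm, hY⟩ := hc
    have : MF (Flo Y δ) m = 0 := MF_eq_zero hp hpm (by intro k; simp [Flo]; intro h; omega)
    simp [this]

lemma conv_coe (f g : ArithmeticFunction ℝ) :
    LSeries.convolution (fun n => ((f n : ℝ):ℂ)) (fun n => ((g n:ℝ):ℂ)) = fun n => (((f * g) n : ℝ):ℂ) := by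
  rw [LSeries.convolution_def]
  ext n
  simp [ArithmeticFunction.mul_apply]

lemma lseries_H (δ : ℝ) (Y X : ℕ) {q : ℕ} (χ : DirichletCharacter ℂ q)
    (s : ℂ) (hs : 1 < s.re) : LSeriesHasSum (((χ ·) : ℕ → ℂ) * fun n => ((Hf δ Y X n : ℝ) : ℂ)) s
      (Dχ δ Y χ s * DPoly (Rset Y X) (MF (Fhi Y (δ/2))) χ s * DPoly (Rset Y X) (MF (Gfun Y (δ/2))) χ s) := by
  have h1 := lseries_D δ Y χ s hs
  have h2 := lseries_fin Y X (Fhi Y (δ/2)) (by intro p hp k; simp [Fhi, hp]) χ s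
  have h3 := lseries_fin Y X (Gfun Y (δ/2)) (by intro p hp k; simp [Gfun, hp]) χ s
  have h := (h1.convolution h2).convolution h3
  rw [DirichletCharacter.mul_convolution_distrib, conv_coe, DirichletCharacter.mul_convolution_distrib, conv_coe] at h
  exact h

lemma _root_.HasSum.congr_fun' {f g : ℕ → ℂ} {a : ℂ} (h : HasSum f a) (e : ∀ n, g n = f n) : HasSum g a := by
  have : g = f := funext e
  rw [this]; exact h

lemma lseries_class (δ : ℝ) (Y X : ℕ) {q : ℕ} (hq : 1 ≤ q) (b : ZMod q) (hb : IsUnit b)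
    (s : ℂ) (hs : 1 < s.re) :
    HasSum (fun n : ℕ => (if (n : ZMod q) = b then ((Hf δ Y X n : ℝ) : ℂ) else 0) * (n:ℂ)^(-s))
      ((1/(q.totient:ℂ)) * ∑ χ : DirichletCharacter ℂ q, χ b⁻¹ *
      (Dχ δ Y χ s * DPoly (Rset Y X) (MF (Fhi Y (δ/2))) χ s * DPoly (Rset Y X) (MF (Gfun Y (δ/2))) χ s)) := by
  have : NeZero q := ⟨by omega⟩
  have h := hasSum_sum (s := (Finset.univ : Finset (DirichletCharacter ℂ q)))
    (fun χ _ => ((lseries_H δ Y X χ s hs).mul_left (χ b⁻¹)))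
  have h2 := h.mul_left (1/(q.totient:ℂ))
  refine h2.congr_fun' ?_
  intro n
  by_cases h0 : n = 0
  · subst h0; simp
  simp only [LSeries.term_of_ne_zero h0, Pi.mul_apply]
  have o := DirichletCharacter.sum_char_inv_mul_char_eq ℂ hb (n : ZMod q)
  have : ∀ χ : DirichletCharacter ℂ q, χ b⁻¹ * (χ (n:ZMod q) * ((Hf δ Y X n:ℝ):ℂ) / (n:ℂ)^s) =
     (χ b⁻¹ * χ (n:ZMod q)) * (((Hf δ Y X n:ℝ):ℂ) / (n:ℂ)^s) := by intro χ; ring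
  simp_rw [this]
  rw [← Finset.sum_mul, o, Complex.cpow_neg]
  have hφ : (q.totient : ℂ) ≠ 0 := by
    have := Nat.totient_pos.2 (show 0 < q by omega)
    exact_mod_cast this.ne'
  by_cases hn : (n : ZMod q) = b
  · rw [if_pos hn, if_pos hn.symm]; field_simp
  · rw [if_neg hn, if_neg (fun h => hn h.symm)]; simp

def LLs (δ : ℝ) (Y X q : ℕ) (b : ZMod q) (s : ℂ) : ℂ := (1/(q.totient:ℂ)) * ∑ χ : DirichletCharacter ℂ q, χ b⁻¹ *
      (Dχ δ Y χ s * DPoly (Rset Y X) (MF (Fhi Y (δ/2))) χ s * DPoly (Rset Y X) (MF (Gfun Y (δ/2))) χ s)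

lemma swap (δ : ℝ) (Y X : ℕ) {q : ℕ} (hq : 1 ≤ q) (b : ZMod q) (hb : IsUnit b) {η c : ℝ} (hη : 0 < η) (hc : 1 < c)
    (l l' : ℝ) (N : ℕ) (hl : Real.exp (l + η) ≤ N) (hl' : Real.exp (l' + η) ≤ N) :
    ∫ t : ℝ, LLs δ Y X q b ((c:ℂ) + t * Complex.I) * (JJ η ((c:ℂ) + t * Complex.I) *
      (Complex.exp (((c:ℂ) + t * Complex.I - 1) * l) - Complex.exp (((c:ℂ) + t * Complex.I - 1) * l'))) =
    2 * (Real.pi:ℂ) * ((∑ n ∈ Icc 1 N, (if (n : ZMod q) = b then Hf δ Y X n else 0) *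
      (Real.exp (-l) * kk η (l - Real.log n) - Real.exp (-l') * kk η (l' - Real.log n)) : ℝ) : ℂ) := by
  set g : ℕ → ℂ := fun n => if (n : ZMod q) = b then ((Hf δ Y X n : ℝ) : ℂ) else 0 with hg
  have hg0 : g 0 = 0 := by simp [hg]
  set K : ℝ → ℂ := fun t => JJ η ((c:ℂ) + t * Complex.I) *
      (Complex.exp (((c:ℂ) + t * Complex.I - 1) * l) - Complex.exp (((c:ℂ) + t * Complex.I - 1) * l')) with hK
  set F : ℕ → ℝ → ℂ := fun n t => g n * (n:ℂ)^(-((c:ℂ) + t * Complex.I)) * K t with hF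
  have hc0 : 0 < c := by linarith
  have hFn : ∀ n, 1 ≤ n → ∀ t, F n t = g n * (JJ η ((c:ℂ) + t * Complex.I) * Complex.exp (((c:ℂ) + t * Complex.I) * ((l - Real.log n : ℝ):ℂ)) * Complex.exp (-(l:ℂ))
      - JJ η ((c:ℂ) + t * Complex.I) * Complex.exp (((c:ℂ) + t * Complex.I) * ((l' - Real.log n : ℝ):ℂ)) * Complex.exp (-(l':ℂ))) := by
    intro n hn t
    simp only [hF, hK]
    rw [npow_exp hn]
    set s := (c:ℂ) + t * Complex.I
    have e : ∀ y : ℝ, Complex.exp (s * ((y - Real.log n : ℝ):ℂ)) * Complex.exp (-(y:ℂ)) =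
       Complex.exp (-(s * (Real.log n))) * Complex.exp ((s - 1) * y) := by
      intro y
      rw [← Complex.exp_add, ← Complex.exp_add]; congr 1; push_cast; ring
    linear_combination (- g n * JJ η s) * e l + (g n * JJ η s) * e l'
  have hI : ∀ y : ℝ, ∀ n : ℕ, Integrable (fun t : ℝ => JJ η ((c:ℂ) + t * Complex.I) * Complex.exp (((c:ℂ) + t * Complex.I) * ((y - Real.log n : ℝ):ℂ)) * Complex.exp (-(y:ℂ))) :=
    fun y n => (JJ_integrable hη hc0 _).mul_const _
  have hKi : Integrable K := by
    have := (hI l 1).sub (hI l' 1)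
    refine this.congr (Filter.Eventually.of_forall fun t => ?_)
    have e : ∀ y : ℝ, Complex.exp (((c:ℂ) + t * Complex.I) * ((y - Real.log (1:ℕ) : ℝ):ℂ)) * Complex.exp (-(y:ℂ)) =
       Complex.exp (((c:ℂ) + t * Complex.I - 1) * y) := by
      intro y
      rw [← Complex.exp_add]; congr 1; push_cast; simp; ring
    simp only [hK, Pi.sub_apply]
    rw [mul_assoc, mul_assoc, e, e]; ring
  have hFi : ∀ n, Integrable (F n) := by
    intro n
    rcases Nat.eq_zero_or_pos n with rfl | hn
    · simp [hF, hg0]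
    · have : F n = _ := funext (hFn n hn)
      rw [this]
      exact ((hI l n).sub (hI l' n)).const_mul _
  have hFs : Summable fun n => ∫ t, ‖F n t‖ := by
    have h := (lseries_class δ Y X hq b hb (c:ℂ) (by simpa using hc)).summable.norm.mul_right (∫ t, ‖K t‖)
    refine h.congr ?_
    intro n
    rw [← integral_const_mul]
    congr 1; ext t
    simp only [hF]
    rcases Nat.eq_zero_or_pos n with rfl | hn
    · have : ‖g 0‖ = 0 := by simp [hg0]
      simp only [norm_mul, this, zero_mul]
      simp only [hg] at this
      rw [this]; simp
    have e1 : ‖(n:ℂ)^(-(c:ℂ))‖ = (n:ℝ)^(-c) := by rw [Complex.norm_natCast_cpow_of_pos hn]; simp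
    have e2 : ‖(n:ℂ)^(-((c:ℂ) + t * Complex.I))‖ = (n:ℝ)^(-c) := by rw [Complex.norm_natCast_cpow_of_pos hn]; simp
    rw [norm_mul, norm_mul _ (K t), norm_mul (g n) ((n:ℂ)^(-((c:ℂ) + t * Complex.I))), e2, e1]
  have hs := hasSum_integral_of_summable_integral_norm hFi hFs
  have hIntg : ∀ n, ∫ t, F n t = 2 * (Real.pi:ℂ) * (((if (n : ZMod q) = b then Hf δ Y X n else 0) *
      (Real.exp (-l) * kk η (l - Real.log n) - Real.exp (-l') * kk η (l' - Real.log n)) : ℝ):ℂ) := by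
    intro n
    rcases Nat.eq_zero_or_pos n with rfl | hn
    · simp [hF, hg0]
    · have : F n = _ := funext (hFn n hn)
      rw [this, integral_const_mul, integral_sub (hI l n) (hI l' n), integral_mul_const, integral_mul_const,
        JJ_integral hη hc0, JJ_integral hη hc0]
      simp only [hg]
      split_ifs
      · push_cast; ring
      · simp
  have hfin := hasSum_sum_of_ne_finset_zero (L := SummationFilter.unconditional ℕ) (s := Icc 1 N) (f := fun n => ∫ t, F n t) ?_
  · have := hs.unique hfin
    have e2 : ∀ t : ℝ, ∑' n, F n t = LLs δ Y X q b ((c:ℂ) + t * Complex.I) * K t := by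
      intro t
      have h := (lseries_class δ Y X hq b hb ((c:ℂ) + t * Complex.I) (by simpa using hc)).mul_right (K t)
      exact h.tsum_eq
    simp_rw [e2] at this
    rw [this, Complex.ofReal_sum, Finset.mul_sum]
    exact Finset.sum_congr rfl fun n _ => hIntg n
  · intro n hn
    rw [hIntg]
    simp only [mem_Icc, not_and, not_le] at hn
    rcases Nat.eq_zero_or_pos n with rfl | hn0
    · simp
    have hN : (N:ℝ) < n := by exact_mod_cast hn hn0
    have k : ∀ y : ℝ, Real.exp (y + η) ≤ N → kk η (y - Real.log n) = 0 := by
      intro y hy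
      apply kk_zero hη
      have : y + η ≤ Real.log n := by
        rw [Real.le_log_iff_exp_le (by exact_mod_cast hn0)]; linarith
      linarith
    rw [k l hl, k l' hl']; simp

/-- Bound on `D * Δ`. -/
lemma DΔ_bound {q : ℕ} (hq : 1 ≤ q) (χ : DirichletCharacter ℂ q) {σ : ℝ} (hσ : 0 < σ) (t : ℝ) (Y : ℕ) (δ : ℝ) (h0 : 0 < δ) (h1 : δ < 1)
    {κ : ℝ} (hκ : 0 < κ) (hκ1 : κ ≤ 1) {l l' : ℝ} (hll : l' ≤ l) (hσl : σ * l ≤ 1) :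
    ‖Dχ δ Y χ (((1+σ:ℝ):ℂ) + t * Complex.I)‖ * ‖Complex.exp ((((1+σ:ℝ):ℂ) + t * Complex.I - 1) * l) - Complex.exp ((((1+σ:ℝ):ℂ) + t * Complex.I - 1) * l')‖ ≤
     Real.exp 30 * (1 + (1+1/σ)/PP (-(1+σ)) Y * (1 + Real.log q + 2*(1+1/κ) + (l - l'))) * ‖((1+σ:ℝ):ℂ) + t * Complex.I‖^κ := by
  set s := ((1+σ:ℝ):ℂ) + t * Complex.I with hs
  have hsre : s.re = 1 + σ := by simp [hs]
  have hs1 : 1 ≤ ‖s‖ := (norm_s_ge (c := 1+σ) (by linarith) t).1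
  have hsκ : 1 ≤ ‖s‖^κ := Real.one_le_rpow hs1 hκ.le
  set w := s - 1 with hw
  have hwre : w.re = σ := by simp [hw, hsre]
  have hw0 : 0 < ‖w‖ := by
    rw [norm_pos_iff]; intro h; rw [h] at hwre; simp at hwre; linarith
  have hexp : ∀ y ≤ l, Real.exp (w.re * y) ≤ Real.exp 1 := by
    intro y hy; rw [hwre]; apply Real.exp_le_exp.2; nlinarith
  set Δ := Complex.exp (w * l) - Complex.exp (w * l') with hΔ
  have b1 : ‖Δ‖ ≤ 2 * Real.exp 1 := by
    refine (norm_sub_le _ _).trans ?_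
    rw [Complex.norm_exp, Complex.norm_exp]
    have h1 := hexp l le_rfl
    have h2 := hexp l' hll
    simp only [Complex.mul_re, Complex.ofReal_re, Complex.ofReal_im, mul_zero, sub_zero]
    linarith
  have b2 : ‖Δ‖ ≤ ‖w‖ * Real.exp 1 * (l - l') := norm_exp_sub_exp_le w hll (fun u hu => hexp u hu.2)
  have he : 2 * Real.exp 1 ≤ Real.exp 2 := by
    have : Real.exp 2 = Real.exp 1 * Real.exp 1 := by rw [← Real.exp_add]; norm_num
    rw [this]
    have := Real.add_one_le_exp (1:ℝ)
    nlinarith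
  set A0 := (1+1/σ)/PP (-(1+σ)) Y with hA0
  have hPP := PP_pos (a := -(1+σ)) (by linarith) Y
  have hA0n : 0 ≤ A0 := by positivity
  have hlq : 0 ≤ Real.log q := Real.log_nonneg (by exact_mod_cast hq)
  have hD := D_bound χ hσ hsre Y δ h0 h1
  have hLb := L_bound hq χ (s := s) (by linarith) hκ hκ1 (2/‖w‖) (by positivity) (fun _ => le_rfl)
  set Lc := ‖LSeries (fun n => χ (n : ZMod q)) s‖
  have e1 : Lc * (1+1/σ)/PP (-(1+σ)) Y = Lc * A0 := by rw [hA0]; ring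
  rw [e1] at hD
  have hLΔ : Lc * ‖Δ‖ ≤ Real.exp 2 * (1 + Real.log q + 2*(1+1/κ) + (l - l')) * ‖s‖^κ := by
    have h2 : 2/‖w‖ * ‖Δ‖ ≤ Real.exp 2 * (l - l') := by
      calc 2/‖w‖ * ‖Δ‖ ≤ 2/‖w‖ * (‖w‖ * Real.exp 1 * (l - l')) := by gcongr
        _ = 2 * Real.exp 1 * (l - l') := by field_simp
        _ ≤ _ := by gcongr
    have h3 : (1 + Real.log q + 2 * (1+1/κ) * ‖s‖^κ) * ‖Δ‖ ≤ (1 + Real.log q + 2 * (1+1/κ) * ‖s‖^κ) * Real.exp 2 := by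
      gcongr; linarith
    have h4 : (1 + Real.log q) ≤ (1 + Real.log q) * ‖s‖^κ := le_mul_of_one_le_right (by positivity) hsκ
    have h5 : (l - l') ≤ (l - l') * ‖s‖^κ := le_mul_of_one_le_right (by linarith) hsκ
    have e2 := Real.exp_pos 2
    calc Lc * ‖Δ‖ ≤ (1 + Real.log q + 2/‖w‖ + 2 * (1+1/κ) * ‖s‖^κ) * ‖Δ‖ := by gcongr
      _ = (1 + Real.log q + 2 * (1+1/κ) * ‖s‖^κ) * ‖Δ‖ + 2/‖w‖ * ‖Δ‖ := by ring
      _ ≤ (1 + Real.log q + 2 * (1+1/κ) * ‖s‖^κ) * Real.exp 2 + Real.exp 2 * (l - l') := add_le_add h3 h2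
      _ ≤ ((1 + Real.log q) * ‖s‖^κ + 2 * (1+1/κ) * ‖s‖^κ) * Real.exp 2 + Real.exp 2 * ((l - l') * ‖s‖^κ) := by gcongr
      _ = _ := by ring
  have e30 : Real.exp 30 = Real.exp 28 * Real.exp 2 := by rw [← Real.exp_add]; norm_num
  have hΔ' : ‖Δ‖ ≤ Real.exp 2 * ‖s‖^κ := by
    have := Real.exp_pos 2
    nlinarith
  calc ‖Dχ δ Y χ s‖ * ‖Δ‖ ≤ (Real.exp 28 * (1 + Lc * A0)) * ‖Δ‖ := by
        gcongr; exact hD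
    _ = Real.exp 28 * (‖Δ‖ + A0 * (Lc * ‖Δ‖)) := by ring
    _ ≤ Real.exp 28 * (Real.exp 2 * ‖s‖^κ + A0 * (Real.exp 2 * (1 + Real.log q + 2*(1+1/κ) + (l - l')) * ‖s‖^κ)) := by gcongr
    _ = _ := by rw [e30]; ring

lemma H_bound (δ : ℝ) (h0 : 0 < δ) (h1 : δ < 1) (Y X : ℕ) {q : ℕ} (hq : 1 ≤ q) (b : ZMod q) (hb : IsUnit b)
    {η σ : ℝ} (hη : 0 < η) (hη1 : η ≤ 1) (hσ : 0 < σ) (hσ1 : σ ≤ 1) {l l' : ℝ} (hll : l' ≤ l) (hσl : σ * l ≤ 1)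
    (N : ℕ) (hl : Real.exp (l + η) ≤ N) {κ : ℝ} (hκ : 0 < κ) (hκ1 : κ ≤ 1/2) {β : ℝ}
    (hN : ∀ b : ZMod q, ∀ t : ℝ, 1 ≤ t → (((Rset Y X).filter (fun r : ℕ => (r : ZMod q) = b ∧ (r:ℝ) ≤ t)).card : ℝ) ≤ β * t / q) :
    |∑ n ∈ Icc 1 N, (if (n : ZMod q) = b then Hf δ Y X n else 0) *
      (Real.exp (-l) * kk η (l - Real.log n) - Real.exp (-l') * kk η (l' - Real.log n))| ≤
    (9 * η^(-(2*κ))) * (Real.exp 30 * (1 + (1+1/σ)/PP (-(1+σ)) Y * (1 + Real.log q + 2*(1+1/κ) + (l - l')))) *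
      (cK κ * (Real.exp 1 * ((Real.sqrt Real.pi * Real.exp 1 * (8 * β / q)) * ∑ r ∈ Rset Y X, (r:ℝ)^(-(1+σ))))) := by
  have hR : ∀ r ∈ Rset Y X, 1 ≤ r := by
    intro r hr; simp only [Rset, mem_filter, mem_Icc] at hr; omega
  have aE : ∀ r ∈ Rset Y X, |MF (Fhi Y (δ/2)) r| ≤ 1 := by
    intro r _
    have n1 : ∀ p k, 0 ≤ Fhi Y (δ/2) p k := by intro p k; unfold Fhi; split_ifs <;> linarith
    rw [abs_of_nonneg (MF_nonneg n1 r)]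
    exact MF_le_one n1 (by intro p k; unfold Fhi; split_ifs <;> linarith) r
  have aG : ∀ r ∈ Rset Y X, |MF (Gfun Y (δ/2)) r| ≤ 1 := by
    intro r _
    have hc : 0 ≤ 1 - δ/2 := by linarith
    have n1 : ∀ p k, 0 ≤ Gfun Y (δ/2) p k := by intro p k; unfold Gfun; split_ifs <;> positivity
    rw [abs_of_nonneg (MF_nonneg n1 r)]
    refine MF_le_one n1 ?_ r
    intro p k; unfold Gfun; split_ifs
    · linarith
    · have : (1 - δ/2)^(k-1) ≤ 1 := pow_le_one₀ hc (by linarith)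
      have : 0 ≤ (1 - δ/2)^(k-1) := by positivity
      nlinarith
  have hc1 : 1 ≤ 1 + σ := by linarith
  obtain ⟨iE, mE⟩ := meansq hq (Rset Y X) hR _ aE hc1 hN hκ
  obtain ⟨iG, mG⟩ := meansq hq (Rset Y X) hR _ aG hc1 hN hκ
  have hsw := swap δ Y X hq b hb hη (c := 1+σ) (by linarith) l l' N hl ((Real.exp_le_exp.2 (by linarith)).trans hl)
  set S := ∑ n ∈ Icc 1 N, (if (n : ZMod q) = b then Hf δ Y X n else 0) *
      (Real.exp (-l) * kk η (l - Real.log n) - Real.exp (-l') * kk η (l' - Real.log n)) with hS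
  set B := Real.exp 30 * (1 + (1+1/σ)/PP (-(1+σ)) Y * (1 + Real.log q + 2*(1+1/κ) + (l - l'))) with hB
  set M := cK κ * (Real.exp 1 * (q.totient * (Real.sqrt Real.pi * Real.exp 1 * (8 * β / q)) * ∑ r ∈ Rset Y X, (r:ℝ)^(-(1+σ)))) with hM
  set s : ℝ → ℂ := fun t => ((1+σ:ℝ):ℂ) + t * Complex.I with hs
  set E : DirichletCharacter ℂ q → ℝ → ℂ := fun χ t => DPoly (Rset Y X) (MF (Fhi Y (δ/2))) χ (s t) with hE
  set G : DirichletCharacter ℂ q → ℝ → ℂ := fun χ t => DPoly (Rset Y X) (MF (Gfun Y (δ/2))) χ (s t) with hG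
  have hφ : (0:ℝ) < q.totient := by exact_mod_cast Nat.totient_pos.2 (show 0 < q by omega)
  have hBn : 0 ≤ B := by
    have hPP := PP_pos (a := -(1+σ)) (by linarith) Y
    have hlq : 0 ≤ Real.log q := Real.log_nonneg (by exact_mod_cast hq)
    have : 0 ≤ l - l' := by linarith
    positivity
  set Bd : ℝ → ℝ := fun t => (1/(q.totient:ℝ)) * (9 * η^(-(2*κ))) * B * (1/2) * (‖s t‖^(-(1+κ)) * ∑ χ, ‖E χ t‖^2 + ‖s t‖^(-(1+κ)) * ∑ χ, ‖G χ t‖^2) with hBd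
  have hle : ‖∫ t : ℝ, LLs δ Y X q b (s t) * (JJ η (s t) *
      (Complex.exp ((s t - 1) * l) - Complex.exp ((s t - 1) * l')))‖ ≤ ∫ t, Bd t := by
    apply norm_integral_le_of_norm_le
    · exact (iE.add iG).const_mul _
    · refine Filter.Eventually.of_forall fun t => ?_
      set Δ := Complex.exp ((s t - 1) * l) - Complex.exp ((s t - 1) * l')
      have hst : 1 ≤ ‖s t‖ := (norm_s_ge hc1 t).1
      have hsre : (s t).re = 1 + σ := by simp [hs]
      have hJ := JJ_bound hη hη1 (s := s t) (by linarith) (by linarith) (κ := 2*κ) (by linarith) (by linarith)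
      have hL : ‖LLs δ Y X q b (s t)‖ ≤ (1/(q.totient:ℝ)) * ∑ χ : DirichletCharacter ℂ q, ‖Dχ δ Y χ (s t)‖ * (‖E χ t‖ * ‖G χ t‖) := by
        unfold LLs
        rw [norm_mul]
        have : ‖(1/(q.totient:ℂ))‖ = 1/(q.totient:ℝ) := by simp
        rw [this]
        gcongr
        refine (norm_sum_le _ _).trans (Finset.sum_le_sum fun χ _ => ?_)
        rw [norm_mul, norm_mul, norm_mul]
        have := DirichletCharacter.norm_le_one χ b⁻¹
        calc _ ≤ 1 * (‖Dχ δ Y χ (s t)‖ * ‖E χ t‖ * ‖G χ t‖) := by gcongr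
          _ = _ := by ring
      have hLD : ‖LLs δ Y X q b (s t)‖ * ‖Δ‖ ≤ (1/(q.totient:ℝ)) * ((B * ‖s t‖^κ) * ((1/2) * (∑ χ, ‖E χ t‖^2 + ∑ χ, ‖G χ t‖^2))) := by
        calc _ ≤ ((1/(q.totient:ℝ)) * ∑ χ : DirichletCharacter ℂ q, ‖Dχ δ Y χ (s t)‖ * (‖E χ t‖ * ‖G χ t‖)) * ‖Δ‖ := by gcongr
          _ = (1/(q.totient:ℝ)) * ∑ χ : DirichletCharacter ℂ q, (‖Dχ δ Y χ (s t)‖ * ‖Δ‖) * (‖E χ t‖ * ‖G χ t‖) := by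
            rw [mul_assoc, Finset.sum_mul]; congr 1; exact Finset.sum_congr rfl fun χ _ => by ring
          _ ≤ (1/(q.totient:ℝ)) * ∑ χ : DirichletCharacter ℂ q, (B * ‖s t‖^κ) * ((1/2) * (‖E χ t‖^2 + ‖G χ t‖^2)) := by
            refine mul_le_mul_of_nonneg_left (Finset.sum_le_sum fun χ _ => ?_) (by positivity)
            refine mul_le_mul ?_ ?_ (by positivity) (by positivity)
            · have := DΔ_bound hq χ hσ t Y δ h0 h1 hκ (by linarith) hll hσl
              exact this
            · nlinarith [sq_nonneg (‖E χ t‖ - ‖G χ t‖)]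
          _ = _ := by rw [← Finset.mul_sum, ← Finset.mul_sum, Finset.sum_add_distrib]
      have hpow : ‖s t‖^(-(1+2*κ)) * ‖s t‖^κ = ‖s t‖^(-(1+κ)) := by
        rw [← Real.rpow_add (by linarith)]; congr 1; ring
      rw [norm_mul, norm_mul]
      calc _ = ‖JJ η (s t)‖ * (‖LLs δ Y X q b (s t)‖ * ‖Δ‖) := by ring
        _ ≤ (9 * η^(-(2*κ)) * ‖s t‖^(-(1+2*κ))) * ((1/(q.totient:ℝ)) * ((B * ‖s t‖^κ) * ((1/2) * (∑ χ, ‖E χ t‖^2 + ∑ χ, ‖G χ t‖^2)))) := by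
          gcongr
        _ = (1/(q.totient:ℝ)) * (9 * η^(-(2*κ))) * B * (1/2) * ((‖s t‖^(-(1+2*κ)) * ‖s t‖^κ) * (∑ χ, ‖E χ t‖^2 + ∑ χ, ‖G χ t‖^2)) := by ring
        _ = Bd t := by rw [hpow, hBd]; ring
  have hBi : ∫ t, Bd t ≤ (1/(q.totient:ℝ)) * (9 * η^(-(2*κ))) * B * M := by
    rw [hBd, integral_const_mul]
    have : ∫ t, (‖s t‖^(-(1+κ)) * ∑ χ, ‖E χ t‖^2 + ‖s t‖^(-(1+κ)) * ∑ χ, ‖G χ t‖^2) ≤ M + M := by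
      rw [integral_add iE iG]
      exact add_le_add mE mG
    calc _ ≤ (1/(q.totient:ℝ)) * (9 * η^(-(2*κ))) * B * (1/2) * (M + M) := by gcongr
      _ = _ := by ring
  rw [hsw] at hle
  have hn : ‖2 * (Real.pi:ℂ) * ((S:ℝ):ℂ)‖ = 2 * Real.pi * |S| := by
    simp [abs_of_pos Real.pi_pos]
  rw [hn] at hle
  have hpi := Real.pi_gt_three
  have : |S| ≤ 2 * Real.pi * |S| := by nlinarith [abs_nonneg S]
  refine (this.trans (hle.trans hBi)).trans (le_of_eq ?_)
  rw [hM]; field_simp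

lemma Rsum_le {σ : ℝ} (hσ : 0 < σ) (Y X : ℕ) :
    ∑ r ∈ Rset Y X, (r:ℝ)^(-(1+σ)) ≤ (1+1/σ) / PP (-(1+σ)) Y := by
  have hP := PP_pos (a := -(1+σ)) (by linarith) Y
  rw [le_div_iff₀ hP]
  have h := (smooth_hasSum (a := -(1+σ)) (by linarith) Y).mul_left (∑ r ∈ Rset Y X, (r:ℝ)^(-(1+σ)))
  refine hasSum_le_of_sum_le h fun S => ?_
  set S' := S.map ⟨Subtype.val, Subtype.val_injective⟩ with hS'
  have e1 : ∑ m ∈ S, (∑ r ∈ Rset Y X, (r:ℝ)^(-(1+σ))) * ((m:ℕ):ℝ)^(-(1+σ)) =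
      ∑ z ∈ Rset Y X ×ˢ S', ((z.1 * z.2 : ℕ):ℝ)^(-(1+σ)) := by
    rw [← Finset.mul_sum, Finset.sum_product, Finset.sum_mul]
    refine Finset.sum_congr rfl fun r _ => ?_
    rw [hS', Finset.sum_map, Finset.mul_sum]
    refine Finset.sum_congr rfl fun m _ => ?_
    simp only [Function.Embedding.coeFn_mk]
    push_cast
    rw [Real.mul_rpow (by positivity) (by positivity)]
  rw [e1]
  have e2 := Finset.sum_image (s := Rset Y X ×ˢ S') (g := fun z : ℕ × ℕ => z.1 * z.2) (f := fun n : ℕ => (n:ℝ)^(-(1+σ))) ?_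
  · rw [← e2]; exact zeta_sum_le σ hσ _
  · have cop : ∀ r ∈ Rset Y X, ∀ m ∈ S', Nat.Coprime r m := by
      intro r hr m hm
      simp only [hS', Finset.mem_map, Function.Embedding.coeFn_mk, Subtype.exists, exists_and_right, exists_eq_right] at hm
      obtain ⟨hm, -⟩ := hm
      simp only [Rset, mem_filter] at hr
      apply Nat.Coprime.symm
      rw [Nat.coprime_iff_gcd_eq_one] 
      by_contra hne
      obtain ⟨p, hp, hpd⟩ := Nat.exists_prime_and_dvd hne
      have h1 := hr.2 p hp (hpd.trans (Nat.gcd_dvd_right _ _))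
      have h2 := Nat.mem_smoothNumbers'.1 hm p hp (hpd.trans (Nat.gcd_dvd_left _ _))
      omega
    intro z hz z' hz' he
    simp only [coe_product, Set.mem_prod, mem_coe] at hz hz'
    simp only at he
    have hd : z.1 = z'.1 := by
      apply Nat.dvd_antisymm
      · exact (cop _ hz.1 _ hz'.2).dvd_of_dvd_mul_right (he ▸ Dvd.intro _ rfl)
      · exact (cop _ hz'.1 _ hz.2).dvd_of_dvd_mul_right (he ▸ Dvd.intro _ rfl)
    have h0 : 0 < z.1 := by
      have := hz.1; simp only [Rset, mem_filter, mem_Icc] at this; omega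
    have : z.2 = z'.2 := by
      rw [← hd] at he
      exact Nat.eq_of_mul_eq_mul_left h0 he
    exact Prod.ext hd this

lemma exists_nat_exp (v : ℝ) (hv : 2 ≤ v) : ∃ N : ℕ, 3 ≤ N ∧ v ≤ Real.log N ∧ Real.log N ≤ 2 * v := by
  have h3 : (3:ℝ) ≤ Real.exp v := by have := Real.add_one_le_exp v; linarith
  have hN := Nat.le_ceil (Real.exp v)
  have hN2 := Nat.ceil_lt_add_one (Real.exp_pos v).le
  have hpos : (0:ℝ) < (⌈Real.exp v⌉₊ : ℝ) := by linarith
  refine ⟨⌈Real.exp v⌉₊, ?_, ?_, ?_⟩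
  · exact_mod_cast h3.trans hN
  · rw [Real.le_log_iff_exp_le hpos]; exact hN
  · rw [Real.log_le_iff_le_exp hpos]
    have : Real.exp (2*v) = Real.exp v * Real.exp v := by rw [← Real.exp_add]; ring_nf
    rw [this]; nlinarith

lemma rpow_le_e {N : ℕ} (hN : 3 ≤ N) {v : ℝ} (hv : 2 ≤ v) (h : Real.log N ≤ 2 * v) : (N:ℝ)^(1/(2*v)) ≤ Real.exp 1 := by
  rw [Real.rpow_def_of_pos (by positivity)]
  apply Real.exp_le_exp.2
  rw [mul_one_div, div_le_one (by positivity)]; exact h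

/-- rough numbers in progressions -/
lemma beta_bound {v1 : ℝ} (hv1 : 2 ≤ v1) {v : ℝ} (hv : 2 * v1 ≤ v) (Y X : ℕ) (hY3 : 3 ≤ Y) (hY : v ≤ Real.log Y) {q : ℕ} (hq : 1 ≤ q)
    (b : ZMod q) (t : ℝ) (ht : 1 ≤ t) :
    (((Rset Y X).filter (fun r : ℕ => (r : ZMod q) = b ∧ (r:ℝ) ≤ t)).card : ℝ) ≤
      ((1 + Real.log q)^2 / v1 + q * (Real.exp (-(v/(2*v1))) * (1+2*v1)^24)) * t / q := by
  have hq0 : (0:ℝ) < q := by exact_mod_cast hq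
  by_cases htY : t < Y
  · have : (Rset Y X).filter (fun r : ℕ => (r : ZMod q) = b ∧ (r:ℝ) ≤ t) = ∅ := by
      apply Finset.filter_eq_empty_iff.2
      rintro r hr ⟨-, hrt⟩
      simp only [Rset, mem_filter, mem_Icc] at hr
      obtain ⟨p, hp, hpr⟩ := Nat.exists_prime_and_dvd (show r ≠ 1 by omega)
      have h1 := hr.2 p hp hpr
      have h2 := Nat.le_of_dvd (by omega) hpr
      have : (Y:ℝ) ≤ r := by exact_mod_cast h1.trans h2
      linarith
    rw [this]; simp; positivity
  push Not at htY
  obtain ⟨Z, hZ3, hZ1, hZ2⟩ := exists_nat_exp v1 hv1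
  have hZY : Z ≤ Y := by
    have : Real.log Z ≤ Real.log Y := by linarith
    have := (Real.log_le_log_iff (by positivity) (by positivity)).1 this
    exact_mod_cast this
  have hsub : (((Rset Y X).filter (fun r : ℕ => (r : ZMod q) = b ∧ (r:ℝ) ≤ t)).card : ℝ) ≤ roughCount Z q b t := by
    unfold roughCount
    norm_cast
    apply Finset.card_le_card
    intro r hr
    simp only [Rset, mem_filter, mem_Icc] at hr ⊢
    refine ⟨⟨by omega, Nat.le_floor hr.2.2⟩, hr.2.1, fun p hp hpr => hZY.trans (hr.1.2 p hp hpr)⟩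
  refine hsub.trans ((sieve Z q (by omega) hq b t (by linarith) (1/(2*v1)) (by positivity) ?_ (rpow_le_e hZ3 hv1 hZ2)).trans ?_)
  · rw [div_le_div_iff₀ (by positivity) (by positivity)]; linarith
  · have e1 : (1 + 1/(1/(2*v1))) = 1 + 2*v1 := by rw [one_div_one_div]
    rw [e1]
    have e2 : t^(1 - 1/(2*v1)) ≤ t * Real.exp (-(v/(2*v1))) := by
      rw [sub_eq_add_neg, Real.rpow_add (by linarith), Real.rpow_one]
      gcongr
      rw [Real.rpow_def_of_pos (by linarith)]
      apply Real.exp_le_exp.2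
      have : v ≤ Real.log t := hY.trans (Real.log_le_log (by positivity) htY)
      rw [mul_neg, mul_one_div]
      apply neg_le_neg; gcongr
    have hl0 : 0 ≤ Real.log q := Real.log_nonneg (by exact_mod_cast hq)
    calc _ ≤ t / q * (1 + Real.log q)^2 / v1 + (t * Real.exp (-(v/(2*v1)))) * (1+2*v1)^24 := by gcongr
      _ = _ := by field_simp

lemma smooth_sharp (δ : ℝ) (h0 : 0 < δ) (h1 : δ < 1) (Y X : ℕ) {q : ℕ} (hq : 1 ≤ q) (b : ZMod q) {η : ℝ} (hη : 0 < η) (hη1 : η ≤ 1)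
    {y : ℝ} (hy : 1 ≤ y) (hyX : y * Real.exp η ≤ X) :
    |(1/y) * (∑ n ∈ Icc 1 ⌊y⌋₊, if (n : ZMod q) = b then δ ^ n.primeFactors.card else 0) -
      ∑ n ∈ Icc 1 X, (if (n : ZMod q) = b then Hf δ Y X n else 0) * (Real.exp (-Real.log y) * kk η (Real.log y - Real.log n))| ≤
     (1/y) * (2 * ∑ n ∈ (Icc 1 ⌊y⌋₊).filter (fun n : ℕ => (n : ZMod q) = b), MF (Fmix Y δ (δ/2)) n) + 2 * η / q + 2 / y := by
  have hy0 : 0 < y := by linarith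
  have hee : 1 ≤ Real.exp η := Real.one_le_exp hη.le
  have hyX' : y ≤ X := by nlinarith
  have hfX : ⌊y⌋₊ ≤ X := Nat.floor_le_of_le hyX'
  have ey : Real.exp (-Real.log y) = 1/y := by rw [Real.exp_neg, Real.exp_log hy0]; simp
  set I1 := (Icc 1 ⌊y⌋₊).filter (fun n : ℕ => (n : ZMod q) = b) with hI1
  set I2 := (Icc 1 ⌊y * Real.exp η⌋₊).filter (fun n : ℕ => (n : ZMod q) = b) with hI2
  set IX := (Icc 1 X).filter (fun n : ℕ => (n : ZMod q) = b) with hIX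
  have hf2 : ⌊y * Real.exp η⌋₊ ≤ X := Nat.floor_le_of_le hyX
  have hf12 : ⌊y⌋₊ ≤ ⌊y * Real.exp η⌋₊ := Nat.floor_le_floor (by nlinarith)
  have s12 : I1 ⊆ I2 := by
    intro n hn; simp only [hI1, hI2, mem_filter, mem_Icc] at hn ⊢; exact ⟨⟨hn.1.1, by omega⟩, hn.2⟩
  have s2X : I2 ⊆ IX := by
    intro n hn; simp only [hIX, hI2, mem_filter, mem_Icc] at hn ⊢; exact ⟨⟨hn.1.1, by omega⟩, hn.2⟩
  have eA : (∑ n ∈ Icc 1 ⌊y⌋₊, if (n : ZMod q) = b then δ ^ n.primeFactors.card else 0) = ∑ n ∈ I1, δ ^ n.primeFactors.card := by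
    rw [hI1, Finset.sum_filter]
  have hH1 : ∀ n ∈ IX, 0 ≤ Hf δ Y X n ∧ Hf δ Y X n ≤ 1 := by
    intro n hn
    simp only [hIX, mem_filter, mem_Icc] at hn
    have hd := decomp δ h0 h1 Y X n (by omega) (by omega)
    constructor
    · unfold Hf
      have tn : ∀ F : ℕ → ℕ → ℝ, (∀ p k, 0 ≤ F p k) → ∀ m, 0 ≤ trunc (MF F) X m := by
        intro F hF m; rw [trunc_apply]; split_ifs
        · exact MF_nonneg hF m
        · rfl
      have hc : 0 ≤ 1 - δ/2 := by linarith
      simp only [ArithmeticFunction.mul_apply]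
      refine Finset.sum_nonneg fun z _ => mul_nonneg (Finset.sum_nonneg fun w _ => mul_nonneg ?_ ?_) ?_
      · exact MF_nonneg (by intro p k; unfold Flo; split_ifs <;> linarith) _
      · exact tn _ (by intro p k; unfold Fhi; split_ifs <;> linarith) _
      · exact tn _ (by intro p k; unfold Gfun; split_ifs <;> positivity) _
    · have : δ ^ n.primeFactors.card ≤ 1 := pow_le_one₀ h0.le h1.le
      unfold Hf; linarith [hd.1]
  have eB : ∑ n ∈ Icc 1 X, (if (n : ZMod q) = b then Hf δ Y X n else 0) * (Real.exp (-Real.log y) * kk η (Real.log y - Real.log n))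
      = (1/y) * (∑ n ∈ I1, Hf δ Y X n + ∑ n ∈ I2 \ I1, Hf δ Y X n * kk η (Real.log y - Real.log n)) := by
    have c1 : ∑ n ∈ Icc 1 X, (if (n : ZMod q) = b then Hf δ Y X n else 0) * (Real.exp (-Real.log y) * kk η (Real.log y - Real.log n))
       = (1/y) * ∑ n ∈ IX, Hf δ Y X n * kk η (Real.log y - Real.log n) := by
      rw [hIX, Finset.sum_filter, Finset.mul_sum, ey]
      refine Finset.sum_congr rfl fun n _ => ?_
      split_ifs <;> ring
    have c2 : ∑ n ∈ IX, Hf δ Y X n * kk η (Real.log y - Real.log n) = ∑ n ∈ I2, Hf δ Y X n * kk η (Real.log y - Real.log n) := by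
      symm
      apply Finset.sum_subset s2X
      intro n hn hn2
      simp only [hI2, hIX, mem_filter, mem_Icc] at hn hn2
      have hlt : ⌊y * Real.exp η⌋₊ < n := by
        by_contra hc; exact hn2 ⟨⟨hn.1.1, by omega⟩, hn.2⟩
      have hlt' := Nat.lt_of_floor_lt hlt
      have : Real.log y + η ≤ Real.log n := by
        have h := Real.log_le_log (by positivity) hlt'.le
        rwa [Real.log_mul hy0.ne' (Real.exp_pos _).ne', Real.log_exp] at h
      rw [kk_zero hη (by linarith), mul_zero]
    rw [c1, c2, ← Finset.sum_sdiff s12, add_comm]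
    congr 2
    refine Finset.sum_congr rfl fun n hn => ?_
    simp only [hI1, mem_filter, mem_Icc] at hn
    have hny : (n:ℝ) ≤ y := (Nat.le_floor_iff hy0.le).1 hn.1.2
    have hn0 : (0:ℝ) < n := by exact_mod_cast hn.1.1
    rw [kk_one hη (by have := Real.log_le_log hn0 hny; linarith), mul_one]
  rw [eA, eB]
  have hd : ∑ n ∈ I1, δ ^ n.primeFactors.card - ∑ n ∈ I1, Hf δ Y X n = ∑ n ∈ I1, (δ ^ n.primeFactors.card - Hf δ Y X n) := by
    rw [Finset.sum_sub_distrib]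
  have d0 : 0 ≤ ∑ n ∈ I1, (δ ^ n.primeFactors.card - Hf δ Y X n) := by
    refine Finset.sum_nonneg fun n hn => ?_
    simp only [hI1, mem_filter, mem_Icc] at hn
    exact (decomp δ h0 h1 Y X n (by omega) (by omega)).1
  have d1 : ∑ n ∈ I1, (δ ^ n.primeFactors.card - Hf δ Y X n) ≤ 2 * ∑ n ∈ I1, MF (Fmix Y δ (δ/2)) n := by
    rw [Finset.mul_sum]
    refine Finset.sum_le_sum fun n hn => ?_
    simp only [hI1, mem_filter, mem_Icc] at hn
    exact (decomp δ h0 h1 Y X n (by omega) (by omega)).2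
  have t0 : 0 ≤ ∑ n ∈ I2 \ I1, Hf δ Y X n * kk η (Real.log y - Real.log n) := by
    refine Finset.sum_nonneg fun n hn => mul_nonneg (hH1 n (s2X (mem_sdiff.1 hn).1)).1 (kk_nonneg hη _)
  have t1 : ∑ n ∈ I2 \ I1, Hf δ Y X n * kk η (Real.log y - Real.log n) ≤ y * (2 * η) / q + 2 := by
    have : ∑ n ∈ I2 \ I1, Hf δ Y X n * kk η (Real.log y - Real.log n) ≤ ∑ n ∈ I2 \ I1, (1:ℝ) := by
      refine Finset.sum_le_sum fun n hn => ?_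
      have := hH1 n (s2X (mem_sdiff.1 hn).1)
      exact mul_le_one₀ this.2 (kk_nonneg hη _) (kk_le_one hη _)
    refine this.trans ?_
    rw [Finset.sum_const, nsmul_eq_mul, mul_one, Finset.card_sdiff_of_subset s12, Nat.cast_sub (Finset.card_le_card s12)]
    have c1 := abs_le.1 (count_class q hq b y hy0.le)
    have c2 := abs_le.1 (count_class q hq b (y * Real.exp η) (by positivity))
    have hexp : Real.exp η ≤ 1 + 2 * η := by
      have := Real.abs_exp_sub_one_le (x := η) (by rw [abs_of_pos hη]; exact hη1)
      rw [abs_of_pos hη] at this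
      linarith [le_abs_self (Real.exp η - 1)]
    have hq0 : (0:ℝ) < q := by exact_mod_cast hq
    have : y * Real.exp η / q - y / q ≤ y * (2 * η) / q := by
      rw [← sub_div]; gcongr; nlinarith
    linarith [c1.1, c2.2]
  rw [← mul_sub, abs_mul, abs_of_pos (show 0 < 1/y by positivity)]
  have hq0 : (0:ℝ) < q := by exact_mod_cast hq
  have e : (1/y) * (2 * ∑ n ∈ I1, MF (Fmix Y δ (δ/2)) n) + 2 * η / q + 2 / y =
     (1/y) * (2 * ∑ n ∈ I1, MF (Fmix Y δ (δ/2)) n + (y * (2 * η) / q + 2)) := by field_simp; ring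
  rw [e]
  gcongr
  have nn : 0 ≤ y * (2 * η) / q + 2 := by positivity
  rw [abs_le]; constructor <;> linarith

lemma pp_factor (δ : ℝ) (h0 : 0 < δ) (h1 : δ < 1) {u : ℝ} (hu : 0 ≤ u) (hu2 : u ≤ 1/2) :
    ((1 - u)⁻¹)^δ ≤ (1 + δ * u) * Real.exp (2 * u^2) := by
  have h1u : 0 < 1 - u := by linarith
  have a : (1 - u)⁻¹ ≤ (1 + u) * Real.exp (2*u^2) := by
    rw [inv_le_iff_one_le_mul₀ h1u]
    have he := Real.add_one_le_exp (2*u^2)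
    have hu4 : u^2 ≤ 1/4 := by nlinarith
    calc (1:ℝ) ≤ (1 - u^2) * (2*u^2 + 1) := by nlinarith [sq_nonneg u, sq_nonneg (u^2)]
      _ ≤ (1 - u^2) * Real.exp (2*u^2) := by gcongr; nlinarith
      _ = _ := by ring
  calc ((1 - u)⁻¹)^δ ≤ ((1 + u) * Real.exp (2*u^2))^δ := by gcongr
    _ = (1+u)^δ * (Real.exp (2*u^2))^δ := by rw [Real.mul_rpow (by positivity) (by positivity)]
    _ ≤ (1 + δ * u) * Real.exp (2 * u^2) := by
      gcongr
      · exact rpow_one_add_le_one_add_mul_self (by linarith) h0.le h1.le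
      · rw [← Real.exp_mul]
        apply Real.exp_le_exp.2
        nlinarith [sq_nonneg u]

lemma pp_lower (δ : ℝ) (h0 : 0 < δ) (h1 : δ < 1) {x : ℝ} (hx : 1 ≤ x) {q : ℕ} (hq : 1 ≤ q) :
    (Real.log x)^δ ≤ Real.exp 4 * (1 + Real.log q) *
      ∏ p ∈ ((Icc 1 ⌊x⌋₊).filter Nat.Prime).filter (fun p => ¬ p ∣ q), (1 + δ / (p:ℝ)) := by
  set N := ⌊x⌋₊ + 1 with hN
  have hset : N.primesBelow = (Icc 1 ⌊x⌋₊).filter Nat.Prime := by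
    ext p; simp only [Nat.mem_primesBelow, mem_filter, mem_Icc, hN]
    constructor
    · rintro ⟨a, b⟩; exact ⟨⟨b.one_le, by omega⟩, b⟩
    · rintro ⟨a, b⟩; exact ⟨by omega, b⟩
  rw [← hset]
  have hlx : 0 ≤ Real.log x := Real.log_nonneg hx
  have hxN : Real.log x ≤ PP (-1) N := by
    refine le_trans ?_ (log_le_PP N (by omega))
    apply Real.log_le_log (by linarith)
    have := Nat.lt_floor_add_one x
    rw [hN]; push_cast; exact this.le
  have hP : (PP (-1) N)^δ ≤ Real.exp 4 * ∏ p ∈ N.primesBelow, (1 + δ / (p:ℝ)) := by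
    unfold PP
    rw [← Real.finsetProd_rpow _ _ (fun p hp => by
      have := rpow_prime_lt_one (a := -1) (by norm_num) (Nat.prime_of_mem_primesBelow hp)
      rw [inv_nonneg]; linarith)]
    calc ∏ p ∈ N.primesBelow, ((1 - (p:ℝ)^(-1:ℝ))⁻¹)^δ ≤ ∏ p ∈ N.primesBelow, ((1 + δ * (p:ℝ)⁻¹) * Real.exp (2 * ((p:ℝ)⁻¹)^2)) := by
          apply Finset.prod_le_prod
          · intro p hp
            have := rpow_prime_lt_one (a := -1) (by norm_num) (Nat.prime_of_mem_primesBelow hp)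
            apply Real.rpow_nonneg
            rw [inv_nonneg]; linarith
          · intro p hp
            rw [Real.rpow_neg_one]
            have h2 : (2:ℝ) ≤ p := by exact_mod_cast (Nat.prime_of_mem_primesBelow hp).two_le
            apply pp_factor δ h0 h1 (by positivity)
            rw [inv_le_comm₀ (by linarith) (by norm_num)]; linarith
      _ = (∏ p ∈ N.primesBelow, (1 + δ / (p:ℝ))) * Real.exp (2 * ∑ p ∈ N.primesBelow, ((p:ℝ)⁻¹)^2) := by
          rw [Finset.prod_mul_distrib, ← Real.exp_sum, Finset.mul_sum]
          simp only [div_eq_mul_inv]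
      _ ≤ (∏ p ∈ N.primesBelow, (1 + δ / (p:ℝ))) * Real.exp 4 := by
          gcongr
          have := sum_inv_sq_le N.primesBelow
          linarith
      _ = _ := by ring
  have hs : ∏ p ∈ N.primesBelow, (1 + δ / (p:ℝ)) ≤ (1 + Real.log q) * ∏ p ∈ N.primesBelow.filter (fun p => ¬ p ∣ q), (1 + δ / (p:ℝ)) := by
    rw [← Finset.prod_filter_mul_prod_filter_not N.primesBelow (fun p => p ∣ q)]
    gcongr
    refine le_trans ?_ (prod_primeFactors_le q hq)
    calc ∏ p ∈ N.primesBelow with p ∣ q, (1 + δ / (p:ℝ)) ≤ ∏ p ∈ N.primesBelow with p ∣ q, (1 + (p:ℝ)⁻¹) := by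
          apply Finset.prod_le_prod
          · intro p _; positivity
          · intro p _
            rw [div_eq_mul_inv]
            have : 0 ≤ (p:ℝ)⁻¹ := by positivity
            nlinarith
      _ ≤ _ := by
          apply Finset.prod_le_prod_of_subset_of_one_le
          · intro p hp
            simp only [mem_filter, Nat.mem_primesBelow] at hp
            exact Nat.mem_primeFactors.2 ⟨hp.1.2, hp.2, by omega⟩
          · intro p _; positivity
          · intro p _ _
            have : 0 ≤ (p:ℝ)⁻¹ := by positivity
            linarith
  calc (Real.log x)^δ ≤ (PP (-1) N)^δ := by gcongr
    _ ≤ _ := hP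
    _ ≤ Real.exp 4 * ((1 + Real.log q) * ∏ p ∈ N.primesBelow.filter (fun p => ¬ p ∣ q), (1 + δ / (p:ℝ))) := by gcongr
    _ = _ := by ring

def KH (ε : ℝ) : ℝ := 9 * (Real.exp 30 * (1 + 2 * Real.exp 2 * (2 + 2*(1+1/ε)))) *
  (cK ε * (Real.exp 1 * ((Real.sqrt Real.pi * Real.exp 1 * 16) * (2 * Real.exp 2))))

lemma A0_bound {ε L : ℝ} (he : 0 < ε) (hL1 : 1 ≤ L) (Y : ℕ) (hY3 : 3 ≤ Y)
    (hYl : L^(1-ε) ≤ Real.log Y) (hYu : Real.log Y ≤ 2 * L^(1-ε)) :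
    (1 + 1/(1/L)) / PP (-(1+1/L)) Y ≤ 2 * Real.exp 2 * L^ε := by
  have hL0 : 0 < L := by linarith
  have hPP := PP_pos (a := -(1+1/L)) (by have : 0 < 1/L := by positivity
                                         linarith) Y
  have hge := PP_ge (1/L) (by positivity) Y (by omega)
  have hle : L^(1-ε) ≤ L := by
    calc L^(1-ε) ≤ L^(1:ℝ) := Real.rpow_le_rpow_of_exponent_le hL1 (by linarith)
      _ = L := Real.rpow_one L
  have hYp : Real.exp (-2) ≤ (Y:ℝ)^(-(1/L)) := by
    rw [Real.rpow_def_of_pos (by positivity)]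
    apply Real.exp_le_exp.2
    rw [mul_neg, mul_one_div]
    apply neg_le_neg
    rw [div_le_iff₀ hL0]; linarith
  have hP : Real.exp (-2) * L^(1-ε) ≤ PP (-(1+1/L)) Y := by
    refine le_trans ?_ hge
    gcongr
  rw [one_div_one_div, div_le_iff₀ hPP]
  have e1 : L^ε * L^(1-ε) = L := by rw [← Real.rpow_add hL0]; simp
  have e2 : Real.exp 2 * Real.exp (-2) = 1 := by rw [← Real.exp_add]; simp
  calc 1 + L ≤ 2 * L := by linarith
    _ = 2 * (Real.exp 2 * Real.exp (-2)) * (L^ε * L^(1-ε)) := by rw [e1, e2]; ring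
    _ = 2 * Real.exp 2 * L^ε * (Real.exp (-2) * L^(1-ε)) := by ring
    _ ≤ _ := by gcongr

lemma K_main (δ : ℝ) (h0 : 0 < δ) (h1 : δ < 1) {ε L : ℝ} (he : 0 < ε) (he1 : ε ≤ 1/20) (hL1 : 1 ≤ L)
    (hLε : 2 ≤ L^ε) (hL2 : 2 ≤ L^(1-2*ε)) (Y X : ℕ) (hY3 : 3 ≤ Y)
    (hYl : L^(1-ε) ≤ Real.log Y) (hYu : Real.log Y ≤ 2 * L^(1-ε))
    {q : ℕ} (hq : 1 ≤ q) (b : ZMod q) (hb : IsUnit b) (hlq : 1 + Real.log q ≤ L^ε)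
    (hsm : q * (Real.exp (-(L^ε/2)) * (1+2*L)^24) ≤ L^(-1:ℝ))
    {l' : ℝ} (hll : l' ≤ L) (hU : L - l' ≤ L^ε) (hX : Real.exp (L + 1/L) ≤ X) :
    q * |∑ n ∈ Icc 1 X, (if (n : ZMod q) = b then Hf δ Y X n else 0) *
      (Real.exp (-L) * kk (1/L) (L - Real.log n) - Real.exp (-l') * kk (1/L) (l' - Real.log n))| ≤
    KH ε * L^(-1+9*ε) := by
  have hL0 : 0 < L := by linarith
  have hq0 : (0:ℝ) < q := by exact_mod_cast hq
  have hlq0 : 0 ≤ Real.log q := Real.log_nonneg (by exact_mod_cast hq)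
  have hr : ∀ a b : ℝ, L^a * L^b = L^(a+b) := fun a b => (Real.rpow_add hL0 a b).symm
  have hmono : ∀ a b : ℝ, a ≤ b → L^a ≤ L^b := fun a b h => Real.rpow_le_rpow_of_exponent_le hL1 h
  set v1 := L^(1-2*ε) with hv1
  set v := L^(1-ε) with hv
  have hvv : v = L^ε * v1 := by rw [hv, hv1, hr]; congr 1; ring
  have hv1L : v1 ≤ L := by
    calc v1 ≤ L^(1:ℝ) := hmono _ _ (by linarith)
      _ = L := Real.rpow_one L
  have hL'1 : 1/L ≤ 1 := by rw [div_le_one hL0]; exact hL1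
  have hσl : 1/L * L ≤ 1 := by rw [one_div_mul_cancel hL0.ne']
  set β := (1 + Real.log q)^2 / v1 + q * (Real.exp (-(v/(2*v1))) * (1+2*v1)^24) with hβ
  have hN := fun b t ht => beta_bound (v1 := v1) hL2 (v := v) (by rw [hvv]; nlinarith) Y X hY3 hYl hq b t ht
  have hb2 := H_bound δ h0 h1 Y X hq b hb (η := 1/L) (σ := 1/L) (by positivity) hL'1 (by positivity) hL'1 hll hσl X hX he (by linarith) (β := β) hN
  have hβle : β ≤ 2 * L^(-1+4*ε) := by
    have a1 : (1 + Real.log q)^2 / v1 ≤ L^(-1+4*ε) := by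
      rw [div_le_iff₀ (by positivity), hv1, hr]
      calc (1 + Real.log q)^2 ≤ (L^ε)^2 := by gcongr
        _ = L^(-1+4*ε+(1-2*ε)) := by rw [sq, hr]; congr 1; ring
    have a2 : q * (Real.exp (-(v/(2*v1))) * (1+2*v1)^24) ≤ L^(-1+4*ε) := by
      have : v/(2*v1) = L^ε/2 := by rw [hvv]; field_simp
      rw [this]
      calc _ ≤ q * (Real.exp (-(L^ε/2)) * (1+2*L)^24) := by gcongr
        _ ≤ L^(-1:ℝ) := hsm
        _ ≤ _ := hmono _ _ (by linarith)
    rw [hβ]; linarith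
  have hβ0 : 0 ≤ β := by positivity
  have hA := A0_bound he hL1 Y hY3 hYl hYu
  set A0 := (1 + 1/(1/L)) / PP (-(1+1/L)) Y with hA0
  have hPP := PP_pos (a := -(1+1/L)) (by have : 0 < 1/L := by positivity
                                         linarith) Y
  have hA00 : 0 ≤ A0 := by positivity
  have hR : ∑ r ∈ Rset Y X, (r:ℝ)^(-(1+1/L)) ≤ 2 * Real.exp 2 * L^ε := (Rsum_le (by positivity) Y X).trans hA
  have hη : (1/L)^(-(2*ε)) = L^(2*ε) := by
    rw [one_div, Real.inv_rpow hL0.le, ← Real.rpow_neg hL0.le, neg_neg]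
  rw [hη] at hb2
  have hLe1 : 1 ≤ L^ε := by linarith
  have hB : 1 + A0 * (1 + Real.log q + 2*(1+1/ε) + (L - l')) ≤ (1 + 2 * Real.exp 2 * (2 + 2*(1+1/ε))) * L^(2*ε) := by
    have b1 : 1 + Real.log q + 2*(1+1/ε) + (L - l') ≤ (2 + 2*(1+1/ε)) * L^ε := by
      have : 2*(1+1/ε) ≤ 2*(1+1/ε) * L^ε := le_mul_of_one_le_right (by positivity) hLe1
      linarith
    have b2 : (1:ℝ) ≤ L^(2*ε) := Real.one_le_rpow hL1 (by linarith)
    have b3 : 0 ≤ L - l' := by linarith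
    calc _ ≤ 1 + (2 * Real.exp 2 * L^ε) * ((2 + 2*(1+1/ε)) * L^ε) := by gcongr
      _ = 1 + 2 * Real.exp 2 * (2 + 2*(1+1/ε)) * L^(2*ε) := by
        rw [show 2*ε = ε+ε by ring, ← hr]; ring
      _ ≤ L^(2*ε) + 2 * Real.exp 2 * (2 + 2*(1+1/ε)) * L^(2*ε) := by linarith
      _ = _ := by ring
  have hcK := cK_nonneg ε
  calc _ ≤ q * ((9 * L^(2*ε)) * (Real.exp 30 * (1 + A0 * (1 + Real.log q + 2*(1+1/ε) + (L - l')))) *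
      (cK ε * (Real.exp 1 * ((Real.sqrt Real.pi * Real.exp 1 * (8 * β / q)) * ∑ r ∈ Rset Y X, (r:ℝ)^(-(1+1/L)))))) := by
        gcongr
    _ ≤ q * ((9 * L^(2*ε)) * (Real.exp 30 * ((1 + 2 * Real.exp 2 * (2 + 2*(1+1/ε))) * L^(2*ε))) *
      (cK ε * (Real.exp 1 * ((Real.sqrt Real.pi * Real.exp 1 * (8 * (2 * L^(-1+4*ε)) / q)) * (2 * Real.exp 2 * L^ε))))) := by
        gcongr
    _ = KH ε * (L^(2*ε) * L^(2*ε) * L^(-1+4*ε) * L^ε) := by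
        unfold KH; field_simp; ring
    _ = _ := by rw [hr, hr, hr]; congr 2; ring

lemma K_P (δ : ℝ) (h0 : 0 < δ) (h1 : δ < 1) {ε μ L : ℝ} (he : ε = δ/20) (hμ : μ = δ^2/400) (hL1 : 1 ≤ L)
    (Z : ℕ) (hZ3 : 3 ≤ Z) (hZu : Real.log Z ≤ 2 * L^(1-μ)) (Y : ℕ) (hY3 : 3 ≤ Y)
    (hYu : Real.log Y ≤ 2 * L^(1-ε)) :
    PP (-1) Z ^ (δ/2) * PP (-1) Y ^ (δ/2) ≤ 4 * Real.exp 5 * L^(δ-10*μ) := by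
  have hL0 : 0 < L := by linarith
  have hr : ∀ a b : ℝ, L^a * L^b = L^(a+b) := fun a b => (Real.rpow_add hL0 a b).symm
  have hmono : ∀ a b : ℝ, a ≤ b → L^a ≤ L^b := fun a b h => Real.rpow_le_rpow_of_exponent_le hL1 h
  have hμ0 : 0 < μ := by rw [hμ]; positivity
  have p1 := mertens_upper Z hZ3
  have p2 := mertens_upper Y hY3
  have z0 := (PP_pos (a := -1) (by norm_num) Z).le
  have y0 := (PP_pos (a := -1) (by norm_num) Y).le
  have p1' : PP (-1) Z ≤ 4 * Real.exp 5 * L^(1-μ) := by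
    refine p1.trans ?_
    calc 2 * Real.exp 5 * Real.log Z ≤ 2 * Real.exp 5 * (2 * L^(1-μ)) := by gcongr
      _ = _ := by ring
  have p2' : PP (-1) Y ≤ 4 * Real.exp 5 * L^(1-ε) := by
    refine p2.trans ?_
    calc 2 * Real.exp 5 * Real.log Y ≤ 2 * Real.exp 5 * (2 * L^(1-ε)) := by gcongr
      _ = _ := by ring
  have hc1 : 1 ≤ 4 * Real.exp 5 := by
    have := Real.add_one_le_exp (5:ℝ); linarith
  calc _ ≤ (4 * Real.exp 5 * L^(1-μ))^(δ/2) * (4 * Real.exp 5 * L^(1-ε))^(δ/2) := by gcongr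
    _ = (4 * Real.exp 5)^(δ/2) * (4 * Real.exp 5)^(δ/2) * (L^((1-μ)*(δ/2)) * L^((1-ε)*(δ/2))) := by
      rw [Real.mul_rpow (x := 4 * Real.exp 5) (y := L^(1-μ)) (by positivity) (by positivity), Real.mul_rpow (x := 4 * Real.exp 5) (y := L^(1-ε)) (by positivity) (by positivity), ← Real.rpow_mul hL0.le, ← Real.rpow_mul hL0.le]; ring
    _ = (4 * Real.exp 5)^δ * L^((1-μ)*(δ/2) + (1-ε)*(δ/2)) := by
      rw [← Real.rpow_add (by positivity), hr]; congr 2; ring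
    _ ≤ (4 * Real.exp 5)^(1:ℝ) * L^(δ-10*μ) := by
      apply mul_le_mul
      · exact Real.rpow_le_rpow_of_exponent_le hc1 h1.le
      · apply hmono
        have : ε * (δ/2) = 10 * μ := by rw [he, hμ]; ring
        have : 0 ≤ μ * (δ/2) := by positivity
        nlinarith
      · positivity
      · positivity
    _ = _ := by rw [Real.rpow_one]

lemma K_shiu (δ : ℝ) (h0 : 0 < δ) (h1 : δ < 1) {ε μ L : ℝ} (he : ε = δ/20) (hμ : μ = δ^2/400) (hL1 : 1 ≤ L)
    (hL2 : 2 ≤ L^(1-μ)) (hYZ' : 2 * L^(1-ε) ≤ L^(1-μ)) (Y : ℕ) (hY3 : 3 ≤ Y)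
    (hYu : Real.log Y ≤ 2 * L^(1-ε))
    {q : ℕ} (hq : 1 ≤ q) (b : ZMod q) (hb : IsUnit b) (hlq : 1 + Real.log q ≤ L^μ)
    (hsm : q * (Real.exp (-(L^μ/8)) * (1+2*L)^24) ≤ L^(-1:ℝ))
    {y : ℝ} (hy : 1 ≤ y) (hyL : L/2 ≤ Real.log y) :
    q * ((1/y) * ∑ n ∈ (Icc 1 ⌊y⌋₊).filter (fun n : ℕ => (n : ZMod q) = b), MF (Fmix Y δ (δ/2)) n) ≤
      (8 * Real.exp 33 + 1) * L^(-1+δ-2*μ) := by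
  have hL0 : 0 < L := by linarith
  have hq0 : (0:ℝ) < q := by exact_mod_cast hq
  have hy0 : 0 < y := by linarith
  have hlq0 : 0 ≤ Real.log q := Real.log_nonneg (by exact_mod_cast hq)
  have hr : ∀ a b : ℝ, L^a * L^b = L^(a+b) := fun a b => (Real.rpow_add hL0 a b).symm
  have hmono : ∀ a b : ℝ, a ≤ b → L^a ≤ L^b := fun a b h => Real.rpow_le_rpow_of_exponent_le hL1 h
  have hμ0 : 0 < μ := by rw [hμ]; positivity
  have hμδ : 2 * μ ≤ δ := by rw [hμ]; nlinarith
  obtain ⟨Z, hZ3, hZl, hZu⟩ := exists_nat_exp (L^(1-μ)) hL2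
  set v2 := L^(1-μ) with hv2
  have hv2L : v2 ≤ L := by
    calc v2 ≤ L^(1:ℝ) := hmono _ _ (by linarith)
      _ = L := Real.rpow_one L
  have hYZ : Y ≤ Z := by
    have : Real.log Y ≤ Real.log Z := by linarith
    have := (Real.log_le_log_iff (by positivity) (by positivity)).1 this
    exact_mod_cast this
  have hs := shiu δ h0 h1 Y Z q hYZ (by omega) hq b hb y hy (1/(2*v2)) (by positivity)
    (by rw [div_le_div_iff₀ (by positivity) (by positivity)]; linarith) (rpow_le_e hZ3 hL2 hZu)
  rw [one_div_one_div] at hs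
  set s := y^(-(1/(2*v2)/2)) * (1+2*v2)^24 with hsdef
  have hqs : q * s ≤ L^(-1:ℝ) := by
    refine le_trans ?_ hsm
    have : y^(-(1/(2*v2)/2)) ≤ Real.exp (-(L^μ/8)) := by
      rw [Real.rpow_def_of_pos hy0]
      apply Real.exp_le_exp.2
      have e : L^μ * v2 = L := by rw [hv2, hr]; simp
      have e2 : L^μ/8 = L/2 * (1/(2*v2)/2) := by
        have hv0 : v2 ≠ 0 := by positivity
        have e3 : L^μ = L / v2 := by rw [eq_div_iff hv0]; exact e
        rw [e3]; field_simp; norm_num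
      rw [mul_neg, e2]
      apply neg_le_neg; gcongr
    rw [hsdef]; gcongr
  have hP := K_P δ h0 h1 he hμ hL1 Z hZ3 hZu Y hY3 hYu
  have hP0 : 0 ≤ PP (-1) Z ^ (δ/2) * PP (-1) Y ^ (δ/2) :=
    mul_nonneg (Real.rpow_nonneg (PP_pos (by norm_num) Z).le _) (Real.rpow_nonneg (PP_pos (by norm_num) Y).le _)
  set P := PP (-1) Z ^ (δ/2) * PP (-1) Y ^ (δ/2) with hPdef
  have hlZ : 0 < Real.log Z := by linarith
  have hq1 : (1 + Real.log q)^2 / Real.log Z + q * s ≤ 2 * L^(-1+3*μ) := by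
    have a1 : (1 + Real.log q)^2 / Real.log Z ≤ L^(-1+3*μ) := by
      rw [div_le_iff₀ hlZ]
      calc (1 + Real.log q)^2 ≤ (L^μ)^2 := by gcongr
        _ = L^(-1+3*μ) * v2 := by rw [sq, hr, hv2, hr]; congr 1; ring
        _ ≤ _ := by gcongr
    have a2 : L^(-1:ℝ) ≤ L^(-1+3*μ) := hmono _ _ (by linarith)
    linarith
  calc _ ≤ q * ((1/y) * (y * (((1 + Real.log q)^2 / Real.log Z / q + s) * (Real.exp 28 * P) + s))) := by gcongr
    _ = ((1 + Real.log q)^2 / Real.log Z + q * s) * (Real.exp 28 * P) + q * s := by field_simp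
    _ ≤ (2 * L^(-1+3*μ)) * (Real.exp 28 * (4 * Real.exp 5 * L^(δ-10*μ))) + L^(-1:ℝ) := by
      gcongr
    _ = 8 * Real.exp 33 * L^(-1+3*μ + (δ-10*μ)) + L^(-1:ℝ) := by
      rw [← hr (-1+3*μ) (δ-10*μ), show (33:ℝ) = 28+5 by norm_num, Real.exp_add]; ring
    _ ≤ 8 * Real.exp 33 * L^(-1+δ-2*μ) + L^(-1+δ-2*μ) := by
      have a1 := hmono (-1+3*μ + (δ-10*μ)) (-1+δ-2*μ) (by linarith)
      have a2 := hmono (-1) (-1+δ-2*μ) (by linarith)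
      gcongr
    _ = _ := by ring

lemma N_core (δ : ℝ) (h0 : 0 < δ) (h1 : δ < 1) {ε μ L : ℝ} (he : ε = δ/20) (hμ : μ = δ^2/400) (hL1 : 1 ≤ L)
    (hLε : 2 ≤ L^ε) (hL2 : 2 ≤ L^(1-2*ε)) (hL3 : 2 ≤ L^(1-μ)) (hYZ' : 2 * L^(1-ε) ≤ L^(1-μ))
    {q : ℕ} (hq : 1 ≤ q) (b : ZMod q) (hb : IsUnit b) (hlq : 1 + Real.log q ≤ L^μ)
    (hsm : q * (Real.exp (-(L^μ/8)) * (1+2*L)^24) ≤ L^(-1:ℝ))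
    {x x' : ℝ} (hx' : 1 ≤ x') (hxx : x' ≤ x) (hL : Real.log x = L)
    (hyL : L/2 ≤ Real.log x') (hU : L - Real.log x' ≤ L^μ) (hqx : q / x' ≤ L^(-1:ℝ)) :
    |(q / x') * (∑ n ∈ Icc 1 ⌊x'⌋₊, if (n : ZMod q) = b then δ^n.primeFactors.card else 0) -
     (q / x) * (∑ n ∈ Icc 1 ⌊x⌋₊, if (n : ZMod q) = b then δ^n.primeFactors.card else 0)| ≤
      (KH ε + 4 * (8 * Real.exp 33 + 1) + 8) * L^(-1+δ-2*μ) := by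
  have hL0 : 0 < L := by linarith
  have hx0 : 0 < x := by linarith
  have hx'0 : 0 < x' := by linarith
  have hq0 : (0:ℝ) < q := by exact_mod_cast hq
  have hmono : ∀ a b : ℝ, a ≤ b → L^a ≤ L^b := fun a b h => Real.rpow_le_rpow_of_exponent_le hL1 h
  have hμ0 : 0 < μ := by rw [hμ]; positivity
  have he0 : 0 < ε := by rw [he]; positivity
  have hμε : μ ≤ ε := by rw [hμ, he]; nlinarith
  have hμδ : 2 * μ ≤ δ/2 := by rw [hμ]; nlinarith
  have hμe := hmono _ _ hμε
  have hη1 : 1/L ≤ 1 := by rw [div_le_one hL0]; exact hL1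
  obtain ⟨Y, hY3, hYl, hYu⟩ := exists_nat_exp (L^(1-ε)) (hL2.trans (hmono _ _ (by linarith)))
  set X := ⌈Real.exp (L + 1/L)⌉₊ with hXd
  have hX : Real.exp (L + 1/L) ≤ X := Nat.le_ceil _
  have hXx : x * Real.exp (1/L) ≤ X := by
    rw [Real.exp_add, ← hL, Real.exp_log hx0, hL] at hX; exact hX
  have hXx' : x' * Real.exp (1/L) ≤ X := le_trans (by gcongr) hXx
  have hsm' : q * (Real.exp (-(L^ε/2)) * (1+2*L)^24) ≤ L^(-1:ℝ) := by
    refine le_trans ?_ hsm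
    have : 0 ≤ L^μ := by positivity
    gcongr; linarith
  have hM := K_main δ h0 h1 he0 (by rw [he]; linarith) hL1 hLε hL2 Y X hY3 hYl hYu hq b hb (hlq.trans hμe) hsm'
    (l' := Real.log x') (by rw [← hL]; exact Real.log_le_log hx'0 hxx) (hU.trans hμe) hX
  have s1 := smooth_sharp δ h0 h1 Y X hq b (η := 1/L) (by positivity) hη1 (hx'.trans hxx) hXx
  have s2 := smooth_sharp δ h0 h1 Y X hq b (η := 1/L) (by positivity) hη1 hx' hXx'
  have t1 := K_shiu δ h0 h1 he hμ hL1 hL3 hYZ' Y hY3 hYu hq b hb hlq hsm (hx'.trans hxx) (by rw [hL]; linarith)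
  have t2 := K_shiu δ h0 h1 he hμ hL1 hL3 hYZ' Y hY3 hYu hq b hb hlq hsm hx' hyL
  rw [hL] at s1
  have hqx2 : q / x ≤ L^(-1:ℝ) := le_trans (by gcongr) hqx
  have hLi : 1/L = L^(-1:ℝ) := by rw [Real.rpow_neg_one, one_div]
  have m1 := hmono (-1) (-1+δ-2*μ) (by linarith)
  have m2 := hmono (-1+9*ε) (-1+δ-2*μ) (by rw [he]; linarith)
  have hKH : 0 ≤ KH ε := by
    have := cK_nonneg ε
    unfold KH; positivity
  have m3 := mul_le_mul_of_nonneg_left m2 hKH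
  set S1 := ∑ n ∈ Icc 1 ⌊x⌋₊, if (n : ZMod q) = b then δ^n.primeFactors.card else 0
  set S2 := ∑ n ∈ Icc 1 ⌊x'⌋₊, if (n : ZMod q) = b then δ^n.primeFactors.card else 0
  set F1 := ∑ n ∈ (Icc 1 ⌊x⌋₊).filter (fun n : ℕ => (n : ZMod q) = b), MF (Fmix Y δ (δ/2)) n
  set F2 := ∑ n ∈ (Icc 1 ⌊x'⌋₊).filter (fun n : ℕ => (n : ZMod q) = b), MF (Fmix Y δ (δ/2)) n
  simp only [mul_sub, Finset.sum_sub_distrib] at hM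
  set T1 := ∑ n ∈ Icc 1 X, (if (n : ZMod q) = b then Hf δ Y X n else 0) * (Real.exp (-L) * kk (1/L) (L - Real.log n))
  set T2 := ∑ n ∈ Icc 1 X, (if (n : ZMod q) = b then Hf δ Y X n else 0) * (Real.exp (-Real.log x') * kk (1/L) (Real.log x' - Real.log n))
  have e : (q/x') * S2 - (q/x) * S1 = q * ((1/x' * S2 - T2) - (1/x*S1 - T1) - (T1 - T2)) := by ring
  rw [e, abs_mul, abs_of_pos hq0]
  have tri : |(1/x' * S2 - T2) - (1/x*S1 - T1) - (T1 - T2)| ≤ |1/x' * S2 - T2| + |1/x*S1 - T1| + |T1 - T2| :=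
    (abs_sub _ _).trans (by gcongr; exact abs_sub _ _)
  have u1 := mul_le_mul_of_nonneg_left s1 hq0.le
  have u2 := mul_le_mul_of_nonneg_left s2 hq0.le
  have u3 := mul_le_mul_of_nonneg_left tri hq0.le
  have v1 : q * (1/x * (2*F1) + 2*(1/L)/q + 2/x) = 2 * (q * (1/x*F1)) + 2 * (1/L) + 2 * (q/x) := by field_simp
  have v2 : q * (1/x' * (2*F2) + 2*(1/L)/q + 2/x') = 2 * (q * (1/x'*F2)) + 2 * (1/L) + 2 * (q/x') := by field_simp
  rw [v1, hLi] at u1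
  rw [v2, hLi] at u2
  rw [mul_add, mul_add] at u3
  linarith

lemma ev_log (C : ℝ) (hC : 0 < C) {μ : ℝ} (hμ : 0 < μ) : ∀ᶠ L : ℝ in atTop, 1 + C * Real.log L ≤ L^μ := by
  have h := (isLittleO_log_rpow_atTop hμ).bound (c := 1/(2*C)) (by positivity)
  have h2 := (tendsto_rpow_atTop hμ).eventually_ge_atTop 2
  filter_upwards [h, h2, eventually_ge_atTop 1] with L a b c
  rw [Real.norm_of_nonneg (Real.log_nonneg c), Real.norm_of_nonneg (by linarith)] at a
  have : C * Real.log L ≤ C * (1/(2*C) * L^μ) := by gcongr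
  have e : C * (1/(2*C) * L^μ) = L^μ/2 := by field_simp
  linarith

lemma ev_exp (C : ℝ) {μ : ℝ} (hμ : 0 < μ) :
    ∀ᶠ L : ℝ in atTop, L^C * (Real.exp (-(L^μ/8)) * (1+2*L)^24) ≤ L^(-1:ℝ) := by
  have h := (tendsto_rpow_mul_exp_neg_mul_atTop_nhds_zero ((C+25)/μ) (1/8) (by norm_num)).comp (tendsto_rpow_atTop hμ)
  have h' := h.eventually_le_const (u := 1/3^24) (by norm_num)
  filter_upwards [h', eventually_ge_atTop 1] with L a c
  have hL0 : 0 < L := by linarith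
  simp only [Function.comp] at a
  rw [← Real.rpow_mul hL0.le, mul_div_cancel₀ _ hμ.ne'] at a
  have e : -(1/8) * L^μ = -(L^μ/8) := by ring
  rw [e] at a
  have e2 : L^(C+25) = L^C * L^24 * L := by
    rw [show C+25 = C + (24:ℕ) + 1 by norm_num; ring, Real.rpow_add hL0, Real.rpow_add hL0, Real.rpow_natCast, Real.rpow_one]
  rw [e2] at a
  rw [Real.rpow_neg_one, ← one_div, le_div_iff₀ hL0]
  calc _ ≤ L^C * (Real.exp (-(L^μ/8)) * (3*L)^24) * L := by gcongr; linarith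
    _ = 3^24 * (L^C * L^24 * L * Real.exp (-(L^μ/8))) := by rw [mul_pow]; ring
    _ ≤ 3^24 * (1/3^24) := by gcongr
    _ = 1 := by norm_num

lemma ev_exp2 (C : ℝ) : ∀ᶠ L : ℝ in atTop, L^C * L^C * Real.exp (-L) ≤ L^(-1:ℝ) := by
  have h := (tendsto_rpow_mul_exp_neg_mul_atTop_nhds_zero (C+C+1) 1 (by norm_num))
  have h' := h.eventually_le_const (u := 1) (by norm_num)
  filter_upwards [h', eventually_ge_atTop 1] with L a c
  have hL0 : 0 < L := by linarith
  rw [Real.rpow_add hL0, Real.rpow_add hL0, Real.rpow_one, neg_one_mul] at a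
  rw [Real.rpow_neg_one, ← one_div, le_div_iff₀ hL0]
  linarith

lemma pp_final (δ : ℝ) (h0 : 0 < δ) (h1 : δ < 1) {μ x : ℝ} (hx : 1 ≤ x) (hL1 : 1 ≤ Real.log x)
    {q : ℕ} (hq : 1 ≤ q) (hlq : 1 + Real.log q ≤ (Real.log x)^μ) :
    (Real.log x)^(-1+δ-2*μ) ≤ Real.exp 4 * (Real.log x)^(-μ) * ((q:ℝ)/(Nat.totient q : ℝ)) * (1 / Real.log x) *
      ∏ p ∈ ((Icc 1 ⌊x⌋₊).filter Nat.Prime).filter (fun p => ¬ p ∣ q), (1 + |(fun n : ℕ => δ^n.primeFactors.card) p| / (p:ℝ)) := by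
  have hp := pp_lower δ h0 h1 hx hq
  have e : ∏ p ∈ ((Icc 1 ⌊x⌋₊).filter Nat.Prime).filter (fun p => ¬ p ∣ q), (1 + |(fun n : ℕ => δ^n.primeFactors.card) p| / (p:ℝ)) =
      ∏ p ∈ ((Icc 1 ⌊x⌋₊).filter Nat.Prime).filter (fun p => ¬ p ∣ q), (1 + δ / (p:ℝ)) := by
    apply Finset.prod_congr rfl
    intro p hp
    have hpp : p.Prime := (Finset.mem_filter.1 (Finset.mem_filter.1 hp).1).2
    simp [hpp.primeFactors, abs_of_pos h0]
  rw [e]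
  set P := ∏ p ∈ ((Icc 1 ⌊x⌋₊).filter Nat.Prime).filter (fun p => ¬ p ∣ q), (1 + δ / (p:ℝ)) with hPd
  have hP : 0 ≤ P := Finset.prod_nonneg fun p _ => by positivity
  set L := Real.log x with hLd
  have hL0 : 0 < L := by linarith
  have ht0 : (0:ℝ) < Nat.totient q := by exact_mod_cast Nat.totient_pos.2 hq
  have ht : 1 ≤ (q:ℝ)/(Nat.totient q : ℝ) := by
    rw [one_le_div ht0]; exact_mod_cast Nat.totient_le q
  have hp2 : L^δ ≤ Real.exp 4 * L^μ * P := hp.trans (by gcongr)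
  calc L^(-1+δ-2*μ) = L^(-μ) * L^(-μ) * (1/L) * L^δ := by
        rw [one_div, ← Real.rpow_neg_one, ← Real.rpow_add hL0, ← Real.rpow_add hL0, ← Real.rpow_add hL0]; congr 1; ring
    _ ≤ L^(-μ) * L^(-μ) * (1/L) * (Real.exp 4 * L^μ * P) := by gcongr
    _ = Real.exp 4 * L^(-μ) * 1 * (1/L) * P := by
        have : L^(-μ) * L^μ = 1 := by rw [← Real.rpow_add hL0]; simp
        linear_combination (L^(-μ) * (1/L) * Real.exp 4 * P) * this
    _ ≤ _ := by gcongr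

lemma O_IV (δ : ℝ) (h0 : 0 < δ) (h1 : δ < 1) (C : ℝ) (hC : 0 < C) :
   ∃ φ : ℝ → ℝ, Tendsto φ atTop (nhds 0) ∧
    ∃ K : ℝ, 0 < K ∧ ∃ x₀ : ℝ, ∀ x ≥ x₀, ∀ x' : ℝ, ∀ q : ℕ, ∀ A : ℤ,
      x * (Real.log x) ^ (-C) < x' → x' < x →
      1 ≤ q → (q : ℝ) < (Real.log x) ^ C → Int.gcd (q : ℤ) A = 1 →
      |(q / x') * (∑ n ∈ Icc 1 ⌊x'⌋₊, if ((n : ℤ) : ZMod q) = (A : ZMod q) then (fun n : ℕ => δ^n.primeFactors.card) n else 0) -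
       (q / x) * (∑ n ∈ Icc 1 ⌊x⌋₊, if ((n : ℤ) : ZMod q) = (A : ZMod q) then (fun n : ℕ => δ^n.primeFactors.card) n else 0)| ≤
        K * φ x * ((q : ℝ) / (Nat.totient q : ℝ)) * (1 / Real.log x) *
      ∏ p ∈ ((Icc 1 ⌊x⌋₊).filter Nat.Prime).filter (fun p => ¬ p ∣ q), (1 + |(fun n : ℕ => δ^n.primeFactors.card) p| / (p:ℝ)) := by
  obtain ⟨ε, he⟩ : ∃ ε, ε = δ/20 := ⟨_, rfl⟩
  obtain ⟨μ, hμ⟩ : ∃ μ, μ = δ^2/400 := ⟨_, rfl⟩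
  have hμ0 : 0 < μ := by rw [hμ]; positivity
  have he0 : 0 < ε := by rw [he]; positivity
  have he1 : ε < 1/20 := by rw [he]; linarith
  have hμε : μ < ε := by rw [hμ, he]; nlinarith
  have hKH : 0 ≤ KH ε := by
    have := cK_nonneg ε
    unfold KH; positivity
  refine ⟨fun x => (Real.log x)^(-μ), (tendsto_rpow_neg_atTop hμ0).comp Real.tendsto_log_atTop,
    (KH ε + 4 * (8 * Real.exp 33 + 1) + 8) * Real.exp 4, by positivity, ?_⟩
  have ev := ((ev_log C hC hμ0).and ((ev_exp C hμ0).and ((ev_exp2 C).and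
    (((tendsto_rpow_atTop he0).eventually_ge_atTop 2).and
    (((tendsto_rpow_atTop (show 0 < 1-2*ε by linarith)).eventually_ge_atTop 2).and
    (((tendsto_rpow_atTop (show 0 < 1-μ by linarith)).eventually_ge_atTop 2).and
    (((tendsto_rpow_atTop (show 0 < ε-μ by linarith)).eventually_ge_atTop 2).and
    (eventually_ge_atTop (1:ℝ)))))))))
  have ev2 := (Real.tendsto_log_atTop.eventually ev).and (eventually_ge_atTop (1:ℝ))
  obtain ⟨x₀, hx₀⟩ := eventually_atTop.1 ev2
  refine ⟨x₀, fun x hx x' q A hxl hxu hq hqC hg => ?_⟩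
  obtain ⟨⟨f1, f2, f3, f4, f5, f6, f7, hL1⟩, hx1⟩ := hx₀ x hx
  have hpf : 1 + Real.log q ≤ (Real.log x)^μ := by
    refine le_trans ?_ f1
    have hq0 : (0:ℝ) < q := by exact_mod_cast hq
    have := Real.log_le_log hq0 hqC.le
    rw [Real.log_rpow (by linarith)] at this
    linarith
  have pf := pp_final δ h0 h1 hx1 hL1 hq hpf
  have hx0 : 0 < x := by linarith
  obtain ⟨L, hL⟩ : ∃ L, L = Real.log x := ⟨_, rfl⟩
  rw [← hL] at hxl hqC f1 f2 f3 f4 f5 f6 f7 hL1 hpf pf ⊢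
  have hL0 : 0 < L := by linarith
  have hq0 : (0:ℝ) < q := by exact_mod_cast hq
  have hx'0 : 0 < x' := lt_trans (by positivity) hxl
  have hlx' : L - C * Real.log L ≤ Real.log x' := by
    have := Real.log_le_log (by positivity) hxl.le
    rw [Real.log_mul hx0.ne' (by positivity), Real.log_rpow hL0, ← hL] at this
    linarith
  have hμL : 2 * L^μ ≤ L := by
    calc 2 * L^μ ≤ L^(1-μ) * L^μ := by gcongr
      _ = L := by rw [← Real.rpow_add hL0]; simp
  have hyL : L/2 ≤ Real.log x' := by linarith
  have hx'1 : 1 ≤ x' := by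
    by_contra hc
    push Not at hc
    have := Real.log_nonpos hx'0.le hc.le
    linarith
  have hYZ : 2 * L^(1-ε) ≤ L^(1-μ) := by
    calc 2 * L^(1-ε) ≤ L^(ε-μ) * L^(1-ε) := by gcongr
      _ = L^(1-μ) := by rw [← Real.rpow_add hL0]; congr 1; ring
  have hqx : q / x' ≤ L^(-1:ℝ) := by
    refine le_trans ?_ f3
    have hxe : x = Real.exp L := by rw [hL, Real.exp_log hx0]
    calc q / x' ≤ L^C / (x * L^(-C)) := by gcongr
      _ = _ := by
        rw [hxe, Real.exp_neg, Real.rpow_neg hL0.le]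
        have := Real.exp_pos L
        field_simp
  have hb : IsUnit (A : ZMod q) := by
    rw [ZMod.coe_int_isUnit_iff_isCoprime]
    exact Int.isCoprime_iff_gcd_eq_one.2 hg
  have hc := N_core δ h0 h1 he hμ hL1 f4 f5 f6 hYZ hq (A : ZMod q) hb hpf
    (le_trans (by gcongr) f2) hx'1 hxu.le hL.symm hyL (by linarith) hqx
  simp only [Int.cast_natCast, ← hL]
  refine hc.trans ?_
  refine (mul_le_mul_of_nonneg_left pf (show 0 ≤ KH ε + 4 * (8 * Real.exp 33 + 1) + 8 by positivity)).trans (le_of_eq ?_)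
  ring

lemma O_III (δ : ℝ) (h0 : 0 < δ) : ∃ x₀ : ℝ, ∀ x ≥ x₀, δ/2 ≤ (1 / x) *
    ∑ p ∈ (Icc 1 ⌊x⌋₊).filter Nat.Prime, |(fun n : ℕ => δ^n.primeFactors.card) p| * Real.log p := by
  have h := (isLittleO_log_rpow_atTop (show (0:ℝ) < 1/2 by norm_num)).bound (c := 1/40) (by norm_num)
  obtain ⟨x₀, hx₀⟩ := eventually_atTop.1 (h.and (eventually_ge_atTop (10:ℝ)))
  refine ⟨x₀, fun x hx => ?_⟩
  obtain ⟨a, hx10⟩ := hx₀ x hx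
  have hl0 : 0 ≤ Real.log x := Real.log_nonneg (by linarith)
  rw [← Real.sqrt_eq_rpow, Real.norm_of_nonneg hl0, Real.norm_of_nonneg (Real.sqrt_nonneg x)] at a
  have hs0 := Real.sqrt_nonneg x
  have hss := Real.mul_self_sqrt (show 0 ≤ x by linarith)
  have hs1 : Real.sqrt x ≤ x := by
    have : 1 ≤ Real.sqrt x := Real.one_le_sqrt.2 (by linarith)
    nlinarith
  have ht := Chebyshev.theta_ge' (x := x) (by linarith)
  have hb : Real.log (x+2) ≤ 2 * Real.log x := by
    rw [← Real.log_rpow (by linarith)]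
    apply Real.log_le_log (by linarith)
    norm_num; nlinarith
  have hc : Real.sqrt x * Real.log x ≤ x / 40 := by nlinarith
  have hlog2 := Real.log_two_gt_d9
  have hth : x/2 ≤ Chebyshev.theta x := by nlinarith
  have e : ∑ p ∈ (Icc 1 ⌊x⌋₊).filter Nat.Prime, |(fun n : ℕ => δ^n.primeFactors.card) p| * Real.log p = δ * Chebyshev.theta x := by
    rw [Chebyshev.theta, Finset.mul_sum]
    apply Finset.sum_congr
    · ext p; simp [Nat.succ_le_iff]
    · intro p hp
      have hpp : p.Prime := (Finset.mem_filter.1 hp).2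
      simp [hpp.primeFactors, abs_of_pos h0]
  rw [e, one_div, inv_mul_eq_div, le_div_iff₀ (by linarith)]
  nlinarith

lemma O_abs (δ : ℝ) (h0 : 0 < δ) (h1 : δ < 1) (n : ℕ) : |δ^n.primeFactors.card| ≤ 1 := by
  rw [abs_of_nonneg (by positivity)]
  exact pow_le_one₀ h0.le h1.le

/-- For `δ ∈ (0,1)`, the multiplicative function `h(n) = δ^{ω(n)}` (where `ω(n)`
is the number of distinct prime factors of `n`) belongs to the class `𝓜`. -/
theorem stmt_17 (δ : ℝ) (hδ0 : 0 < δ) (hδ1 : δ < 1) :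
    MemM (fun n => δ ^ n.primeFactors.card) := by
  refine ⟨⟨by simp, fun m n hmn => ?_⟩, ⟨1, le_rfl, fun p k _ _ => ?_⟩, fun ε hε => ⟨1, one_pos, fun n hn => ?_⟩,
    ⟨δ/2, by positivity, O_III δ hδ0⟩, fun C hC => O_IV δ hδ0 hδ1 C hC⟩
  · show δ ^ (m * n).primeFactors.card = δ ^ m.primeFactors.card * δ ^ n.primeFactors.card
    rw [hmn.primeFactors_mul, Finset.card_union_of_disjoint hmn.disjoint_primeFactors, pow_add]
  · rw [one_pow]; exact O_abs δ hδ0 hδ1 _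
  · rw [one_mul]
    exact (O_abs δ hδ0 hδ1 n).trans (Real.one_le_rpow (by exact_mod_cast hn) hε.le)

end
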